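/- Let q > 3 be a prime power and n >= 14 a positive integer. Then there always exists an element α in F_{q^n}* such that both α and α^{-1} are simultaneously primitive and 1-normal over F_q. -/

import Mathlib

open Polynomial

noncomputable section

/-- The action `h ∘ β = Σ_i a_i β^{q^i}` of a polynomial `h = Σ_i a_i x^i` over `F_q`
on an element `β` of an extension field. -/
def polyAct {Fq F : Type*} [Field Fq] [Field F] [Algebra Fq F]
    (q : ℕ) (h : Fq[X]) (β : F) : F :=
  h.sum fun i a => algebraMap Fq F a * β ^ q ^ i

/-- `h` is the `F_q`-order of `β`: the monic divisor of `x^n - 1` of least degree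
annihilating `β`. -/
def IsFqOrder {Fq F : Type*} [Field Fq] [Field F] [Algebra Fq F]
    (q n : ℕ) (h : Fq[X]) (β : F) : Prop :=
  h.Monic ∧ h ∣ (X ^ n - 1 : Fq[X]) ∧ polyAct q h β = 0 ∧
    ∀ h' : Fq[X], h'.Monic → h' ∣ (X ^ n - 1 : Fq[X]) → polyAct q h' β = 0 →
      h.natDegree ≤ h'.natDegree

/-- `α` is `k`-normal over `F_q`: its `F_q`-order has degree `n - k`. -/
def IsKNormal (Fq : Type*) {F : Type*} [Field Fq] [Field F] [Algebra Fq F]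
    (q n k : ℕ) (α : F) : Prop :=
  ∃ h : Fq[X], IsFqOrder q n h α ∧ h.natDegree = n - k

section Stepanov

theorem stepanov_sum_ne_zero {L : Type*} [Field L] {q E I : ℕ} (hq : 2 ≤ q) (hE : 0 < E)
    {t : L[X]} (ht0 : t ≠ 0) (ht : t.natDegree = 2 * (q - 1) * E)
    (a : Fin I × Fin q → L[X]) (ha : ∀ x, (a x).natDegree < E) (hne : a ≠ 0) :
    ∑ x, a x * (X ^ (q * E * x.1) * (t ^ (x.2 : ℕ) *
      X ^ ((q - 1) * E * (q - 1 - x.2)))) ≠ 0 := by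
  classical
  obtain ⟨D, rfl⟩ : ∃ D, q = D + 1 := ⟨q - 1, by omega⟩
  simp only [Nat.add_sub_cancel] at *
  set f : Fin I × Fin (D + 1) → L[X] := fun x => a x * (X ^ ((D + 1) * E * x.1) *
    (t ^ (x.2 : ℕ) * X ^ (D * E * (D - x.2)))) with hf
  have hdeg : ∀ x, a x ≠ 0 → (f x).natDegree =
      (a x).natDegree + E * ((D + 1) * x.1 + D * x.2 + D * D) := by
    intro x hx
    have h2 := x.2.2
    obtain ⟨c, hc⟩ : ∃ c, D = x.2 + c := ⟨D - x.2, by omega⟩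
    have hc' : D - x.2 = c := by omega
    rw [hf]
    simp only
    rw [natDegree_mul hx (by simp [ht0]), natDegree_mul (by simp) (by simp [ht0]),
      natDegree_mul (by simp [ht0]) (by simp)]
    simp only [natDegree_pow, natDegree_X, ht, hc']
    have : D * D = D * x.2 + D * c := by rw [← mul_add, ← hc]
    rw [this]; ring
  have key : degree (Finset.univ.sum f) = Finset.univ.sup fun i => degree (f i) := by
    apply degree_sum_eq_of_disjoint
    intro x hx y hy hxy h
    have hax : a x ≠ 0 := fun h0 => hx.2 (by simp [hf, h0])
    have hay : a y ≠ 0 := fun h0 => hy.2 (by simp [hf, h0])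
    apply hxy
    have h1 : (f x).natDegree = (f y).natDegree := natDegree_eq_of_degree_eq h
    rw [hdeg x hax, hdeg y hay] at h1
    have h3 : (D + 1) * x.1 + D * x.2 + D * D = (D + 1) * y.1 + D * y.2 + D * D := by
      have e1 := Nat.add_mul_div_left (a x).natDegree
        ((D + 1) * x.1 + D * x.2 + D * D) hE
      have e2 := Nat.add_mul_div_left (a y).natDegree
        ((D + 1) * y.1 + D * y.2 + D * D) hE
      rw [Nat.div_eq_of_lt (ha x)] at e1
      rw [Nat.div_eq_of_lt (ha y)] at e2
      rw [h1] at e1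
      omega
    have h4 : (x.2 : ℕ) = y.2 := by
      have b1 := x.2.2
      have b2 := y.2.2
      have : ((D + 1 : ℕ) : ℤ) ∣ (x.2 : ℤ) - y.2 := by
        refine ⟨x.1 + x.2 - y.1 - y.2, ?_⟩
        have h3' : ((D : ℤ) + 1) * x.1 + D * x.2 + D * D
          = (D + 1) * y.1 + D * y.2 + D * D := by exact_mod_cast h3
        push_cast; linarith
      have := Int.eq_zero_of_abs_lt_dvd this (by rw [abs_lt]; push_cast; constructor <;> omega)
      omega
    have h5 : (x.1 : ℕ) = y.1 := by
      rw [h4] at h3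
      have : (D + 1) * (x.1 : ℕ) = (D + 1) * y.1 := by omega
      exact Nat.eq_of_mul_eq_mul_left (by omega) this
    exact Prod.ext (Fin.ext h5) (Fin.ext h4)
  obtain ⟨x, hx⟩ := Function.ne_iff.mp hne
  have hfx : f x ≠ 0 := by
    simp only [hf]
    exact mul_ne_zero hx (by simp [ht0])
  intro h0
  have : degree (f x) ≤ degree (Finset.univ.sum f) := by
    rw [key]; exact Finset.le_sup (f := fun i => degree (f i)) (Finset.mem_univ x)
  rw [h0, degree_zero, le_bot_iff, degree_eq_bot] at this
  exact hfx this

end Stepanov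

theorem exists_stepanov_coeffs {L : Type*} [Field L] {q E I : ℕ} (hI : I = E + 2 * (q - 1) + 2)
    (hE : q ≤ E) (hq : 2 ≤ q)
    {t : L[X]} (ht : t.natDegree ≤ 2 * (q - 1) * E) :
    ∃ b : Fin I × Fin q → L[X], (∀ x, (b x).natDegree < E) ∧ b ≠ 0 ∧
      ∑ x, expand L (q * E) (b x) * (X ^ (x.1 : ℕ) * (t ^ (x.2 : ℕ) *
      X ^ ((q - 1) * E * (q - 1 - x.2)))) = 0 := by
  classical
  set N := q * E * E + I + 2 * (q - 1) * (q * E) with hN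
  let M : (Fin I × Fin q → degreeLT L E) →ₗ[L] L[X] :=
    { toFun := fun b => ∑ x, expand L (q * E) (b x : L[X]) * (X ^ (x.1 : ℕ) * (t ^ (x.2 : ℕ) *
        X ^ ((q - 1) * E * (q - 1 - x.2))))
      map_add' := by
        intro b c
        simp only [Pi.add_apply, Submodule.coe_add, map_add, add_mul, Finset.sum_add_distrib]
      map_smul' := by
        intro r b
        simp only [Pi.smul_apply, Submodule.coe_smul, map_smul, smul_mul_assoc,
          Finset.smul_sum, RingHom.id_apply] }
  have hEpos : 0 < E := by omega
  have hlt : ∀ p : degreeLT L E, (p : L[X]).natDegree < E := by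
    intro p
    have h := mem_degreeLT.mp p.2
    by_cases h0 : (p : L[X]) = 0
    · rw [h0]; simpa using hEpos
    · exact (natDegree_lt_iff_degree_lt h0).mpr h
  have hM : ∀ b, M b ∈ degreeLT L N := by
    intro b
    apply Submodule.sum_mem
    intro x _
    rw [mem_degreeLT]
    refine lt_of_le_of_lt degree_le_natDegree ?_
    norm_cast
    have h1 := hlt (b x)
    have h2 := x.2.2
    have h3 := x.1.2
    calc _ ≤ (E - 1) * (q * E) + (x.1 + (x.2 * (2 * (q - 1) * E) + (q - 1) * E * (q - 1 - x.2))) := by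
          refine natDegree_mul_le_of_le ?_ (natDegree_mul_le_of_le (by simp)
            (natDegree_mul_le_of_le (natDegree_pow_le_of_le _ ht) (by simp)))
          rw [natDegree_expand]
          exact Nat.mul_le_mul_right _ (by omega)
      _ < N := by
          obtain ⟨c, hc⟩ : ∃ c, q = x.2 + 1 + c := ⟨q - 1 - x.2, by omega⟩
          have hc1 : q - 1 - x.2 = c := by omega
          have hc2 : q - 1 = x.2 + c := by omega
          obtain ⟨e, rfl⟩ : ∃ e, E = e + 1 := ⟨E - 1, by omega⟩
          have h4 : (x.2 * (2 * (q - 1) * (e + 1)) + (q - 1) * (e + 1) * (q - 1 - x.2))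
            ≤ 2 * (q - 1) * (q * (e + 1)) := by
            rw [hc1, hc2]
            generalize (x.2 : ℕ) = j at *
            rw [hc]
            nlinarith [Nat.zero_le ((j + c) * (e + 1) * c), Nat.zero_le ((j + c) * (e + 1))]
          have h5 : (e + 1 - 1) * (q * (e + 1)) ≤ q * (e + 1) * (e + 1) := by
            rw [Nat.add_sub_cancel, mul_comm]; exact Nat.mul_le_mul_left _ (by omega)
          omega
  have hfr : ∀ k, Module.finrank L (degreeLT L k) = k := by
    intro k
    rw [(degreeLTEquiv L k).finrank_eq]; simp
  have hfd : ∀ k, FiniteDimensional L (degreeLT L k) := fun k =>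
    (degreeLTEquiv L k).symm.finiteDimensional
  have hker : LinearMap.ker (M.codRestrict _ hM) ≠ ⊥ := by
    apply LinearMap.ker_ne_bot_of_finrank_lt
    rw [hfr, Module.finrank_pi_fintype]
    simp only [hfr, Finset.sum_const, Finset.card_univ, Fintype.card_prod, Fintype.card_fin,
      smul_eq_mul]
    have : I * q * E = q * E * E + 2 * (q - 1) * (q * E) + 2 * (q * E) := by rw [hI]; ring
    have h6 : 2 * E ≤ q * E := Nat.mul_le_mul_right _ hq
    omega
  obtain ⟨b, hb, hb0⟩ := (Submodule.ne_bot_iff _).mp hker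
  refine ⟨fun x => b x, fun x => hlt _, ?_, ?_⟩
  · intro h
    exact hb0 (funext fun x => Subtype.ext (congrFun h x))
  · have := congrArg Subtype.val (LinearMap.mem_ker.mp hb)
    simpa [M] using this

/-- The numerator of the half trace of `A z^(q-1) + B z^(-(q-1)) - w`. -/
noncomputable def halfTracePoly {L : Type*} [Field L] (q ν : ℕ) (A B w : L) : L[X] :=
  ∑ k ∈ Finset.range (ν + 1), (C (A ^ q ^ k) * X ^ ((q - 1) * (q ^ ν + q ^ k)) +
    C (B ^ q ^ k) * X ^ ((q - 1) * (q ^ ν - q ^ k)) - C (w ^ q ^ k) * X ^ ((q - 1) * q ^ ν))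

theorem coeff_halfTracePoly {L : Type*} [Field L] {q ν : ℕ} (hq : 2 ≤ q) (A B w : L) :
    (halfTracePoly q ν A B w).coeff (2 * (q - 1) * q ^ ν) = A ^ q ^ ν := by
  have hE : 0 < q ^ ν := by positivity
  have hD : 0 < q - 1 := by omega
  have hDE : 0 < (q - 1) * q ^ ν := by positivity
  have e : 2 * (q - 1) * q ^ ν = (q - 1) * (q ^ ν + q ^ ν) := by ring
  have h1 : ∀ k, (q - 1) * (q ^ ν + q ^ ν) ≠ (q - 1) * (q ^ ν - q ^ k) := by
    intro k h
    have := Nat.eq_of_mul_eq_mul_left hD h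
    have := Nat.sub_le (q ^ ν) (q ^ k)
    omega
  have h2 : (q - 1) * (q ^ ν + q ^ ν) ≠ (q - 1) * (q ^ ν) := by
    intro h
    have := Nat.eq_of_mul_eq_mul_left hD h
    omega
  rw [halfTracePoly, finsetSum_coeff, e, Finset.sum_range_succ, Finset.sum_eq_zero]
  · simp only [coeff_sub, coeff_add, coeff_C_mul, coeff_X_pow, if_neg (h1 _), if_neg h2]
    simp
  · intro k hk
    have h3 : (q - 1) * (q ^ ν + q ^ ν) ≠ (q - 1) * (q ^ ν + q ^ k) := by
      intro h
      have := Nat.eq_of_mul_eq_mul_left hD h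
      have : q ^ k < q ^ ν := Nat.pow_lt_pow_right (by omega) (Finset.mem_range.mp hk)
      omega
    simp only [coeff_sub, coeff_add, coeff_C_mul, coeff_X_pow, if_neg (h1 _), if_neg h2, if_neg h3]
    simp

theorem natDegree_halfTracePoly {L : Type*} [Field L] {q ν : ℕ} (hq : 2 ≤ q) {A : L} (hA : A ≠ 0)
    (B w : L) : (halfTracePoly q ν A B w).natDegree = 2 * (q - 1) * q ^ ν := by
  apply le_antisymm
  · apply natDegree_sum_le_of_forall_le
    intro k hk
    have : q ^ k ≤ q ^ ν := Nat.pow_le_pow_right (by omega)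
      (Nat.lt_succ_iff.mp (Finset.mem_range.mp hk))
    have e : 2 * (q - 1) * q ^ ν = (q - 1) * (q ^ ν + q ^ ν) := by ring
    rw [e]
    refine natDegree_sub_le_of_le (natDegree_add_le_of_degree_le ?_ ?_) ?_ |>.trans
      (max_self ((q - 1) * (q ^ ν + q ^ ν))).le <;>
    · refine (natDegree_C_mul_X_pow_le _ _).trans (Nat.mul_le_mul_left _ ?_)
      omega
  · apply le_natDegree_of_ne_zero
    rw [coeff_halfTracePoly hq]
    exact pow_ne_zero _ hA

theorem eval_halfTracePoly {L : Type*} [Field L] {p r ν : ℕ} [Fact p.Prime] [CharP L p]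
    (A B w : L) {z : L} (hz : z ≠ 0) :
    (halfTracePoly (p ^ r) ν A B w).eval z = z ^ ((p ^ r - 1) * (p ^ r) ^ ν) *
      ∑ k ∈ Finset.range (ν + 1),
        (A * z ^ (p ^ r - 1) + B * z⁻¹ ^ (p ^ r - 1) - w) ^ (p ^ r) ^ k := by
  rw [halfTracePoly, eval_finsetSum, Finset.mul_sum]
  refine Finset.sum_congr rfl fun k hk => ?_
  have hle : (p ^ r) ^ k ≤ (p ^ r) ^ ν := Nat.pow_le_pow_right (pow_pos (Fact.out : p.Prime).pos _)
    (Nat.lt_succ_iff.mp (Finset.mem_range.mp hk))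
  have hk' : (p ^ r) ^ k = p ^ (r * k) := by rw [pow_mul]
  rw [hk'] at hle ⊢
  rw [sub_pow_char_pow, add_pow_char_pow]
  simp only [eval_sub, eval_add, eval_mul, eval_C, eval_pow, eval_X]
  obtain ⟨c, hc⟩ : ∃ c, (p ^ r) ^ ν = p ^ (r * k) + c := ⟨_, (Nat.add_sub_cancel' hle).symm⟩
  rw [hc, Nat.add_sub_cancel_left]
  have hz2 : z ^ ((p ^ r - 1) * (p ^ (r * k) + c)) * (z⁻¹ ^ (p ^ r - 1)) ^ p ^ (r * k)
    = z ^ ((p ^ r - 1) * c) := by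
    rw [← pow_mul, mul_add, pow_add, mul_right_comm, ← mul_pow, mul_inv_cancel₀ hz, one_pow,
      one_mul]
  have hz3 : z ^ ((p ^ r - 1) * (p ^ (r * k) + c + p ^ (r * k)))
    = z ^ ((p ^ r - 1) * (p ^ (r * k) + c)) * (z ^ (p ^ r - 1)) ^ p ^ (r * k) := by
    rw [← pow_mul, ← pow_add, ← mul_add]
  rw [mul_pow, mul_pow, ← hz2, hz3]
  generalize z ^ ((p ^ r - 1) * (p ^ (r * k) + c)) = u
  generalize (z ^ (p ^ r - 1)) ^ p ^ (r * k) = v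
  generalize (z⁻¹ ^ (p ^ r - 1)) ^ p ^ (r * k) = v'
  ring

theorem card_trace_eq_zero_le {L : Type*} [Field L] [Fintype L] [DecidableEq L] {p r ν : ℕ}
    [Fact p.Prime] [CharP L p] (hr : r ≠ 0) (hν : 1 ≤ ν)
    (hcard : Fintype.card L = (p ^ r) ^ (2 * (ν + 1))) {A : L} (hA : A ≠ 0) (B w : L) :
    (Finset.univ.filter fun z : L => z ≠ 0 ∧ ∑ k ∈ Finset.range (2 * (ν + 1)),
        (A * z ^ (p ^ r - 1) + B * z⁻¹ ^ (p ^ r - 1) - w) ^ (p ^ r) ^ k = 0).card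
      ≤ (p ^ r) ^ (2 * ν + 1) + 4 * p ^ r * (p ^ r) ^ (ν + 1) := by
  set q := p ^ r with hqdef
  have hq : 2 ≤ q := (Fact.out : p.Prime).two_le.trans (Nat.le_self_pow hr p)
  set E := q ^ ν with hEdef
  set s := q * E with hs
  have hsp : s = p ^ (r * (ν + 1)) := by rw [hs, hEdef, hqdef, ← pow_mul, ← pow_add]; ring_nf
  have hEq : q ≤ E := by simpa using Nat.pow_le_pow_right (by omega) hν
  set t := halfTracePoly q ν A B w with ht
  have htd : t.natDegree = 2 * (q - 1) * E := natDegree_halfTracePoly hq hA B w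
  have ht0 : t ≠ 0 := by
    intro h0
    rw [h0] at htd
    have : 0 < 2 * (q - 1) * E := by
      have : 0 < q - 1 := by omega
      have : 0 < E := by omega
      positivity
    simp at htd
    omega
  set I := E + 2 * (q - 1) + 2 with hI
  obtain ⟨b, hb, hb0, hsum⟩ := exists_stepanov_coeffs (I := I) hI hEq hq (t := -t)
    (by rw [natDegree_neg, htd])
  have hss : ∀ x : L, (x ^ s) ^ s = x := by
    intro x
    have : s * s = Fintype.card L := by rw [hcard, hs, hEdef]; ring
    rw [← pow_mul, this, FiniteField.pow_card]
  let φ : L →+* L := iterateFrobenius L p (r * (ν + 1))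
  have hφ : ∀ x, φ x = x ^ s := fun x => by rw [iterateFrobenius_def, ← hsp]
  have hφφ : φ.comp φ = RingHom.id L := by
    ext x; simp [hφ, hss]
  let a : Fin I × Fin q → L[X] := fun x => (b x).map φ
  have hab : ∀ x, (a x).map φ = b x := fun x => by
    simp only [a, Polynomial.map_map, hφφ, Polynomial.map_id]
  have ha : ∀ x, (a x).natDegree < E := fun x => (natDegree_map_le).trans_lt (hb x)
  have ha0 : a ≠ 0 := by
    intro h
    apply hb0
    funext x
    rw [← hab, h]; simp
  have hH := stepanov_sum_ne_zero hq (by omega) ht0 htd a ha ha0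
  set H := ∑ x, a x * (X ^ (q * E * x.1) * (t ^ (x.2 : ℕ) *
      X ^ ((q - 1) * E * (q - 1 - x.2)))) with hHdef
  have hHd : H.natDegree ≤ q ^ (2 * ν + 1) + 4 * q * q ^ (ν + 1) := by
    apply natDegree_sum_le_of_forall_le
    intro x _
    have h1 := ha x
    have h2 := x.2.2
    have h3 := x.1.2
    calc _ ≤ (E - 1) + (q * E * x.1 + (x.2 * (2 * (q - 1) * E) + (q - 1) * E * (q - 1 - x.2))) := by
          refine natDegree_mul_le_of_le (by omega) (natDegree_mul_le_of_le (by simp)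
            (natDegree_mul_le_of_le (natDegree_pow_le_of_le _ htd.le) (by simp)))
      _ ≤ E * 1 + (q * E * (E + 2 * (q - 1) + 1) + (q - 1) * (2 * (q - 1) * E)) := by
          have h4 : q * E * x.1 ≤ q * E * (E + 2 * (q - 1) + 1) :=
            Nat.mul_le_mul_left _ (by omega)
          have h5 : x.2 * (2 * (q - 1) * E) + (q - 1) * E * (q - 1 - x.2)
              ≤ (q - 1) * (2 * (q - 1) * E) := by
            obtain ⟨c, hc⟩ : ∃ c, q - 1 = x.2 + c := ⟨q - 1 - x.2, by omega⟩
            have hc1 : q - 1 - x.2 = c := by omega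
            rw [hc1, hc]
            nlinarith [Nat.zero_le ((x.2 + c) * E * c)]
          omega
      _ ≤ E * q + (q * E * (E + 2 * (q - 1) + 1) + q * (2 * (q - 1) * E)) := by
          gcongr <;> omega
      _ ≤ _ := by
          have e1 : q ^ (2 * ν + 1) = q * E * E := by rw [hEdef]; ring
          have e2 : q ^ (ν + 1) = q * E := by rw [hEdef]; ring
          rw [e1, e2]
          obtain ⟨D, hD⟩ : ∃ D, q = D + 1 := ⟨q - 1, by omega⟩
          have hD' : q - 1 = D := by omega
          rw [hD', hD]
          nlinarith [Nat.zero_le ((D + 1) * E)]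
  refine le_trans (le_trans (Finset.card_le_card (t := H.roots.toFinset) ?_)
    (Multiset.toFinset_card_le _)) ((card_roots' H).trans hHd)
  intro z hz
  obtain ⟨hz0, hz⟩ := (Finset.mem_filter.mp hz).2
  rw [Multiset.mem_toFinset, mem_roots hH, IsRoot.def]
  set S := ∑ k ∈ Finset.range (ν + 1),
        (A * z ^ (q - 1) + B * z⁻¹ ^ (q - 1) - w) ^ q ^ k with hS
  have hSs : S ^ s = -S := by
    rw [two_mul, Finset.sum_range_add, ← hS] at hz
    rw [eq_neg_iff_add_eq_zero, add_comm, ← hz, ← hφ, hS, map_sum]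
    congr 1
    refine Finset.sum_congr rfl fun k _ => ?_
    rw [hφ, ← pow_mul]
    congr 1
    rw [hs, hEdef]; ring
  have hv : t.eval z = z ^ ((q - 1) * E) * S := eval_halfTracePoly A B w hz0
  have hG := congrArg (fun P => z ^ (s * ((q - 1) * E * (q - 1))) * eval z P) hsum
  simp only [eval_finsetSum, eval_mul, expand_eval, eval_pow, eval_X, eval_neg, hv,
    eval_zero, mul_zero] at hG
  have hφH : φ (H.eval z) * z ^ ((q - 1) * E * (q - 1)) = 0 := by
    rw [← hG, hHdef]
    simp only [eval_finsetSum, eval_mul, eval_pow, eval_X, hv, map_sum, Finset.mul_sum,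
      Finset.sum_mul, map_mul, map_pow]
    refine Finset.sum_congr rfl fun x _ => ?_
    have h1 : φ ((a x).eval z) = (b x).eval (z ^ s) := by
      rw [← hφ z, ← eval₂_hom, ← eval_map, hab]
    rw [h1, hφ z, hφ S, hSs, pow_mul _ (q * E), ← hs, hss]
    obtain ⟨c, hc⟩ : ∃ c, q - 1 = x.2 + c := ⟨q - 1 - x.2, by have := x.2.2; omega⟩
    have hc1 : q - 1 - x.2 = c := by omega
    rw [hc1]
    generalize hj : (x.2 : ℕ) = j at *
    generalize hDE : (q - 1) * E = N
    have e1 : (-(z ^ N * S)) ^ j = z ^ (N * j) * (-S) ^ j := by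
      rw [← mul_neg, mul_pow, pow_mul]
    have e2 : z ^ (s * (N * (j + c))) = z ^ (s * (N * j)) * z ^ (s * (N * c)) := by
      rw [← pow_add]; ring_nf
    have e3 : z ^ (N * (j + c)) = z ^ (N * j) * z ^ (N * c) := by rw [← pow_add]; ring_nf
    have e4 : ((z ^ s) ^ N * -S) ^ j = z ^ (s * (N * j)) * (-S) ^ j := by
      rw [mul_pow, ← pow_mul, ← pow_mul, mul_assoc]
    rw [hc, e1, e2, e3, e4, ← pow_mul]
    ring
  have := (mul_eq_zero.mp hφH).resolve_right (pow_ne_zero _ hz0)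
  exact (map_eq_zero φ).mp this

theorem MulChar.norm_apply_unit {K : Type*} [Field K] [Finite K] (χ : MulChar K ℂ) (u : Kˣ) :
    ‖χ (u : K)‖ = 1 := by
  have := Fintype.ofFinite K
  have h : (χ (u : K)) ^ (Nat.card Kˣ) = 1 := by
    rw [← map_pow, ← Units.val_pow_eq_pow_val, pow_card_eq_one', Units.val_one, map_one]
  exact Complex.norm_eq_one_of_pow_eq_one h Nat.card_pos.ne'

section ExpSum
variable {K L : Type*} [Field K] [Field L] [Fintype K] [Fintype L] [Algebra K L]
  [DecidableEq L]

theorem card_trace_eq_le {ν : ℕ} (hν : 1 ≤ ν) (hfr : Module.finrank K L = 2 * (ν + 1))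
    {A : L} (hA : A ≠ 0) (B : L) (c : K) [DecidableEq K] :
    (Finset.univ.filter fun z : Lˣ => Algebra.trace K L (A * z ^ (Fintype.card K - 1) +
      B * (z⁻¹ : Lˣ) ^ (Fintype.card K - 1)) = c).card ≤
    Fintype.card K ^ (2 * ν + 1) + 4 * Fintype.card K * Fintype.card K ^ (ν + 1) := by
  classical
  obtain ⟨p, hp⟩ := CharP.exists K
  have : Fact p.Prime := ⟨CharP.char_is_prime K p⟩
  obtain ⟨r, -, hr⟩ := FiniteField.card K p
  have : CharP L p := charP_of_injective_algebraMap (algebraMap K L).injective p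
  obtain ⟨w, hw⟩ := Algebra.trace_surjective K L c
  have hcard : Fintype.card L = (p ^ (r : ℕ)) ^ (2 * (ν + 1)) := by
    rw [Module.card_eq_pow_finrank (K := K), hfr, hr]
  have key := card_trace_eq_zero_le r.ne_zero hν hcard hA B w
  rw [hr]
  refine le_trans (Finset.card_le_card_of_injOn (fun z : Lˣ => (z : L)) ?_
    Units.val_injective.injOn) key
  intro z hz
  have hz := (Finset.mem_filter.mp hz).2
  rw [Finset.coe_filter, Set.mem_ofPred_eq]
  refine ⟨Finset.mem_univ _, z.ne_zero, ?_⟩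
  have h := FiniteField.algebraMap_trace_eq_sum_pow K L
    (A * (z : L) ^ (p ^ (r : ℕ) - 1) + B * (z : L)⁻¹ ^ (p ^ (r : ℕ) - 1) - w)
  rw [hfr, Nat.card_eq_fintype_card, hr] at h
  rw [← h, map_sub]
  simp only [Units.val_inv_eq_inv_val] at hz
  rw [hz, hw, sub_self, map_zero]

theorem norm_sum_addChar_trace_le {ν : ℕ} (hν : 1 ≤ ν) (hfr : Module.finrank K L = 2 * (ν + 1))
    {A : L} (hA : A ≠ 0) (B : L) {ψ : AddChar K ℂ} (hψ : ψ ≠ 1) :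
    ‖∑ z : Lˣ, ψ (Algebra.trace K L (A * z ^ (Fintype.card K - 1) +
      B * (z⁻¹ : Lˣ) ^ (Fintype.card K - 1)))‖ ≤
      (4 * (Fintype.card K : ℝ) ^ 2 + 1) * (Fintype.card K : ℝ) ^ (ν + 1) := by
  classical
  set Q := Fintype.card K with hQ
  set g : Lˣ → K := fun z => Algebra.trace K L (A * z ^ (Q - 1) + B * (z⁻¹ : Lˣ) ^ (Q - 1)) with hg
  set M := Q ^ (2 * ν + 1) + 4 * Q * Q ^ (ν + 1) with hM
  set N : K → ℕ := fun c => (Finset.univ.filter fun z : Lˣ => g z = c).card with hN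
  have hNM : ∀ c, N c ≤ M := fun c => card_trace_eq_le hν hfr hA B c
  have hsumN : ∑ c, N c = Q ^ (2 * (ν + 1)) - 1 := by
    rw [hQ, ← hfr, ← Module.card_eq_pow_finrank (K := K) (V := L), ← Fintype.card_units,
      ← Finset.card_univ, Finset.card_eq_sum_card_fiberwise (f := g) (t := Finset.univ)]
    intro x _; simp
  have h1 : ∑ z : Lˣ, ψ (g z) = ∑ c, (N c : ℂ) * ψ c := by
    rw [← Finset.sum_fiberwise_of_maps_to (s := Finset.univ) (t := Finset.univ) (g := g)
      (fun _ _ => Finset.mem_univ _)]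
    refine Finset.sum_congr rfl fun c _ => ?_
    rw [Finset.sum_congr rfl (g := fun _ => ψ c), Finset.sum_const, nsmul_eq_mul]
    intro z hz
    rw [(Finset.mem_filter.mp hz).2]
  have h2 : ∑ c, (N c : ℂ) * ψ c = - ∑ c, ((M : ℂ) - N c) * ψ c := by
    simp only [sub_mul, Finset.sum_sub_distrib, ← Finset.mul_sum]
    rw [AddChar.sum_eq_zero_of_ne_one hψ]; ring
  have h3 : ‖∑ c, ((M : ℂ) - N c) * ψ c‖ ≤ ∑ c, ((M : ℝ) - N c) := by
    refine norm_sum_le_of_le _ fun c _ => ?_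
    rw [norm_mul, AddChar.norm_apply, mul_one, ← Nat.cast_sub (hNM c), Complex.norm_natCast,
      Nat.cast_sub (hNM c)]
  have hQ1 : 1 ≤ Q := Fintype.card_pos
  rw [show (∑ z : Lˣ, ψ (Algebra.trace K L (A * z ^ (Q - 1) + B * (z⁻¹ : Lˣ) ^ (Q - 1))))
    = ∑ z : Lˣ, ψ (g z) from rfl, h1, h2, norm_neg]
  refine h3.trans ?_
  rw [Finset.sum_sub_distrib, Finset.sum_const, Finset.card_univ, ← hQ,
    nsmul_eq_mul, ← Nat.cast_sum, hsumN, Nat.cast_sub (Nat.one_le_pow _ _ hQ1), hM]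
  push_cast
  have : (1 : ℝ) ≤ (Q : ℝ) ^ (ν + 1) := one_le_pow₀ (by exact_mod_cast hQ1)
  ring_nf at this ⊢
  linarith

/-- The twisted Kloosterman sum over an extension `L` of `K`. -/
noncomputable def kloostermanSum (K L : Type*) [Field K] [Field L] [Fintype Lˣ]
    [Algebra K L] (χ : MulChar K ℂ) (ψ : AddChar K ℂ) (a b : K) : ℂ :=
  ∑ x : Lˣ, χ (Algebra.norm K (x : L)) *
    ψ (Algebra.trace K L (algebraMap K L a * x + algebraMap K L b * (x⁻¹ : Lˣ)))

theorem norm_kloostermanSum_le {ν : ℕ} (hν : 1 ≤ ν) (hfr : Module.finrank K L = 2 * (ν + 1))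
    (χ : MulChar K ℂ) {ψ : AddChar K ℂ} (hψ : ψ ≠ 1) {a : K} (ha : a ≠ 0) (b : K) :
    ‖kloostermanSum K L χ ψ a b‖ ≤
      (4 * (Fintype.card K : ℝ) ^ 2 + 1) * (Fintype.card K : ℝ) ^ (ν + 1) := by
  classical
  set Q := Fintype.card K with hQ
  set T : ℝ := (4 * (Q : ℝ) ^ 2 + 1) * (Q : ℝ) ^ (ν + 1) with hT
  have hnorm : ∀ z : Lˣ, Algebra.norm K ((z : L) ^ (Q - 1)) = 1 := by
    intro z
    rw [map_pow]
    exact FiniteField.pow_card_sub_one_eq_one _ (by simp [Algebra.norm_eq_zero_iff])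
  have h1 : ∀ z : Lˣ, kloostermanSum K L χ ψ a b = ∑ x : Lˣ, χ (Algebra.norm K (x : L)) *
      ψ (Algebra.trace K L ((algebraMap K L a * x) * z ^ (Q - 1) +
        (algebraMap K L b * (x⁻¹ : Lˣ)) * (z⁻¹ : Lˣ) ^ (Q - 1))) := by
    intro z
    rw [kloostermanSum, ← Equiv.sum_comp (Equiv.mulRight (z ^ (Q - 1)))]
    refine Fintype.sum_congr _ _ fun x => ?_
    simp only [Equiv.coe_mulRight, Units.val_mul, Units.val_pow_eq_pow_val, map_mul, mul_inv,
      hnorm, mul_one, ← inv_pow, mul_assoc]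
  have h2 : (Fintype.card Lˣ : ℂ) * kloostermanSum K L χ ψ a b =
      ∑ x : Lˣ, χ (Algebra.norm K (x : L)) * ∑ z : Lˣ,
      ψ (Algebra.trace K L ((algebraMap K L a * x) * z ^ (Q - 1) +
        (algebraMap K L b * (x⁻¹ : Lˣ)) * (z⁻¹ : Lˣ) ^ (Q - 1))) := by
    simp_rw [Finset.mul_sum]
    rw [Finset.sum_comm, ← nsmul_eq_mul, ← Finset.card_univ, ← Finset.sum_const]
    exact Finset.sum_congr rfl fun z _ => h1 z
  have h3 : ‖(Fintype.card Lˣ : ℂ) * kloostermanSum K L χ ψ a b‖ ≤ ∑ x : Lˣ, T := by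
    rw [h2]
    refine norm_sum_le_of_le _ fun x _ => ?_
    have hu : IsUnit (Algebra.norm K (x : L)) := x.isUnit.map (Algebra.norm K)
    obtain ⟨u, hu⟩ := hu
    rw [norm_mul, ← hu, MulChar.norm_apply_unit, one_mul]
    exact norm_sum_addChar_trace_le hν hfr (A := algebraMap K L a * x) (by simp [ha]) _ hψ
  rw [norm_mul, Complex.norm_natCast, Finset.sum_const, nsmul_eq_mul, Finset.card_univ] at h3
  exact le_of_mul_le_mul_left h3 (by exact_mod_cast Fintype.card_pos)

end ExpSum

section LFunction
variable {K : Type*} [Field K]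

/-- The completely multiplicative function on monic polynomials attached to a Kloosterman sum. -/
noncomputable def kloostermanCoeff (χ : MulChar K ℂ) (ψ : AddChar K ℂ) (a b : K) (g : K[X]) : ℂ :=
  χ ((-1) ^ g.natDegree * g.coeff 0) * ψ (-(a * g.nextCoeff) - b * (g.coeff 1 / g.coeff 0))

variable (χ : MulChar K ℂ) (ψ : AddChar K ℂ) (a b : K)

theorem kloostermanCoeff_one : kloostermanCoeff χ ψ a b 1 = 1 := by
  simp [kloostermanCoeff, coeff_one, nextCoeff]

theorem kloostermanCoeff_mul {g h : K[X]} (hg : g.Monic) (hh : h.Monic) :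
    kloostermanCoeff χ ψ a b (g * h) = kloostermanCoeff χ ψ a b g * kloostermanCoeff χ ψ a b h := by
  unfold kloostermanCoeff
  rw [hg.natDegree_mul hh, hg.nextCoeff_mul hh, mul_coeff_zero, mul_coeff_one, pow_add]
  by_cases hg0 : g.coeff 0 = 0
  · simp [hg0, MulChar.map_zero]
  by_cases hh0 : h.coeff 0 = 0
  · simp [hh0, MulChar.map_zero]
  have e1 : (-1 : K) ^ g.natDegree * (-1) ^ h.natDegree * (g.coeff 0 * h.coeff 0)
    = ((-1) ^ g.natDegree * g.coeff 0) * ((-1) ^ h.natDegree * h.coeff 0) := by ring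
  have e2 : -(a * (g.nextCoeff + h.nextCoeff)) -
        b * ((g.coeff 0 * h.coeff 1 + g.coeff 1 * h.coeff 0) / (g.coeff 0 * h.coeff 0))
      = (-(a * g.nextCoeff) - b * (g.coeff 1 / g.coeff 0)) +
        (-(a * h.nextCoeff) - b * (h.coeff 1 / h.coeff 0)) := by
    field_simp; ring
  rw [e1, e2, map_mul, AddChar.map_add_eq_mul]
  ring

theorem kloostermanCoeff_pow {g : K[X]} (hg : g.Monic) (m : ℕ) :
    kloostermanCoeff χ ψ a b (g ^ m) = kloostermanCoeff χ ψ a b g ^ m := by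
  induction m with
  | zero => simp [kloostermanCoeff_one]
  | succ m ih => rw [pow_succ, kloostermanCoeff_mul _ _ _ _ (hg.pow m) hg, ih, pow_succ]

variable [Finite K]

theorem finite_monic_natDegree (d : ℕ) : {g : K[X] | g.Monic ∧ g.natDegree = d}.Finite := by
  have : Module.Finite K (degreeLT K (d + 1)) := (degreeLTEquiv K (d + 1)).symm.finiteDimensional
  have : Finite (degreeLT K (d + 1)) := Module.finite_of_finite K
  refine Set.Finite.subset (Set.toFinite (degreeLT K (d + 1) : Set K[X])) ?_
  rintro g ⟨hg, rfl⟩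
  rw [SetLike.mem_coe, mem_degreeLT, degree_eq_natDegree hg.ne_zero]
  exact_mod_cast Nat.lt_succ_self _

variable (K) in
/-- Monic polynomials of degree `d` over a finite field. -/
noncomputable def monicFinset (d : ℕ) : Finset K[X] := (finite_monic_natDegree (K := K) d).toFinset

theorem mem_monicFinset {d : ℕ} {g : K[X]} : g ∈ monicFinset K d ↔ g.Monic ∧ g.natDegree = d := by
  simp [monicFinset]

/-- The coefficients of the `L`-function of a Kloosterman sum. -/
noncomputable def lCoeff (d : ℕ) : ℂ := ∑ g ∈ monicFinset K d, kloostermanCoeff χ ψ a b g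

theorem lCoeff_zero : lCoeff χ ψ a b 0 = 1 := by
  have : monicFinset K 0 = {1} := by
    ext g
    rw [mem_monicFinset, Finset.mem_singleton]
    constructor
    · rintro ⟨h, h0⟩; exact h.natDegree_eq_zero.mp h0
    · rintro rfl; simp
  rw [lCoeff, this, Finset.sum_singleton, kloostermanCoeff_one]

theorem lCoeff_eq_zero {ψ : AddChar K ℂ} (hψ : ψ ≠ 1) {a : K} (ha : a ≠ 0) (b : K) {d : ℕ}
    (hd : 3 ≤ d) : lCoeff χ ψ a b d = 0 := by
  obtain ⟨u, hu⟩ := AddChar.ne_one_iff.mp hψ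
  set t := - u / a with ht
  have hdeg : ∀ {g : K[X]} (s : K), g ∈ monicFinset K d → g + C s * X ^ (d - 1) ∈ monicFinset K d := by
    intro g s hg
    rw [mem_monicFinset] at *
    have hlt : (C s * X ^ (d - 1)).degree < g.degree := by
      rw [degree_eq_natDegree hg.1.ne_zero, hg.2]
      refine (degree_C_mul_X_pow_le _ _).trans_lt ?_
      exact_mod_cast (by omega)
    exact ⟨hg.1.add_of_left hlt, by rw [natDegree_add_eq_left_of_degree_lt hlt, hg.2]⟩
  have key : lCoeff χ ψ a b d = ψ u * lCoeff χ ψ a b d := by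
    rw [lCoeff, Finset.mul_sum]
    refine Finset.sum_bij' (fun g _ => g + C (-t) * X ^ (d - 1)) (fun g _ => g + C t * X ^ (d - 1))
      (fun g hg => hdeg _ hg) (fun g hg => hdeg _ hg) ?_ ?_ ?_
    · intro g hg; simp
    · intro g hg; simp
    · intro g hg
      have hg' := mem_monicFinset.mp (hdeg (-t) hg)
      rw [mem_monicFinset] at hg
      unfold kloostermanCoeff
      rw [hg'.2, hg.2, nextCoeff_of_natDegree_pos (by omega), nextCoeff_of_natDegree_pos (by omega),
        hg'.2, hg.2]
      have h0 : ¬ 0 = d - 1 := by omega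
      have h1 : ¬ 1 = d - 1 := by omega
      simp only [coeff_add, coeff_C_mul, coeff_X_pow, if_neg h0, if_neg h1, mul_zero, add_zero, if_true,
        mul_one]
      rw [mul_left_comm, ← AddChar.map_add_eq_mul]
      congr 2
      rw [ht]; field_simp; ring
  have : (1 - ψ u) * lCoeff χ ψ a b d = 0 := by rw [sub_mul, one_mul, ← key, sub_self]
  exact (mul_eq_zero.mp this).resolve_left (sub_ne_zero.mpr hu.symm)

end LFunction

section LFunction
variable {K : Type*} [Field K] [Finite K]

theorem finite_primePowers (k : ℕ) (hk : k ≠ 0) :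
    {x : K[X] × ℕ | x.1.Monic ∧ Irreducible x.1 ∧ x.2 * x.1.natDegree = k}.Finite := by
  refine Set.Finite.subset (((Set.finite_Iic k).biUnion fun e _ =>
    finite_monic_natDegree (K := K) e).prod (Set.finite_Iic k)) ?_
  rintro ⟨P, m⟩ ⟨h1, h2, h3⟩
  simp only [Set.mem_prod, Set.mem_iUnion, Set.mem_Iic]
  have : 0 < m := Nat.pos_of_ne_zero (by rintro rfl; simp at h3; exact hk h3.symm)
  have h4 : 0 < P.natDegree := h2.natDegree_pos
  simp only at h3
  exact ⟨⟨P.natDegree, by nlinarith, h1, rfl⟩, by nlinarith⟩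

open Classical in
variable (K) in
/-- Pairs `(P, m)` with `P` monic irreducible and `P ^ m` of degree `k`. -/
noncomputable def primePowerFinset (k : ℕ) : Finset (K[X] × ℕ) :=
  if hk : k ≠ 0 then (finite_primePowers (K := K) k hk).toFinset else ∅

theorem mem_primePowerFinset {k : ℕ} (hk : k ≠ 0) {x : K[X] × ℕ} : x ∈ primePowerFinset K k ↔
    x.1.Monic ∧ Irreducible x.1 ∧ x.2 * x.1.natDegree = k := by
  simp [primePowerFinset, hk]

open Classical in
theorem sum_natDegree_primePowers_dvd {g : K[X]} (hg : g.Monic) :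
    ∑ k ∈ Finset.Icc 1 g.natDegree, ∑ x ∈ (primePowerFinset K k).filter (fun x => x.1 ^ x.2 ∣ g),
      x.1.natDegree = g.natDegree := by
  set F := UniqueFactorizationMonoid.normalizedFactors g with hF
  have hFprod : F.prod = g := by
    have := UniqueFactorizationMonoid.prod_normalizedFactors_eq hg.ne_zero
    rw [hg.normalize_eq_self] at this
    exact this
  have hFm : ∀ P ∈ F, P.Monic := fun P hP => by
    have h1 := UniqueFactorizationMonoid.normalize_normalized_factor P hP
    rw [← h1]
    exact monic_normalize (UniqueFactorizationMonoid.irreducible_of_normalized_factor P hP).ne_zero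
  have hdeg : ∑ P ∈ F.toFinset, F.count P * P.natDegree = g.natDegree := by
    conv_rhs => rw [← hFprod, natDegree_multiset_prod_of_monic F hFm, Finset.sum_multiset_map_count]
    simp
  have hdvd : ∀ P : K[X], P.Monic → Irreducible P → ∀ m, P ^ m ∣ g ↔ m ≤ F.count P := by
    intro P hPm hP m
    rw [pow_dvd_iff_le_emultiplicity,
      UniqueFactorizationMonoid.emultiplicity_eq_count_normalizedFactors hP hg.ne_zero,
      hPm.normalize_eq_self]
    exact_mod_cast Iff.rfl
  have hcount : ∀ P ∈ F, F.count P ≤ g.natDegree := by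
    intro P hP
    have h0 : 0 < P.natDegree :=
      (UniqueFactorizationMonoid.irreducible_of_normalized_factor P hP).natDegree_pos
    have := Finset.single_le_sum (f := fun P => F.count P * P.natDegree) (fun _ _ => Nat.zero_le _)
      (Multiset.mem_toFinset.mpr hP)
    rw [hdeg] at this
    nlinarith
  set V := (F.toFinset ×ˢ Finset.Icc 1 g.natDegree).filter (fun x => x.2 ≤ F.count x.1) with hV
  have h1 : ∑ x ∈ V, x.1.natDegree = g.natDegree := by
    rw [hV, Finset.sum_filter, Finset.sum_product]
    refine Eq.trans ?_ hdeg
    refine Finset.sum_congr rfl fun P hP => ?_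
    rw [← Finset.sum_filter]
    simp only
    rw [Finset.sum_const, smul_eq_mul]
    congr 1
    have : (Finset.Icc 1 g.natDegree).filter (fun m => m ≤ F.count P) = Finset.Icc 1 (F.count P) := by
      ext m
      simp only [Finset.mem_filter, Finset.mem_Icc]
      have := hcount P (Multiset.mem_toFinset.mp hP)
      omega
    rw [this, Nat.card_Icc, Nat.add_sub_cancel]
  have hmem : ∀ x ∈ V, x.1.Monic ∧ Irreducible x.1 ∧ x.1 ^ x.2 ∣ g ∧ 1 ≤ x.2 ∧ 0 < x.1.natDegree := by
    intro x hx
    rw [hV, Finset.mem_filter, Finset.mem_product, Multiset.mem_toFinset, Finset.mem_Icc] at hx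
    have hP := UniqueFactorizationMonoid.irreducible_of_normalized_factor _ hx.1.1
    exact ⟨hFm _ hx.1.1, hP, (hdvd _ (hFm _ hx.1.1) hP _).mpr hx.2, hx.1.2.1, hP.natDegree_pos⟩
  rw [← Finset.sum_fiberwise_of_maps_to (s := V) (t := Finset.Icc 1 g.natDegree)
    (g := fun x => x.2 * x.1.natDegree)] at h1
  · conv_rhs => rw [← h1]
    refine Finset.sum_congr rfl fun k hk => ?_
    have hk0 : k ≠ 0 := by have := (Finset.mem_Icc.mp hk).1; omega
    congr 1
    ext x
    rw [Finset.mem_filter, Finset.mem_filter, mem_primePowerFinset hk0]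
    constructor
    · rintro ⟨⟨hm, hi, he⟩, hd⟩
      refine ⟨?_, he⟩
      have hc := (hdvd _ hm hi _).mp hd
      have hx2 : 1 ≤ x.2 := by
        rcases Nat.eq_zero_or_pos x.2 with h | h
        · rw [h] at he; simp at he; exact absurd he.symm hk0
        · exact h
      have hxF : x.1 ∈ F := Multiset.count_pos.mp (by omega)
      rw [hV, Finset.mem_filter, Finset.mem_product, Multiset.mem_toFinset, Finset.mem_Icc]
      exact ⟨⟨hxF, hx2, hc.trans (hcount _ hxF)⟩, hc⟩
    · rintro ⟨hx, he⟩
      obtain ⟨hm, hi, hd, -⟩ := hmem x hx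
      exact ⟨⟨hm, hi, he⟩, hd⟩
  · intro x hx
    obtain ⟨hm, hi, hd, h2, h3⟩ := hmem x hx
    rw [Finset.mem_Icc]
    refine ⟨Nat.mul_pos h2 h3, ?_⟩
    have := natDegree_le_of_dvd hd hg.ne_zero
    rwa [natDegree_pow] at this

variable (χ : MulChar K ℂ) (ψ : AddChar K ℂ) (a b : K)

/-- The power sums attached to the `L`-function of a Kloosterman sum. -/
noncomputable def lPowerSum (k : ℕ) : ℂ :=
  ∑ x ∈ primePowerFinset K k, (x.1.natDegree : ℂ) * kloostermanCoeff χ ψ a b x.1 ^ x.2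

theorem sum_dvd_kloostermanCoeff {h : K[X]} (hh : h.Monic) {d : ℕ} (hd : h.natDegree ≤ d)
    [DecidablePred fun g : K[X] => h ∣ g] :
    ∑ g ∈ (monicFinset K d).filter (fun g => h ∣ g), kloostermanCoeff χ ψ a b g =
      kloostermanCoeff χ ψ a b h * lCoeff χ ψ a b (d - h.natDegree) := by
  rw [lCoeff, Finset.mul_sum]
  symm
  refine Finset.sum_bij (fun g _ => h * g) ?_ ?_ ?_ ?_
  · intro g hg
    rw [mem_monicFinset] at hg
    rw [Finset.mem_filter, mem_monicFinset]
    refine ⟨⟨hh.mul hg.1, ?_⟩, dvd_mul_right _ _⟩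
    rw [hh.natDegree_mul hg.1, hg.2]; omega
  · intro g _ g' _ he
    exact mul_left_cancel₀ hh.ne_zero he
  · intro g hg
    rw [Finset.mem_filter, mem_monicFinset] at hg
    obtain ⟨⟨hm, hdg⟩, c, rfl⟩ := hg
    have hc := hh.of_mul_monic_left hm
    rw [hh.natDegree_mul hc] at hdg
    exact ⟨c, mem_monicFinset.mpr ⟨hc, by omega⟩, rfl⟩
  · intro g hg
    rw [kloostermanCoeff_mul _ _ _ _ hh (mem_monicFinset.mp hg).1]

theorem natCast_mul_lCoeff (d : ℕ) : (d : ℂ) * lCoeff χ ψ a b d =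
    ∑ k ∈ Finset.Icc 1 d, lPowerSum χ ψ a b k * lCoeff χ ψ a b (d - k) := by
  classical
  calc (d : ℂ) * lCoeff χ ψ a b d
      = ∑ g ∈ monicFinset K d, ∑ k ∈ Finset.Icc 1 d,
        ∑ x ∈ (primePowerFinset K k).filter (fun x => x.1 ^ x.2 ∣ g),
          (x.1.natDegree : ℂ) * kloostermanCoeff χ ψ a b g := by
        rw [lCoeff, Finset.mul_sum]
        refine Finset.sum_congr rfl fun g hg => ?_
        obtain ⟨hm, hd⟩ := mem_monicFinset.mp hg
        have h := sum_natDegree_primePowers_dvd hm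
        rw [hd] at h
        simp_rw [← Finset.sum_mul]
        congr 1
        exact_mod_cast h.symm
    _ = ∑ k ∈ Finset.Icc 1 d, lPowerSum χ ψ a b k * lCoeff χ ψ a b (d - k) := by
        rw [Finset.sum_comm]
        refine Finset.sum_congr rfl fun k hk => ?_
        rw [Finset.mem_Icc] at hk
        simp_rw [Finset.sum_filter]
        rw [Finset.sum_comm, lPowerSum, Finset.sum_mul]
        refine Finset.sum_congr rfl fun x hx => ?_
        obtain ⟨hm, hi, he⟩ := (mem_primePowerFinset (by omega)).mp hx
        have hdeg : (x.1 ^ x.2).natDegree = k := by rw [natDegree_pow, he]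
        have := sum_dvd_kloostermanCoeff χ ψ a b (hm.pow x.2) (d := d) (by omega)
        rw [hdeg, kloostermanCoeff_pow _ _ _ _ hm] at this
        rw [← Finset.sum_filter, ← Finset.mul_sum, this, mul_assoc]

end LFunction

section Link
variable {K L : Type*} [Field K] [Finite K] [Field L] [Fintype L] [Algebra K L]

open IntermediateField

theorem minpoly_inv_nextCoeff {x : L} (hx : x ≠ 0) :
    (minpoly K x⁻¹).nextCoeff = (minpoly K x).coeff 1 / (minpoly K x).coeff 0 := by
  set P := minpoly K x with hP
  have hxint : IsIntegral K x := Algebra.IsIntegral.isIntegral x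
  have hxint' : IsIntegral K x⁻¹ := Algebra.IsIntegral.isIntegral _
  have h0 : P.coeff 0 ≠ 0 := by
    rw [hP, Ne, minpoly.coeff_zero_eq_zero hxint]; exact hx
  have hPm : P.Monic := minpoly.monic hxint
  have hrd : P.reverse.natDegree = P.natDegree := by
    rw [reverse_natDegree, natTrailingDegree_eq_zero.mpr (Or.inr h0), Nat.sub_zero]
  have hlead : P.reverse.leadingCoeff = P.coeff 0 := by
    rw [reverse_leadingCoeff, trailingCoeff, natTrailingDegree_eq_zero.mpr (Or.inr h0)]
  set R := C (P.coeff 0)⁻¹ * P.reverse with hR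
  have hRm : R.Monic := by
    rw [Monic, hR, leadingCoeff_mul, leadingCoeff_C, hlead, inv_mul_cancel₀ h0]
  have hRd : R.natDegree = P.natDegree := by
    rw [hR, natDegree_C_mul (inv_ne_zero h0), hrd]
  have hroot : aeval x⁻¹ R = 0 := by
    let _ : Invertible x := invertibleOfNonzero hx
    have h1 := (eval₂_reverse_eq_zero_iff (algebraMap K L) x P).mpr (minpoly.aeval K x)
    rw [invOf_eq_inv] at h1
    rw [hR, map_mul, aeval_def x⁻¹ P.reverse, h1, mul_zero]
  have hadj : K⟮x⁻¹⟯ = K⟮x⟯ := by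
    apply le_antisymm
    · rw [adjoin_simple_le_iff]; exact inv_mem (mem_adjoin_simple_self K x)
    · rw [adjoin_simple_le_iff]
      have := inv_mem (mem_adjoin_simple_self K x⁻¹)
      rwa [inv_inv] at this
  have hdeg : (minpoly K x⁻¹).natDegree = P.natDegree := by
    rw [← adjoin.finrank hxint', ← adjoin.finrank hxint, hadj]
  have hRe : R = minpoly K x⁻¹ := by
    apply eq_of_monic_of_dvd_of_natDegree_le (minpoly.monic hxint') hRm (minpoly.dvd K _ hroot)
    rw [hRd, hdeg]
  have hpos : 0 < P.natDegree := minpoly.natDegree_pos hxint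
  rw [← hRe, nextCoeff_of_natDegree_pos (by omega), hRd, hR, coeff_C_mul, coeff_reverse,
    revAt_le (by omega), show P.natDegree - (P.natDegree - 1) = 1 by omega]
  field_simp

variable (χ : MulChar K ℂ) (ψ : AddChar K ℂ) (a b : K)

theorem kloosterman_summand_eq {x : L} (hx : x ≠ 0) :
    χ (Algebra.norm K x) * ψ (Algebra.trace K L (algebraMap K L a * x + algebraMap K L b * x⁻¹)) =
      kloostermanCoeff χ ψ a b (minpoly K x) ^ (Module.finrank K⟮x⟯ L) := by
  have hxint : IsIntegral K x := Algebra.IsIntegral.isIntegral x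
  have hadj : K⟮x⁻¹⟯ = K⟮x⟯ := by
    apply le_antisymm
    · rw [adjoin_simple_le_iff]; exact inv_mem (mem_adjoin_simple_self K x)
    · rw [adjoin_simple_le_iff]
      have := inv_mem (mem_adjoin_simple_self K x⁻¹)
      rwa [inv_inv] at this
  have hn : Algebra.norm K x =
      ((-1) ^ (minpoly K x).natDegree * (minpoly K x).coeff 0) ^ (Module.finrank K⟮x⟯ L) := by
    rw [Algebra.norm_eq_norm_adjoin]
    congr 1
    have := Algebra.PowerBasis.norm_gen_eq_coeff_zero_minpoly (adjoin.powerBasis hxint)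
    rw [adjoin.powerBasis_gen, adjoin.powerBasis_dim, minpoly_gen] at this
    exact this
  rw [hn, kloostermanCoeff, map_pow χ, mul_pow (χ _), ← AddChar.map_nsmul_eq_pow]
  congr 2
  rw [map_add, ← Algebra.smul_def, ← Algebra.smul_def, map_smul, map_smul,
    trace_eq_finrank_mul_minpoly_nextCoeff, trace_eq_finrank_mul_minpoly_nextCoeff,
    minpoly_inv_nextCoeff hx, hadj]
  simp only [smul_eq_mul, nsmul_eq_mul]
  ring

theorem kloostermanSum_eq_lPowerSum [DecidableEq L] :
    kloostermanSum K L χ ψ a b = lPowerSum χ ψ a b (Module.finrank K L) := by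
  classical
  set k := Module.finrank K L with hk
  have hk0 : k ≠ 0 := Module.finrank_pos.ne'
  have h1 : kloostermanSum K L χ ψ a b =
      ∑ x : L, kloostermanCoeff χ ψ a b (minpoly K x) ^ (Module.finrank K⟮x⟯ L) := by
    rw [kloostermanSum, ← Finset.sum_subset (Finset.subset_univ (Finset.univ.erase (0 : L)))]
    · refine Finset.sum_bij (fun u _ => (u : L)) ?_ ?_ ?_ ?_
      · intro u _; simp
      · intro u _ v _ h; exact Units.ext h
      · intro x hx
        exact ⟨Units.mk0 x (by simpa using hx), Finset.mem_univ _, rfl⟩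
      · intro u _
        rw [Units.val_inv_eq_inv_val, kloosterman_summand_eq _ _ _ _ u.ne_zero]
    · intro x _ hx
      have : x = 0 := by simpa using hx
      subst this
      have hpos : 0 < Module.finrank K⟮(0 : L)⟯ L := Module.finrank_pos
      simp [kloostermanCoeff, MulChar.map_zero, hpos.ne']
  have hmem : ∀ x : L, (minpoly K x, Module.finrank K⟮x⟯ L) ∈ primePowerFinset K k := by
    intro x
    have hxint : IsIntegral K x := Algebra.IsIntegral.isIntegral x
    rw [mem_primePowerFinset hk0]
    refine ⟨minpoly.monic hxint, minpoly.irreducible hxint, ?_⟩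
    simp only
    rw [← adjoin.finrank hxint, mul_comm, Module.finrank_mul_finrank]
  rw [h1, lPowerSum, ← Finset.sum_fiberwise_of_maps_to (s := Finset.univ)
    (g := fun x : L => (minpoly K x, Module.finrank K⟮x⟯ L)) (t := primePowerFinset K k)
    (fun x _ => hmem x)]
  refine Finset.sum_congr rfl fun y hy => ?_
  obtain ⟨hm, hi, he⟩ := (mem_primePowerFinset hk0).mp hy
  have hfib : (Finset.univ.filter fun x : L => (minpoly K x, Module.finrank K⟮x⟯ L) = y)
      = (y.1.rootSet L).toFinset := by
    ext x
    rw [Finset.mem_filter, Set.mem_toFinset, mem_rootSet]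
    constructor
    · rintro ⟨-, rfl⟩
      exact ⟨hm.ne_zero, minpoly.aeval K x⟩
    · rintro ⟨-, hx⟩
      refine ⟨Finset.mem_univ _, ?_⟩
      have hmin : y.1 = minpoly K x := minpoly.eq_of_irreducible_of_monic hi hx hm
      have hxint : IsIntegral K x := Algebra.IsIntegral.isIntegral x
      refine Prod.ext hmin.symm ?_
      simp only
      have h3 := Module.finrank_mul_finrank K K⟮x⟯ L
      rw [adjoin.finrank hxint, ← hmin, ← hk, ← he, mul_comm] at h3
      exact Nat.eq_of_mul_eq_mul_right hi.natDegree_pos h3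
  rw [Finset.sum_congr rfl (g := fun _ => kloostermanCoeff χ ψ a b y.1 ^ y.2), Finset.sum_const,
    hfib, Set.toFinset_card, card_rootSet_eq_natDegree, nsmul_eq_mul]
  · exact PerfectField.separable_of_irreducible hi
  · have hdvd := (hi.natDegree_dvd_iff_dvd_X_pow_card_pow_sub_X (n := k)).mp ⟨y.2, by rw [← he, mul_comm]⟩
    rw [hk, ← Module.natCard_eq_pow_finrank] at hdvd
    have hne : (X ^ Nat.card L - X : K[X]) ≠ 0 :=
      FiniteField.X_pow_card_sub_X_ne_zero K Finite.one_lt_card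
    refine Splits.of_dvd ?_ (map_ne_zero hne) (Polynomial.map_dvd (algebraMap K L) hdvd)
    rw [Polynomial.map_sub, Polynomial.map_pow, map_X, Nat.card_eq_fintype_card]
    rw [splits_iff_card_roots, FiniteField.roots_X_pow_card_sub_X,
      FiniteField.X_pow_card_sub_X_natDegree_eq _ Fintype.one_lt_card]
    rfl
  · intro x hx
    rw [← (Finset.mem_filter.mp hx).2]

end Link

section Weil

theorem norm_le_one_of_pow_le {z : ℂ} {C : ℝ} (h : ∀ k, 2 ≤ k → ‖z‖ ^ k ≤ C) : ‖z‖ ≤ 1 := by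
  by_contra! hz
  obtain ⟨n, hn⟩ := pow_unbounded_of_one_lt C hz
  have h1 := h (n + 2) (by omega)
  have : ‖z‖ ^ n ≤ ‖z‖ ^ (n + 2) := pow_le_pow_right₀ hz.le (by omega)
  linarith

theorem norm_le_one_of_power_sums {u v : ℂ} {C : ℝ} (h : ∀ k, 2 ≤ k → ‖u ^ k + v ^ k‖ ≤ C) :
    ‖u‖ ≤ 1 := by
  have hC : 0 ≤ C := (norm_nonneg _).trans (h 2 le_rfl)
  have huv : ‖u * v‖ ≤ 1 := by
    apply norm_le_one_of_pow_le (C := C * C + C)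
    intro k hk
    have e : 2 * (u * v) ^ k = (u ^ k + v ^ k) * (u ^ k + v ^ k) - (u ^ (2 * k) + v ^ (2 * k)) := by
      rw [mul_pow, two_mul k, pow_add, pow_add]; ring
    have h1 : ‖2 * (u * v) ^ k‖ ≤ C * C + C := by
      rw [e]
      refine (norm_sub_le _ _).trans (add_le_add ?_ (h _ (by omega)))
      rw [norm_mul]
      exact mul_le_mul (h k hk) (h k hk) (norm_nonneg _) hC
    rw [norm_mul, norm_pow, Complex.norm_ofNat] at h1
    have : 0 ≤ ‖u * v‖ ^ k := by positivity
    linarith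
  apply norm_le_one_of_pow_le (C := C + 1)
  intro k hk
  have e : u ^ k * u ^ k = (u ^ k + v ^ k) * u ^ k - (u * v) ^ k := by rw [mul_pow]; ring
  have h1 : ‖u‖ ^ k * ‖u‖ ^ k ≤ C * ‖u‖ ^ k + 1 := by
    rw [← norm_pow, ← norm_mul, e]
    refine (norm_sub_le _ _).trans (add_le_add ?_ ?_)
    · rw [norm_mul]
      exact mul_le_mul_of_nonneg_right (h k hk) (norm_nonneg _)
    · rw [norm_pow]
      exact pow_le_one₀ (norm_nonneg _) huv
  have h2 : 0 ≤ ‖u‖ ^ k := by positivity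
  by_contra! h3
  nlinarith

theorem eq_neg_power_sums {S : ℕ → ℂ} {A₁ A₂ α β : ℂ} (h1 : S 1 = A₁) (h2 : S 2 = 2 * A₂ - A₁ * A₁)
    (hS : ∀ d, S (d + 3) = -A₁ * S (d + 2) - A₂ * S (d + 1)) (hα : α + β = -A₁) (hαβ : α * β = A₂)
    (d : ℕ) : S (d + 1) = -(α ^ (d + 1) + β ^ (d + 1)) ∧
      S (d + 2) = -(α ^ (d + 2) + β ^ (d + 2)) := by
  have hA₁ : A₁ = -(α + β) := by rw [hα, neg_neg]
  induction d with
  | zero =>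
    refine ⟨?_, ?_⟩
    · rw [zero_add, h1, hA₁]; ring
    · rw [zero_add, h2, hA₁, ← hαβ]; ring
  | succ d ih =>
    refine ⟨ih.2, ?_⟩
    rw [show d + 1 + 2 = d + 3 by ring, hS, ih.1, ih.2, hA₁, ← hαβ]
    ring

variable {K : Type*} [Field K] [Fintype K] [DecidableEq K]

theorem norm_lPowerSum_one_le (χ : MulChar K ℂ) {ψ : AddChar K ℂ} (hψ : ψ ≠ 1) {a : K}
    (ha : a ≠ 0) (b : K) : ‖lPowerSum χ ψ a b 1‖ ≤ 2 * Real.sqrt (Fintype.card K) := by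
  classical
  set Q : ℝ := ((Fintype.card K : ℕ) : ℝ) with hQ
  have hQ0 : 0 < Q := by rw [hQ]; exact_mod_cast Fintype.card_pos
  set S := lPowerSum χ ψ a b with hS
  set A := lCoeff χ ψ a b with hA
  have hrec := natCast_mul_lCoeff χ ψ a b
  have hA0 : A 0 = 1 := lCoeff_zero χ ψ a b
  have hA3 : ∀ d, 3 ≤ d → A d = 0 := fun d hd => lCoeff_eq_zero χ hψ ha b hd
  have h1 : S 1 = A 1 := by
    have := hrec 1
    simp only [Finset.Icc_self, Finset.sum_singleton, Nat.cast_one, one_mul, Nat.sub_self] at this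
    rw [← hS, ← hA, hA0, mul_one] at this
    exact this.symm
  have h2 : S 2 = 2 * A 2 - A 1 * A 1 := by
    have := hrec 2
    rw [show Finset.Icc 1 2 = {1, 2} by rfl, Finset.sum_pair (by norm_num)] at this
    simp only [Nat.sub_self, Nat.add_one_sub_one] at this
    rw [← hS, ← hA, hA0, mul_one, h1] at this
    push_cast at this
    linear_combination -this
  have h3 : ∀ d, S (d + 3) = -A 1 * S (d + 2) - A 2 * S (d + 1) := by
    intro d
    have := hrec (d + 3)
    rw [← hS, ← hA, hA3 _ (by omega), mul_zero,
      ← Finset.sum_subset (s₁ := {d + 1, d + 2, d + 3})] at this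
    · rw [Finset.sum_insert (by simp), Finset.sum_insert (by simp), Finset.sum_singleton,
        Nat.sub_self, show d + 3 - (d + 1) = 2 by omega, show d + 3 - (d + 2) = 1 by omega,
        hA0] at this
      linear_combination -this
    · intro k hk
      simp only [Finset.mem_insert, Finset.mem_singleton] at hk
      rw [Finset.mem_Icc]; omega
    · intro k hk hk'
      simp only [Finset.mem_insert, Finset.mem_singleton] at hk'
      rw [Finset.mem_Icc] at hk
      rw [hA3 _ (by omega), mul_zero]
  obtain ⟨α, hα⟩ : ∃ α : ℂ, α * α + A 1 * α + A 2 = 0 := by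
    obtain ⟨s, hs⟩ := IsAlgClosed.exists_eq_mul_self (A 1 * A 1 - 4 * A 2)
    refine ⟨(-A 1 + s) / 2, ?_⟩
    linear_combination -hs / 4
  set β := -A 1 - α with hβ
  have hsum : α + β = -A 1 := by rw [hβ]; ring
  have hprod : α * β = A 2 := by rw [hβ]; linear_combination -hα
  have hpow := eq_neg_power_sums h1 h2 h3 hsum hprod
  have hbound : ∀ k, 2 ≤ k → ‖α ^ (2 * k) + β ^ (2 * k)‖ ≤ (4 * Q ^ 2 + 1) * Q ^ k := by
    intro k hk
    obtain ⟨ν, rfl⟩ : ∃ ν, k = ν + 1 := ⟨k - 1, by omega⟩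
    obtain ⟨p, hp⟩ := CharP.exists K
    have : Fact p.Prime := ⟨CharP.char_is_prime K p⟩
    have : NeZero (2 * (ν + 1)) := ⟨by omega⟩
    let L := FiniteField.Extension K p (2 * (ν + 1))
    have : Finite L := Module.finite_of_finite K
    let _ : Fintype L := Fintype.ofFinite L
    have hfr : Module.finrank K L = 2 * (ν + 1) := FiniteField.finrank_extension K p _
    have hb := norm_kloostermanSum_le (K := K) (L := L) (by omega) hfr χ hψ ha b
    rw [kloostermanSum_eq_lPowerSum, hfr, ← hS, show 2 * (ν + 1) = 2 * ν + 2 by ring,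
      (hpow (2 * ν)).2, norm_neg] at hb
    exact hb
  set r := Real.sqrt Q with hr
  have hr0 : 0 < r := Real.sqrt_pos.mpr hQ0
  have hrr : r * r = Q := Real.mul_self_sqrt hQ0.le
  have hscale : ∀ k, 2 ≤ k → ‖((α / r) ^ 2) ^ k + ((β / r) ^ 2) ^ k‖ ≤ 4 * Q ^ 2 + 1 := by
    intro k hk
    have e : ((α / r) ^ 2) ^ k + ((β / r) ^ 2) ^ k = (α ^ (2 * k) + β ^ (2 * k)) / ((Q ^ k : ℝ) : ℂ) := by
      rw [← hrr, ← pow_mul, ← pow_mul, div_pow, div_pow, ← add_div, ← sq, ← pow_mul]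
      push_cast; rfl
    rw [e, norm_div, Complex.norm_real, Real.norm_of_nonneg (by positivity), div_le_iff₀ (by positivity)]
    exact hbound k hk
  have hle : ∀ z : ℂ, ‖(z / r) ^ 2‖ ≤ 1 → ‖z‖ ≤ r := by
    intro z hz
    rw [norm_pow, norm_div, Complex.norm_real, Real.norm_of_nonneg hr0.le] at hz
    have := (pow_le_one_iff_of_nonneg (by positivity) two_ne_zero).mp hz
    rwa [div_le_one hr0] at this
  have hα' : ‖α‖ ≤ r := hle _ (norm_le_one_of_power_sums hscale)
  have hβ' : ‖β‖ ≤ r := hle _ (norm_le_one_of_power_sums (v := (α / r) ^ 2) (by simpa [add_comm] using hscale))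
  rw [show S 1 = -(α + β) by rw [hsum, h1, neg_neg], norm_neg]
  linarith [norm_add_le α β]

/-- Weil's bound for twisted Kloosterman sums. -/
theorem norm_sum_mulChar_addChar_le (χ : MulChar K ℂ) {ψ : AddChar K ℂ} (hψ : ψ ≠ 1) {a b : K}
    (hab : a ≠ 0 ∨ b ≠ 0) :
    ‖∑ x : Kˣ, χ (x : K) * ψ (a * x + b * (x⁻¹ : Kˣ))‖ ≤ 2 * Real.sqrt (Fintype.card K) := by
  have key : ∀ (χ : MulChar K ℂ) {a : K} (b : K), a ≠ 0 →
      ‖∑ x : Kˣ, χ (x : K) * ψ (a * x + b * (x⁻¹ : Kˣ))‖ ≤ 2 * Real.sqrt (Fintype.card K) := by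
    intro χ a b ha
    have := norm_lPowerSum_one_le χ hψ ha b
    have h := kloostermanSum_eq_lPowerSum (L := K) χ ψ a b
    rw [Module.finrank_self] at h
    rw [← h] at this
    simpa [kloostermanSum, Algebra.norm_self, Algebra.trace_self] using this
  by_cases ha : a = 0
  · have hb : b ≠ 0 := hab.resolve_left (not_not.mpr ha)
    have := key χ⁻¹ a hb
    rw [← Equiv.sum_comp (Equiv.inv Kˣ)] at this
    simpa [MulChar.inv_apply', add_comm] using this
  · exact key χ b ha

end Weil

universe u

section Equidistribution

variable {F : Type*} [Field F]

theorem exists_eq_mulShift [Fintype F] {ψ₀ : AddChar F ℂ} (hψ₀ : ψ₀.IsPrimitive) (ψ : AddChar F ℂ) :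
    ∃ a : F, ψ = ψ₀.mulShift a := by
  have h : Function.Bijective (ψ₀.mulShift) := by
    rw [Fintype.bijective_iff_injective_and_card]
    exact ⟨AddChar.to_mulShift_inj_of_isPrimitive hψ₀, AddChar.card_eq.symm⟩
  obtain ⟨a, ha⟩ := h.2 ψ
  exact ⟨a, ha.symm⟩

/-- Weil's bound for a nontrivial triple of characters. -/
theorem norm_sum_character_triple_le [Fintype F] [DecidableEq F] (c : Fˣ →* ℂ) (ψ₁ ψ₂ : AddChar F ℂ)
    (h : c ≠ 1 ∨ ψ₁ ≠ 0 ∨ ψ₂ ≠ 0) :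
    ‖∑ x : Fˣ, c x * ψ₁ x * ψ₂ (x⁻¹ : Fˣ)‖ ≤ 2 * Real.sqrt (Fintype.card F) := by
  have hψ₀ := AddChar.FiniteField.primitiveChar_to_Complex_isPrimitive F
  set ψ₀ := AddChar.FiniteField.primitiveChar_to_Complex F
  have hψ₀1 : ψ₀ ≠ 1 := by
    have := hψ₀ one_ne_zero
    rwa [AddChar.mulShift_one] at this
  obtain ⟨a, rfl⟩ := exists_eq_mulShift hψ₀ ψ₁
  obtain ⟨b, rfl⟩ := exists_eq_mulShift hψ₀ ψ₂
  by_cases hab : a ≠ 0 ∨ b ≠ 0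
  · have := norm_sum_mulChar_addChar_le (MulChar.ofUnitHom c.toHomUnits) hψ₀1 hab
    simpa [MulChar.ofUnitHom_coe, AddChar.map_add_eq_mul, mul_assoc] using this
  · push Not at hab
    obtain ⟨rfl, rfl⟩ := hab
    have hc : c ≠ 1 := by
      simpa [AddChar.mulShift_zero, AddChar.one_eq_zero] using h
    have hsum : ∑ x : Fˣ, c x = 0 := by
      classical
      exact sum_hom_units_eq_zero c hc
    simp [AddChar.mulShift_zero, hsum]

/-- The multiplicative function on `Fˣ` obtained from a character of a quotient of `Fˣ`. -/
noncomputable def quotientChar {G : Type*} [AddCommGroup G] (π : Additive Fˣ →+ G)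
    (φ : AddChar G ℂ) : Fˣ →* ℂ where
  toFun x := φ (π (Additive.ofMul x))
  map_one' := by rw [ofMul_one, map_zero, φ.map_zero_eq_one]
  map_mul' x y := by rw [ofMul_mul, map_add, φ.map_add_eq_mul]

/-- The additive character of `F` obtained from a character of a quotient of `F`. -/
noncomputable def quotientAddChar (A : AddSubgroup F) (φ : AddChar (F ⧸ A) ℂ) : AddChar F ℂ :=
  φ.compAddMonoidHom (QuotientAddGroup.mk' A)

theorem quotientChar_ne_one {G : Type*} [AddCommGroup G] {π : Additive Fˣ →+ G}
    (hπ : Function.Surjective π) {φ : AddChar G ℂ} (h : φ ≠ 0) : quotientChar π φ ≠ 1 := by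
  contrapose! h
  ext y
  obtain ⟨x, rfl⟩ := hπ y
  exact DFunLike.congr_fun h (Additive.toMul x)

theorem exists_additive_quotient {F : Type u} [Field F] [Fintype F] (M : Subgroup Fˣ) :
    ∃ (G : Type u) (_ : AddCommGroup G) (_ : Fintype G) (π : Additive Fˣ →+ G),
      Function.Surjective π ∧ (∀ x, π (Additive.ofMul x) = 0 ↔ x ∈ M) ∧
        Fintype.card G = M.index := by
  have : Fintype (Additive (Fˣ ⧸ M)) := Fintype.ofFinite _
  refine ⟨Additive (Fˣ ⧸ M), inferInstance, inferInstance,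
    MonoidHom.toAdditive (QuotientGroup.mk' M), QuotientGroup.mk'_surjective M,
    fun x => QuotientGroup.eq_one_iff x, ?_⟩
  rw [← Nat.card_eq_fintype_card]
  rfl

theorem quotientAddChar_ne_zero {A : AddSubgroup F} {φ : AddChar (F ⧸ A) ℂ} (h : φ ≠ 0) :
    quotientAddChar A φ ≠ 0 := by
  contrapose! h
  ext y
  obtain ⟨x, rfl⟩ := QuotientAddGroup.mk_surjective y
  exact DFunLike.congr_fun h x

open Classical in
/-- Elements of `Fˣ` that lie in a multiplicative subgroup and in an additive one, and whose
inverses lie in another additive subgroup, are as frequent as expected. -/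
theorem abs_card_mem_subgroups_sub_le [Fintype F] (M : Subgroup Fˣ) (A B : AddSubgroup F) :
    |((Finset.univ.filter fun x : Fˣ => x ∈ M ∧ (x : F) ∈ A ∧ ((x⁻¹ : Fˣ) : F) ∈ B).card : ℝ) -
      (Fintype.card F - 1) / (M.index * A.index * B.index)| ≤
      2 * Real.sqrt (Fintype.card F) := by
  obtain ⟨G, _, _, π, hπ, hπ0, hm⟩ := exists_additive_quotient M
  have : Fintype (F ⧸ A) := Fintype.ofFinite _
  have : Fintype (F ⧸ B) := Fintype.ofFinite _
  set R : ℝ := 2 * Real.sqrt (Fintype.card F) with hR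
  set T := AddChar G ℂ × AddChar (F ⧸ A) ℂ × AddChar (F ⧸ B) ℂ
  have ha : (Fintype.card (F ⧸ A)) = A.index := by
    rw [AddSubgroup.index, ← Nat.card_eq_fintype_card]
  have hb : (Fintype.card (F ⧸ B)) = B.index := by
    rw [AddSubgroup.index, ← Nat.card_eq_fintype_card]
  set S : T → ℂ := fun t => ∑ x : Fˣ, quotientChar π t.1 x * quotientAddChar A t.2.1 x *
    quotientAddChar B t.2.2 (x⁻¹ : Fˣ) with hS
  have hS0 : S 0 = Fintype.card F - 1 := by
    have : ∀ x : Fˣ, quotientChar π 0 x = 1 := fun x => rfl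
    simp [hS, this, quotientAddChar, Fintype.card_units,
      Nat.cast_sub (Fintype.card_pos (α := F) : 1 ≤ _)]
  have hSt : ∀ t : T, t ≠ 0 → ‖S t‖ ≤ R := by
    intro t ht
    refine norm_sum_character_triple_le _ _ _ ?_
    by_contra! hcon
    refine ht (Prod.ext ?_ (Prod.ext ?_ ?_))
    · by_contra h; exact quotientChar_ne_one hπ h hcon.1
    · by_contra h; exact quotientAddChar_ne_zero h hcon.2.1
    · by_contra h; exact quotientAddChar_ne_zero h hcon.2.2
  have hcardT : (Fintype.card T : ℝ) = M.index * A.index * B.index := by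
    rw [Fintype.card_prod, Fintype.card_prod, AddChar.card_eq, AddChar.card_eq, AddChar.card_eq,
      hm, ha, hb]
    push_cast; ring
  have hsum : ∑ t : T, S t = (Fintype.card T : ℝ) *
      ((Finset.univ.filter fun x : Fˣ => x ∈ M ∧ (x : F) ∈ A ∧ ((x⁻¹ : Fˣ) : F) ∈ B).card : ℝ) := by
    rw [hcardT, hS, Finset.sum_comm, Finset.card_filter]
    push_cast
    rw [Finset.mul_sum]
    refine Finset.sum_congr rfl fun x _ => ?_
    have h1 : ∑ φ, quotientChar π φ x = if x ∈ M then (M.index : ℂ) else 0 := by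
      have := AddChar.sum_apply_eq_ite (π (Additive.ofMul x))
      rw [hm] at this
      simp only [hπ0] at this
      exact this
    have h2 : ∀ (D : AddSubgroup F) [Fintype (F ⧸ D)] (y : F),
        ∑ φ, quotientAddChar D φ y = if y ∈ D then (D.index : ℂ) else 0 := by
      intro D _ y
      have := AddChar.sum_apply_eq_ite (y : F ⧸ D)
      rw [show Fintype.card (F ⧸ D) = D.index by
        rw [AddSubgroup.index, ← Nat.card_eq_fintype_card]] at this
      simp only [QuotientAddGroup.eq_zero_iff] at this
      exact this
    rw [Fintype.sum_prod_type]
    simp only [Fintype.sum_prod_type, mul_assoc, ← Finset.mul_sum]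
    simp only [← Finset.sum_mul]
    rw [h1, h2, h2]
    by_cases hx : x ∈ M <;> by_cases hy : (x : F) ∈ A <;> by_cases hz : (x : F)⁻¹ ∈ B <;>
      simp only [Complex.ofReal_one, Complex.ofReal_zero, hx, hy, hz, if_true, if_false, and_true, and_false, mul_zero, zero_mul,
        mul_one]
  set N : ℝ := ((Finset.univ.filter fun x : Fˣ =>
    x ∈ M ∧ (x : F) ∈ A ∧ ((x⁻¹ : Fˣ) : F) ∈ B).card : ℝ)
  have hT0 : (0 : ℝ) < Fintype.card T := by exact_mod_cast Fintype.card_pos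
  rw [← hcardT]
  have hdiff : (((Fintype.card T : ℝ) * N - (Fintype.card F - 1) : ℝ) : ℂ) =
      ∑ t ∈ Finset.univ.erase (0 : T), S t := by
    rw [Finset.sum_erase_eq_sub (Finset.mem_univ 0), hsum, hS0]
    push_cast
    ring
  have hle : |(Fintype.card T : ℝ) * N - (Fintype.card F - 1)| ≤ Fintype.card T * R := by
    rw [← Real.norm_eq_abs, ← Complex.norm_real, hdiff]
    refine (norm_sum_le_of_le _ fun t ht => hSt t (Finset.ne_of_mem_erase ht)).trans ?_
    rw [Finset.sum_const, nsmul_eq_mul]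
    have : (0 : ℝ) ≤ R := by positivity
    gcongr
    exact (Finset.card_le_univ _)
  rw [show N - (Fintype.card F - 1) / (Fintype.card T : ℝ) =
    ((Fintype.card T : ℝ) * N - (Fintype.card F - 1)) / Fintype.card T by field_simp,
    abs_div, abs_of_pos hT0, div_le_iff₀ hT0, mul_comm R]
  exact hle

end Equidistribution

section Sieve

variable {X ι : Type*} [Fintype X] [DecidableEq ι] {P : X → Prop} {E : ι → X → Prop}
  {w : ι → ℝ} {T R : ℝ}

open Classical in
/-- The number of points satisfying `P`, all the events in `J` and none of those in `C`. -/
noncomputable def siftCount (P : X → Prop) (E : ι → X → Prop) (J C : Finset ι) : ℕ :=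
  (Finset.univ.filter fun x => P x ∧ (∀ i ∈ J, E i x) ∧ ∀ i ∈ C, ¬ E i x).card

theorem siftCount_insert (P : X → Prop) (E : ι → X → Prop) (J C : Finset ι) (i : ι) :
    siftCount P E J (insert i C) + siftCount P E (insert i J) C = siftCount P E J C := by
  classical
  unfold siftCount
  rw [← Finset.card_union_of_disjoint]
  · congr 1
    ext x
    simp only [Finset.mem_union, Finset.mem_filter, Finset.mem_univ, true_and,
      Finset.forall_mem_insert]
    tauto
  · rw [Finset.disjoint_filter]
    intro x _ h1 h2
    exact h1.2.2 i (Finset.mem_insert_self _ _) (h2.2.1 i (Finset.mem_insert_self _ _))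

theorem abs_siftCount_sub_le {U : Finset ι}
    (h : ∀ J ⊆ U, |(siftCount P E J ∅ : ℝ) - T * ∏ i ∈ J, w i| ≤ R) (C : Finset ι)
    (hC : C ⊆ U) : ∀ J ⊆ U, Disjoint J C →
      |(siftCount P E J C : ℝ) - T * (∏ i ∈ J, w i) * ∏ i ∈ C, (1 - w i)| ≤ 2 ^ C.card * R := by
  induction C using Finset.induction_on with
  | empty => intro J hJU _; simpa using h J hJU
  | insert i C hi ih =>
    intro J hJU hJ
    rw [Finset.insert_subset_iff] at hC
    rw [Finset.disjoint_insert_right] at hJ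
    have h1 := ih hC.2 J hJU hJ.2
    have h2 := ih hC.2 (insert i J) (Finset.insert_subset hC.1 hJU) (Finset.disjoint_insert_left.mpr ⟨hi, hJ.2⟩)
    have h3 : (siftCount P E J (insert i C) : ℝ) =
        siftCount P E J C - siftCount P E (insert i J) C := by
      rw [← siftCount_insert P E J C i]; push_cast; ring
    rw [Finset.prod_insert hJ.1] at h2
    rw [h3, Finset.prod_insert hi, Finset.card_insert_of_notMem hi, pow_succ]
    rw [abs_le] at *
    constructor <;> linarith [h1.1, h1.2, h2.1, h2.2]

/-- A lower bound sieve with a core `C`, in which inclusion–exclusion is exact, and remaining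
events `S`, for which the union bound is used. -/
theorem le_siftCount_union {U : Finset ι}
    (h : ∀ J ⊆ U, |(siftCount P E J ∅ : ℝ) - T * ∏ i ∈ J, w i| ≤ R) {C S : Finset ι}
    (hCS : Disjoint C S) (hC : C ⊆ U) (hS : S ⊆ U) :
    T * (∏ i ∈ C, (1 - w i)) * (1 - ∑ i ∈ S, w i) - 2 ^ C.card * (1 + S.card) * R ≤
      siftCount P E ∅ (C ∪ S) := by
  induction S using Finset.induction_on with
  | empty =>
    have := abs_siftCount_sub_le h C hC ∅ (Finset.empty_subset _) (Finset.disjoint_empty_left _)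
    rw [abs_le] at this
    simp only [Finset.prod_empty, Finset.sum_empty, Finset.card_empty, Finset.union_empty] at *
    push_cast
    linarith [this.1]
  | insert i S hi ih =>
    rw [Finset.disjoint_insert_right] at hCS
    rw [Finset.insert_subset_iff] at hS
    have h1 := ih hCS.2 hS.2
    have h2 := abs_siftCount_sub_le h C hC {i} (Finset.singleton_subset_iff.mpr hS.1) (Finset.disjoint_singleton_left.mpr hCS.1)
    have h3 := siftCount_insert P E ∅ (C ∪ S) i
    have h4 : siftCount P E (insert i ∅) (C ∪ S) ≤ siftCount P E {i} C := by
      classical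
      unfold siftCount
      refine Finset.card_le_card fun x => ?_
      simp only [Finset.mem_filter, Finset.mem_univ, true_and]
      exact fun hx => ⟨hx.1, by simpa using hx.2.1, fun j hj => hx.2.2 j (Finset.mem_union_left _ hj)⟩
    have h5 : (siftCount P E ∅ (insert i (C ∪ S)) : ℝ) + siftCount P E {i} C ≥
        siftCount P E ∅ (C ∪ S) := by exact_mod_cast (by omega)
    rw [abs_le, Finset.prod_singleton] at h2
    rw [Finset.union_insert, Finset.sum_insert hi, Finset.card_insert_of_notMem hi]
    push_cast
    linarith [h2.2]

end Sieve

noncomputable section FrobeniusModule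

variable (Fq F : Type*) [Field Fq] [Field F] [Fintype Fq] [Algebra Fq F]

/-- The `q`-Frobenius as an `F_q`-linear endomorphism. -/
def frobEnd : Module.End Fq F := (FiniteField.frobeniusAlgHom Fq F).toLinearMap

variable {Fq F}

theorem frobEnd_pow_apply (i : ℕ) (x : F) :
    (frobEnd Fq F ^ i) x = x ^ (Fintype.card Fq) ^ i := by
  induction i with
  | zero => simp
  | succ i ih =>
    rw [pow_succ', Module.End.mul_apply, ih, frobEnd]
    simp [pow_succ, pow_mul]

theorem aeval_frobEnd_apply (h : Fq[X]) (x : F) :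
    aeval (frobEnd Fq F) h x =
      h.sum fun i a => algebraMap Fq F a * x ^ (Fintype.card Fq) ^ i := by
  rw [Polynomial.aeval_endomorphism]
  simp [frobEnd_pow_apply, Algebra.smul_def]

variable [Fintype F]

theorem aeval_frobEnd_X_pow_sub_one :
    aeval (frobEnd Fq F) (X ^ Module.finrank Fq F - 1 : Fq[X]) = 0 := by
  have := minpoly.aeval Fq (FiniteField.frobeniusAlgHom Fq F).toLinearMap
  rwa [FiniteField.minpoly_frobeniusAlgHom] at this

theorem finrank_ker_aeval_frobEnd_le {h : Fq[X]} (hh : h ≠ 0) :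
    Module.finrank Fq (LinearMap.ker (aeval (frobEnd Fq F) h)) ≤ h.natDegree := by
  classical
  set q := Fintype.card Fq with hq
  have hq1 : 1 < q := Fintype.one_lt_card
  set L : F[X] := ∑ i ∈ h.support, C (algebraMap Fq F (h.coeff i)) * X ^ q ^ i with hL
  have hcoeff : L.coeff (q ^ h.natDegree) = algebraMap Fq F h.leadingCoeff := by
    rw [hL, finsetSum_coeff, Finset.sum_eq_single h.natDegree]
    · simp
    · intro i _ hi
      simp only [coeff_C_mul, coeff_X_pow]
      rw [if_neg, mul_zero]
      exact fun e => hi (Nat.pow_right_injective hq1 e).symm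
    · intro hn
      simp [notMem_support_iff.1 hn]
  have hL0 : L ≠ 0 := by
    intro h0
    rw [h0, coeff_zero] at hcoeff
    exact hh (by simpa using hcoeff.symm)
  have hdeg : L.natDegree ≤ q ^ h.natDegree := by
    refine natDegree_sum_le_of_forall_le _ _ fun i hi => ?_
    refine (natDegree_C_mul_X_pow_le _ _).trans ?_
    exact Nat.pow_le_pow_right (by omega) (le_natDegree_of_mem_supp _ hi)
  have hroots := card_le_degree_of_subset_roots (p := L)
    (Z := Finset.univ.filter fun x => x ∈ LinearMap.ker (aeval (frobEnd Fq F) h)) (by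
      intro x hx
      have hx' : aeval (frobEnd Fq F) h x = 0 := by simpa using hx
      rw [aeval_frobEnd_apply, Polynomial.sum] at hx'
      rw [mem_roots hL0, IsRoot, hL, eval_finsetSum]
      simpa using hx')
  have hcard : Fintype.card (LinearMap.ker (aeval (frobEnd Fq F) h)) =
      q ^ Module.finrank Fq (LinearMap.ker (aeval (frobEnd Fq F) h)) :=
    Module.card_eq_pow_finrank
  have : Fintype.card (LinearMap.ker (aeval (frobEnd Fq F) h)) =
    (Finset.univ.filter fun x => x ∈ LinearMap.ker (aeval (frobEnd Fq F) h)).card :=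
    Fintype.card_subtype _
  rw [← this, hcard] at hroots
  exact (Nat.pow_le_pow_iff_right hq1).1 (hroots.trans hdeg)

theorem finrank_ker_aeval_frobEnd {h : Fq[X]}
    (hd : h ∣ X ^ Module.finrank Fq F - 1) :
    Module.finrank Fq (LinearMap.ker (aeval (frobEnd Fq F) h)) = h.natDegree := by
  obtain ⟨k, hk⟩ := hd
  have hn : 0 < Module.finrank Fq F := Module.finrank_pos
  have h0 : (X ^ Module.finrank Fq F - 1 : Fq[X]) ≠ 0 := X_pow_sub_C_ne_zero hn (1 : Fq)
  have hdeg : (X ^ Module.finrank Fq F - 1 : Fq[X]).natDegree = Module.finrank Fq F :=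
    natDegree_X_pow_sub_C (r := (1 : Fq))
  have hh : h ≠ 0 := by rintro rfl; simp [h0] at hk
  have hk0 : k ≠ 0 := by rintro rfl; simp [h0] at hk
  refine le_antisymm (finrank_ker_aeval_frobEnd_le hh) ?_
  have hr : LinearMap.range (aeval (frobEnd Fq F) k) ≤ LinearMap.ker (aeval (frobEnd Fq F) h) := by
    rintro _ ⟨y, rfl⟩
    rw [LinearMap.mem_ker, ← Module.End.mul_apply, ← map_mul, ← hk, aeval_frobEnd_X_pow_sub_one]
    rfl
  have h1 := Submodule.finrank_mono hr
  have h2 := LinearMap.finrank_range_add_finrank_ker (aeval (frobEnd Fq F) k)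
  have h3 := finrank_ker_aeval_frobEnd_le (F := F) hk0
  rw [hk, natDegree_mul hh hk0] at hdeg
  omega

theorem index_ker_aeval_frobEnd {h k : Fq[X]}
    (hk : X ^ Module.finrank Fq F - 1 = h * k) :
    (LinearMap.ker (aeval (frobEnd Fq F) h)).toAddSubgroup.index =
      Fintype.card Fq ^ k.natDegree := by
  have hn : 0 < Module.finrank Fq F := Module.finrank_pos
  have h0 : (X ^ Module.finrank Fq F - 1 : Fq[X]) ≠ 0 := X_pow_sub_C_ne_zero hn (1 : Fq)
  have hdeg : (X ^ Module.finrank Fq F - 1 : Fq[X]).natDegree = Module.finrank Fq F :=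
    natDegree_X_pow_sub_C (r := (1 : Fq))
  have hh : h ≠ 0 := by rintro rfl; simp [h0] at hk
  have hk0 : k ≠ 0 := by rintro rfl; simp [h0] at hk
  rw [hk, natDegree_mul hh hk0] at hdeg
  have h1 := (LinearMap.ker (aeval (frobEnd Fq F) h)).toAddSubgroup.card_mul_index
  have h2 : Nat.card (LinearMap.ker (aeval (frobEnd Fq F) h)).toAddSubgroup =
      Nat.card Fq ^ h.natDegree := by
    have := Module.natCard_eq_pow_finrank (K := Fq) (V := LinearMap.ker (aeval (frobEnd Fq F) h))
    rw [finrank_ker_aeval_frobEnd ⟨k, hk⟩] at this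
    exact this
  rw [h2, Module.natCard_eq_pow_finrank (K := Fq) (V := F), ← hdeg, pow_add] at h1
  have := Nat.eq_of_mul_eq_mul_left (pow_pos Nat.card_pos _) h1
  rw [this, Nat.card_eq_fintype_card]

/-- The annihilator of `x` is a principal ideal. -/
theorem exists_order (x : F) :
    ∃ o : Fq[X], ∀ h : Fq[X], aeval (frobEnd Fq F) h x = 0 ↔ o ∣ h := by
  let A : Ideal Fq[X] :=
    { carrier := {h | aeval (frobEnd Fq F) h x = 0}
      add_mem' := by
        intro a b ha hb
        simp only [Set.mem_ofPred_eq] at *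
        rw [map_add, LinearMap.add_apply, ha, hb, add_zero]
      zero_mem' := by simp
      smul_mem' := by
        intro c a ha
        simp only [Set.mem_ofPred_eq, smul_eq_mul] at *
        rw [map_mul, Module.End.mul_apply, ha, map_zero] }
  refine ⟨Submodule.IsPrincipal.generator A, fun h => ?_⟩
  rw [← Submodule.IsPrincipal.mem_iff_generator_dvd]
  rfl

end FrobeniusModule

section Events

theorem exists_pow_mul_eq_of_coprime {G : Type*} [CommGroup G] {a b : ℕ} (hab : a.Coprime b)
    {x : G} (ha : ∃ y, y ^ a = x) (hb : ∃ y, y ^ b = x) : ∃ y, y ^ (a * b) = x := by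
  obtain ⟨y, rfl⟩ := ha
  obtain ⟨z, hz⟩ := hb
  have h := Nat.gcd_eq_gcd_ab a b
  rw [Nat.Coprime.gcd_eq_one hab] at h
  refine ⟨z ^ (a.gcdA b) * y ^ (a.gcdB b), ?_⟩
  rw [mul_pow, mul_comm a b, pow_mul, mul_comm b a, pow_mul (y ^ _), ← zpow_natCast (z ^ _) b,
    ← zpow_mul, mul_comm (a.gcdA b), zpow_mul, zpow_natCast z b, hz, ← zpow_natCast (y ^ _) a,
    ← zpow_mul y, mul_comm (a.gcdB b), zpow_mul, zpow_natCast y a, ← zpow_natCast _ a,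
    ← zpow_natCast _ b, ← zpow_mul (y ^ a) _ (a : ℤ), ← zpow_mul (y ^ a) _ (b : ℤ), ← zpow_add,
    mul_comm _ (a : ℤ), mul_comm _ (b : ℤ)]
  push_cast at h
  rw [← h, zpow_one]

theorem forall_exists_pow_iff {G : Type*} [CommGroup G] (D : Finset ℕ)
    (hD : ∀ p ∈ D, p.Prime) (x : G) :
    (∀ p ∈ D, ∃ y, y ^ p = x) ↔ ∃ y, y ^ (∏ p ∈ D, p) = x := by
  induction D using Finset.induction_on with
  | empty => simp
  | insert p D hp ih =>
    rw [Finset.forall_mem_insert] at hD ⊢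
    rw [ih hD.2, Finset.prod_insert hp]
    constructor
    · rintro ⟨h1, h2⟩
      refine exists_pow_mul_eq_of_coprime ?_ h1 h2
      refine Nat.Coprime.prod_right fun r hr => (Nat.coprime_primes hD.1 (hD.2 r hr)).2 ?_
      rintro rfl
      exact hp hr
    · rintro ⟨y, rfl⟩
      exact ⟨⟨y ^ ∏ p ∈ D, p, by rw [← pow_mul, mul_comm]⟩, ⟨y ^ p, by rw [← pow_mul]⟩⟩

theorem isCoprime_of_monic_irreducible {K : Type*} [Field K] {g h : K[X]} (hg : g.Monic)
    (hh : h.Monic) (ig : Irreducible g) (ih : Irreducible h) (hne : g ≠ h) : IsCoprime g h := by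
  refine (ig.coprime_iff_not_dvd).2 fun hd => hne ?_
  exact eq_of_monic_of_associated hg hh (ig.associated_of_dvd ih hd)

theorem prod_dvd_of_monic_irreducible {K : Type*} [Field K] {G : Finset K[X]} {c : K[X]}
    (hG : ∀ g ∈ G, g.Monic ∧ Irreducible g) (hc : ∀ g ∈ G, g ∣ c) : ∏ g ∈ G, g ∣ c := by
  refine Finset.prod_dvd_of_coprime ?_ hc
  intro g hg h hh hne
  exact isCoprime_of_monic_irreducible (hG g hg).1 (hG h hh).1 (hG g hg).2 (hG h hh).2 hne

theorem dvd_div_iff_mul_dvd_of_dvd {K : Type*} [Field K] {f g o : K[X]} (hf : f ≠ 0)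
    (hg : g ∣ f) : o ∣ f / g ↔ g * o ∣ f := by
  have hg0 : g ≠ 0 := by rintro rfl; exact hf (zero_dvd_iff.1 hg)
  conv_rhs => rw [← EuclideanDomain.mul_div_cancel' hg0 hg]
  exact (mul_dvd_mul_iff_left hg0).symm

theorem dvd_and_forall_dvd_div_iff {K : Type*} [Field K] {f o : K[X]} (hf : f ≠ 0)
    {G : Finset K[X]} (hG : ∀ g ∈ G, g.Monic ∧ Irreducible g) (hd : ∀ g ∈ G, g ∣ f) :
    (o ∣ f ∧ ∀ g ∈ G, o ∣ f / g) ↔ o ∣ f / ∏ g ∈ G, g := by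
  rw [dvd_div_iff_mul_dvd_of_dvd hf (prod_dvd_of_monic_irreducible hG hd)]
  constructor
  · rintro ⟨⟨c, rfl⟩, h⟩
    have ho : o ≠ 0 := left_ne_zero_of_mul hf
    rw [mul_comm]
    refine mul_dvd_mul_left o (prod_dvd_of_monic_irreducible hG fun g hg => ?_)
    have := (dvd_div_iff_mul_dvd_of_dvd hf (hd g hg)).1 (h g hg)
    rw [mul_comm g o] at this
    exact (mul_dvd_mul_iff_left ho).1 this
  · intro h
    refine ⟨(Dvd.intro_left _ rfl).trans h, fun g hg => ?_⟩
    rw [dvd_div_iff_mul_dvd_of_dvd hf (hd g hg)]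
    have hgP : g ∣ ∏ g ∈ G, g := Finset.dvd_prod_of_mem (fun g => g) hg
    exact (mul_dvd_mul hgP (dvd_refl o)).trans h

end Events

section FieldEvents

variable {Fq F : Type*} [Field Fq] [Field F] [Fintype Fq] [Fintype F] [Algebra Fq F]

theorem aeval_and_forall_aeval_div_iff {f : Fq[X]} (hf : f ≠ 0)
    {G : Finset Fq[X]} (hG : ∀ g ∈ G, g.Monic ∧ Irreducible g) (hd : ∀ g ∈ G, g ∣ f) (x : F) :
    (aeval (frobEnd Fq F) f x = 0 ∧ ∀ g ∈ G, aeval (frobEnd Fq F) (f / g) x = 0) ↔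
      aeval (frobEnd Fq F) (f / ∏ g ∈ G, g) x = 0 := by
  obtain ⟨o, ho⟩ := exists_order (Fq := Fq) x
  simp only [ho]
  exact dvd_and_forall_dvd_div_iff hf hG hd

theorem isKNormal_one_of_aeval {f : Fq[X]} {q n : ℕ} (hq : Fintype.card Fq = q)
    (hn : Module.finrank Fq F = n) (hf : (X - 1) * f = X ^ n - 1) {x : F}
    (h0 : aeval (frobEnd Fq F) f x = 0)
    (h1 : ∀ g : Fq[X], g.Monic → Irreducible g → g ∣ f → aeval (frobEnd Fq F) (f / g) x ≠ 0) :
    IsKNormal Fq q n 1 x := by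
  have hn0 : 0 < n := hn ▸ Module.finrank_pos
  have hm : (X ^ n - 1 : Fq[X]).Monic := monic_X_pow_sub_C (1 : Fq) hn0.ne'
  have hX1 : (X - 1 : Fq[X]).Monic := monic_X_sub_C (1 : Fq)
  have hfm : f.Monic := by
    have := hm
    rw [← hf] at this
    exact hX1.of_mul_monic_left this
  have hdeg : f.natDegree = n - 1 := by
    have e := congrArg natDegree hf
    rw [hX1.natDegree_mul hfm, show (X ^ n - 1 : Fq[X]).natDegree = n from
      natDegree_X_pow_sub_C (r := (1 : Fq)), show (X - 1 : Fq[X]).natDegree = 1 from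
      natDegree_X_sub_C (1 : Fq)] at e
    omega
  have hact : ∀ h : Fq[X], polyAct q h x = aeval (frobEnd Fq F) h x := fun h => by
    rw [aeval_frobEnd_apply, hq]; rfl
  obtain ⟨o, ho⟩ := exists_order (Fq := Fq) x
  refine ⟨f, ⟨hfm, ⟨X - 1, by rw [← hf, mul_comm]⟩, by rw [hact, h0], ?_⟩, hdeg⟩
  intro h' hm' _ hx'
  rw [hact, ho] at hx'
  obtain ⟨c, hc⟩ := (ho f).1 h0
  by_cases hu : IsUnit c
  · have : f ∣ h' := by
      rw [hc]
      exact (hu.mul_right_dvd).2 hx'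
    exact natDegree_le_of_dvd this hm'.ne_zero
  · have hc0 : c ≠ 0 := by rintro rfl; exact hfm.ne_zero (by rw [hc, mul_zero])
    obtain ⟨g, hgm, hgi, hgc⟩ := exists_monic_irreducible_factor c hu
    have hgf : g ∣ f := hgc.trans ⟨o, by rw [hc, mul_comm]⟩
    refine absurd ((ho _).2 ?_) (h1 g hgm hgi hgf)
    rw [dvd_div_iff_mul_dvd_of_dvd hfm.ne_zero hgf, hc, mul_comm]
    exact mul_dvd_mul_left o hgc

theorem index_ker_aeval_div {f : Fq[X]}
    (hf : (X - 1) * f = X ^ (Module.finrank Fq F) - 1)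
    {G : Finset Fq[X]} (hG : ∀ g ∈ G, g.Monic ∧ Irreducible g) (hd : ∀ g ∈ G, g ∣ f) :
    (LinearMap.ker (aeval (frobEnd Fq F) (f / ∏ g ∈ G, g))).toAddSubgroup.index =
      Fintype.card Fq * ∏ g ∈ G, Fintype.card Fq ^ g.natDegree := by
  have hP := prod_dvd_of_monic_irreducible hG hd
  have hm : (∏ g ∈ G, g).Monic := monic_prod_of_monic _ _ fun g hg => (hG g hg).1
  have hX1 : (X - 1 : Fq[X]).Monic := monic_X_sub_C (1 : Fq)
  rw [index_ker_aeval_frobEnd (k := (∏ g ∈ G, g) * (X - 1))]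
  · rw [hm.natDegree_mul hX1, show (X - 1 : Fq[X]).natDegree = 1 from
      natDegree_X_sub_C (1 : Fq), natDegree_prod_of_monic _ _ fun g hg => (hG g hg).1,
      pow_succ', Finset.prod_pow_eq_pow_sum]
  · rw [← mul_assoc, mul_comm (f / _), EuclideanDomain.mul_div_cancel' hm.ne_zero hP, mul_comm, hf]

/-- A unit of a finite field which is not a `p`-th power for any prime `p` dividing the
order of the unit group is a generator. -/
theorem orderOf_eq_of_forall_not_pow {x : Fˣ}
    (h : ∀ p ∈ (Fintype.card F - 1).primeFactors, ¬ ∃ y : Fˣ, y ^ p = x) :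
    orderOf x = Fintype.card F - 1 := by
  classical
  have hcard : Fintype.card Fˣ = Fintype.card F - 1 := Fintype.card_units F
  have hpos : 0 < Fintype.card F - 1 := hcard ▸ Fintype.card_pos
  refine orderOf_eq_of_pow_and_pow_div_prime hpos (by rw [← hcard, pow_card_eq_one]) ?_
  intro p hp hd hx
  refine h p (Nat.mem_primeFactors.2 ⟨hp, hd, hpos.ne'⟩) ?_
  obtain ⟨g, hg⟩ := IsCyclic.exists_generator (α := Fˣ)
  obtain ⟨k, rfl⟩ := (Submonoid.mem_powers_iff _ _).1 (mem_powers_iff_mem_zpowers.2 (hg x))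
  have ho : orderOf g = Fintype.card F - 1 := by
    rw [orderOf_eq_card_of_forall_mem_zpowers hg, Nat.card_eq_fintype_card, hcard]
  rw [← pow_mul] at hx
  have hd2 := orderOf_dvd_of_pow_eq_one hx
  obtain ⟨m, hm⟩ := hd
  rw [ho, hm, Nat.mul_div_cancel_left _ hp.pos] at hd2
  have hm0 : 0 < m := by
    rcases Nat.eq_zero_or_pos m with h0 | h0
    · rw [h0, mul_zero] at hm; omega
    · exact h0
  obtain ⟨c, rfl⟩ := Nat.dvd_of_mul_dvd_mul_right hm0 hd2
  exact ⟨g ^ c, by rw [← pow_mul, mul_comm]⟩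

end FieldEvents

section Master

variable {Fq F : Type*} [Field Fq] [Field F] [Fintype Fq] [Fintype F] [Algebra Fq F]

/-- The three kinds of events a primitive `1`-normal pair has to avoid. -/
noncomputable def badEvent (F : Type*) [Field F] [Algebra Fq F] (f : Fq[X]) :
    ℕ ⊕ (Fq[X] ⊕ Fq[X]) → Fˣ → Prop
  | Sum.inl p, x => ∃ y : Fˣ, y ^ p = x
  | Sum.inr (Sum.inl g), x => aeval (frobEnd Fq F) (f / g) (x : F) = 0
  | Sum.inr (Sum.inr g), x => aeval (frobEnd Fq F) (f / g) ((x⁻¹ : Fˣ) : F) = 0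

/-- The density of each of the events. -/
noncomputable def badWeight (q : ℕ) : ℕ ⊕ (Fq[X] ⊕ Fq[X]) → ℝ
  | Sum.inl p => 1 / p
  | Sum.inr (Sum.inl g) => 1 / (q : ℝ) ^ g.natDegree
  | Sum.inr (Sum.inr g) => 1 / (q : ℝ) ^ g.natDegree

/-- Both `x` and its inverse are annihilated by `f`. -/
def bothKilled (F : Type*) [Field F] [Algebra Fq F] (f : Fq[X]) (x : Fˣ) : Prop :=
  aeval (frobEnd Fq F) f (x : F) = 0 ∧ aeval (frobEnd Fq F) f ((x⁻¹ : Fˣ) : F) = 0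

open Classical in
theorem abs_siftCount_badEvent_sub_le {f : Fq[X]}
    (hf : (X - 1) * f = X ^ (Module.finrank Fq F) - 1) {D : Finset ℕ} {G H : Finset Fq[X]}
    (hD : D ⊆ (Fintype.card F - 1).primeFactors)
    (hG : ∀ g ∈ G, g.Monic ∧ Irreducible g) (hGd : ∀ g ∈ G, g ∣ f)
    (hH : ∀ g ∈ H, g.Monic ∧ Irreducible g) (hHd : ∀ g ∈ H, g ∣ f) :
    |(siftCount (bothKilled F f) (badEvent F f) (D.disjSum (G.disjSum H)) ∅ : ℝ) -
      ((Fintype.card F : ℝ) - 1) / (Fintype.card Fq : ℝ) ^ 2 *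
        ∏ i ∈ D.disjSum (G.disjSum H), badWeight (Fintype.card Fq) i| ≤
      2 * Real.sqrt (Fintype.card F) := by
  classical
  have hn : 0 < Module.finrank Fq F := Module.finrank_pos
  have hf0 : f ≠ 0 := by
    rintro rfl
    exact X_pow_sub_C_ne_zero hn (1 : Fq) (by simpa using hf.symm)
  have hDp : ∀ p ∈ D, p.Prime := fun p hp => Nat.prime_of_mem_primeFactors (hD hp)
  have hcard : Fintype.card Fˣ = Fintype.card F - 1 := Fintype.card_units F
  have hM : ((powMonoidHom (∏ p ∈ D, p) : Fˣ →* Fˣ).range).index = ∏ p ∈ D, p := by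
    rw [IsCyclic.index_powMonoidHom_range, Nat.card_eq_fintype_card, hcard]
    refine Nat.gcd_eq_right ?_
    exact (Finset.prod_dvd_prod_of_subset _ _ (fun p => p) hD).trans (Nat.prod_primeFactors_dvd _)
  have key := abs_card_mem_subgroups_sub_le
    ((powMonoidHom (∏ p ∈ D, p) : Fˣ →* Fˣ).range)
    (LinearMap.ker (aeval (frobEnd Fq F) (f / ∏ g ∈ G, g))).toAddSubgroup
    (LinearMap.ker (aeval (frobEnd Fq F) (f / ∏ g ∈ H, g))).toAddSubgroup
  rw [hM, index_ker_aeval_div hf hG hGd, index_ker_aeval_div hf hH hHd] at key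
  convert key using 3
  · unfold siftCount
    congr 2
    ext x
    simp only [Finset.mem_filter, Finset.mem_univ, true_and, Finset.notMem_empty,
      false_imp_iff, implies_true, and_true, MonoidHom.mem_range, powMonoidHom_apply,
      Submodule.mem_toAddSubgroup, LinearMap.mem_ker]
    rw [← forall_exists_pow_iff D hDp, ← aeval_and_forall_aeval_div_iff hf0 hG hGd,
      ← aeval_and_forall_aeval_div_iff hf0 hH hHd]
    simp only [bothKilled, Finset.mem_disjSum, or_imp, forall_and]
    constructor
    · rintro ⟨⟨h1, h2⟩, h3, h4⟩
      exact ⟨fun p hp => h3 (Sum.inl p) ⟨p, hp, rfl⟩,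
        ⟨h1, fun g hg => h4 (Sum.inr (Sum.inl g)) ⟨_, Or.inl ⟨g, hg, rfl⟩, rfl⟩⟩,
        ⟨h2, fun g hg => h4 (Sum.inr (Sum.inr g)) ⟨_, Or.inr ⟨g, hg, rfl⟩, rfl⟩⟩⟩
    · rintro ⟨h3, ⟨h1, h4⟩, ⟨h2, h5⟩⟩
      refine ⟨⟨h1, h2⟩, ?_, ?_⟩
      · rintro _ ⟨p, hp, rfl⟩
        exact h3 p hp
      · rintro _ ⟨_, ⟨g, hg, rfl⟩ | ⟨g, hg, rfl⟩, rfl⟩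
        · exact h4 g hg
        · exact h5 g hg
  · rw [Finset.prod_disjSum, Finset.prod_disjSum]
    simp only [badWeight, one_div, Finset.prod_inv_distrib]
    push_cast
    field_simp

/-- The sieve criterion for the existence of a primitive `1`-normal pair. -/
theorem exists_pair_of_sieve {q n : ℕ} (hq : Fintype.card Fq = q) (hn : Module.finrank Fq F = n)
    {f : Fq[X]} (hf : (X - 1) * f = X ^ n - 1) (I : Finset Fq[X])
    (hI : ∀ g : Fq[X], g ∈ I ↔ g.Monic ∧ Irreducible g ∧ g ∣ f)
    {PC PS : Finset ℕ} {IC IS : Finset Fq[X]} (hP : PC ∪ PS = (q ^ n - 1).primeFactors)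
    (hPd : Disjoint PC PS) (hIU : ∀ g, g ∈ I ↔ g ∈ IC ∨ g ∈ IS) (hId : Disjoint IC IS)
    (hmain : 2 ^ (PC.card + 2 * IC.card) * (1 + (PS.card + 2 * IS.card)) *
        (2 * Real.sqrt ((q : ℝ) ^ n)) <
      ((q : ℝ) ^ n - 1) / (q : ℝ) ^ 2 *
        ((∏ p ∈ PC, (1 - 1 / (p : ℝ))) * (∏ g ∈ IC, (1 - 1 / (q : ℝ) ^ g.natDegree)) ^ 2) *
        (1 - (∑ p ∈ PS, 1 / (p : ℝ) + 2 * ∑ g ∈ IS, 1 / (q : ℝ) ^ g.natDegree))) :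
    ∃ α : F, α ≠ 0 ∧ orderOf α = q ^ n - 1 ∧ orderOf α⁻¹ = q ^ n - 1 ∧
      IsKNormal Fq q n 1 α ∧ IsKNormal Fq q n 1 α⁻¹ := by
  classical
  have hQ : Fintype.card F = q ^ n := by
    rw [Module.card_eq_pow_finrank (K := Fq), hq, hn]
  have hsub : ∀ J ⊆ (PC ∪ PS).disjSum (I.disjSum I),
      |(siftCount (bothKilled F f) (badEvent F f) J ∅ : ℝ) -
        ((q : ℝ) ^ n - 1) / (q : ℝ) ^ 2 * ∏ i ∈ J, badWeight q i| ≤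
        2 * Real.sqrt ((q : ℝ) ^ n) := by
    intro J hJ
    have hJ1 : J.toLeft ⊆ PC ∪ PS := fun p hp => by
      simpa using hJ (Finset.mem_toLeft.1 hp)
    have hJ2 : J.toRight.toLeft ⊆ I := fun p hp => by
      simpa using hJ (Finset.mem_toRight.1 (Finset.mem_toLeft.1 hp))
    have hJ3 : J.toRight.toRight ⊆ I := fun p hp => by
      simpa using hJ (Finset.mem_toRight.1 (Finset.mem_toRight.1 hp))
    have := abs_siftCount_badEvent_sub_le (F := F) (f := f) (by rw [hf, hn]) (D := J.toLeft)
      (G := J.toRight.toLeft) (H := J.toRight.toRight) (by rw [hQ, ← hP]; exact hJ1)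
      (fun g hg => ⟨((hI g).1 (hJ2 hg)).1, ((hI g).1 (hJ2 hg)).2.1⟩)
      (fun g hg => ((hI g).1 (hJ2 hg)).2.2)
      (fun g hg => ⟨((hI g).1 (hJ3 hg)).1, ((hI g).1 (hJ3 hg)).2.1⟩)
      (fun g hg => ((hI g).1 (hJ3 hg)).2.2)
    rw [Finset.toLeft_disjSum_toRight, Finset.toLeft_disjSum_toRight, hQ, hq] at this
    push_cast at this
    exact this
  have hsieve := le_siftCount_union (C := PC.disjSum (IC.disjSum IC))
    (S := PS.disjSum (IS.disjSum IS)) hsub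
    (by
      rw [Finset.disjoint_left]
      rintro (p | g | g) h1 h2
      · simp only [Finset.inl_mem_disjSum] at h1 h2
        exact Finset.disjoint_left.1 hPd h1 h2
      all_goals
        simp only [Finset.inr_mem_disjSum, Finset.inl_mem_disjSum] at h1 h2
        exact Finset.disjoint_left.1 hId h1 h2)
    (Finset.disjSum_mono Finset.subset_union_left (Finset.disjSum_mono (fun g hg => (hIU g).2 (Or.inl hg)) fun g hg => (hIU g).2 (Or.inl hg)))
    (Finset.disjSum_mono Finset.subset_union_right (Finset.disjSum_mono (fun g hg => (hIU g).2 (Or.inr hg)) fun g hg => (hIU g).2 (Or.inr hg)))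
  have hpos : 0 < siftCount (bothKilled F f) (badEvent F f) ∅
      (PC.disjSum (IC.disjSum IC) ∪ PS.disjSum (IS.disjSum IS)) := by
    rw [← Nat.cast_pos (α := ℝ)]
    refine lt_of_lt_of_le ?_ hsieve
    simp only [Finset.prod_disjSum, Finset.sum_disjSum, Finset.card_disjSum, badWeight]
    rw [sub_pos]
    refine lt_of_eq_of_lt ?_ (lt_of_lt_of_eq hmain ?_)
    · push_cast
      ring
    · ring
  obtain ⟨x, hx⟩ := Finset.card_pos.1 hpos
  simp only [Finset.mem_filter, Finset.mem_univ, true_and] at hx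
  obtain ⟨⟨hx1, hx2⟩, -, hx3⟩ := hx
  have horder : orderOf x = q ^ n - 1 := by
    rw [← hQ]
    refine orderOf_eq_of_forall_not_pow fun p hp => ?_
    rw [hQ, ← hP, Finset.mem_union] at hp
    refine hx3 (Sum.inl p) ?_
    rcases hp with hp | hp <;> simp [hp]
  refine ⟨x, x.ne_zero, by rw [orderOf_units, horder], ?_, ?_, ?_⟩
  · rw [← Units.val_inv_eq_inv_val, orderOf_units, orderOf_inv, horder]
  · refine isKNormal_one_of_aeval hq hn hf hx1 fun g h1 h2 h3 => hx3 (Sum.inr (Sum.inl g)) ?_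
    rcases (hIU g).1 ((hI g).2 ⟨h1, h2, h3⟩) with hp | hp <;> simp [hp]
  · rw [← Units.val_inv_eq_inv_val]
    refine isKNormal_one_of_aeval hq hn hf hx2 fun g h1 h2 h3 => hx3 (Sum.inr (Sum.inr g)) ?_
    rcases (hIU g).1 ((hI g).2 ⟨h1, h2, h3⟩) with hp | hp <;> simp [hp]

end Master

section Counts

theorem dvd_X_pow_sub_one_gcd {K : Type*} [Field K] (g : K[X]) (a b : ℕ) :
    g ∣ X ^ a.gcd b - 1 ↔ g ∣ X ^ a - 1 ∧ g ∣ X ^ b - 1 := by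
  have key : ∀ m : ℕ, g ∣ X ^ m - 1 ↔ orderOf (AdjoinRoot.root g) ∣ m := fun m => by
    rw [orderOf_dvd_iff_pow_eq_one, ← AdjoinRoot.mk_eq_zero, map_sub, map_pow, AdjoinRoot.mk_X,
      map_one, sub_eq_zero]
  simp only [key, Nat.dvd_gcd_iff]

theorem sum_natDegree_eq_of_squarefree {K : Type*} [Field K] {h : K[X]} (hh : Squarefree h)
    (J : Finset K[X]) (hJ : ∀ g, g ∈ J ↔ g.Monic ∧ Irreducible g ∧ g ∣ h) :
    ∑ g ∈ J, g.natDegree = h.natDegree := by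
  obtain ⟨c, hc⟩ := prod_dvd_of_monic_irreducible (c := h)
    (fun g hg => ⟨((hJ g).1 hg).1, ((hJ g).1 hg).2.1⟩) (fun g hg => ((hJ g).1 hg).2.2)
  have hu : IsUnit c := by
    by_contra hu
    obtain ⟨g, hgm, hgi, hgc⟩ := exists_monic_irreducible_factor c hu
    have hgJ : g ∈ J := (hJ g).2 ⟨hgm, hgi, hgc.trans ⟨_, by rw [hc, mul_comm]⟩⟩
    have hgP : g ∣ ∏ g ∈ J, g := Finset.dvd_prod_of_mem (fun g => g) hgJ
    exact hgi.not_isUnit (hh g (hc ▸ mul_dvd_mul hgP hgc))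
  have hm : (∏ g ∈ J, g).Monic := monic_prod_of_monic _ _ fun g hg => ((hJ g).1 hg).1
  have hc0 : c ≠ 0 := hu.ne_zero
  rw [hc, natDegree_mul hm.ne_zero hc0, natDegree_eq_zero_of_isUnit hu, add_zero,
    natDegree_prod_of_monic _ _ fun g hg => ((hJ g).1 hg).1]

variable {Fq : Type*} [Field Fq] [Fintype Fq]

theorem dvd_and_natDegree_dvd_iff {q n e : ℕ} (hq : Fintype.card Fq = q) (hn : 0 < n)
    {g : Fq[X]} (hg : Irreducible g) :
    g ∣ X ^ n.gcd (q ^ e - 1) - 1 ↔ g ∣ X ^ n - 1 ∧ g.natDegree ∣ e := by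
  have hq1 : 1 < q := hq ▸ Fintype.one_lt_card
  have hqe : 1 ≤ q ^ e := Nat.one_le_pow _ _ (by omega)
  rw [dvd_X_pow_sub_one_gcd, hg.natDegree_dvd_iff_dvd_X_pow_card_pow_sub_X,
    Nat.card_eq_fintype_card, hq]
  refine and_congr_right fun h1 => ?_
  have hsplit : (X ^ q ^ e - X : Fq[X]) = X * (X ^ (q ^ e - 1) - 1) := by
    rw [mul_sub, mul_one, ← pow_succ', Nat.sub_add_cancel hqe]
  rw [hsplit]
  refine ⟨fun h => h.mul_left _, fun h => (hg.prime.dvd_or_dvd h).resolve_left fun hX => ?_⟩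
  have h2 : g ∣ 1 := by
    have : g ∣ X ^ n := hX.trans (dvd_pow_self _ hn.ne')
    simpa using dvd_sub this h1
  exact hg.not_isUnit (isUnit_of_dvd_one h2)

theorem natCast_ne_zero_of_dvd_card_pow_sub_one {q m e : ℕ} (hq : Fintype.card Fq = q)
    (he : 0 < e) (hm : m ∣ q ^ e - 1) : (m : Fq) ≠ 0 := by
  intro h0
  have hq1 : 1 < q := hq ▸ Fintype.one_lt_card
  have hqe : 1 ≤ q ^ e := Nat.one_le_pow _ _ (by omega)
  obtain ⟨c, hc⟩ := hm
  have h1 : ((q ^ e - 1 : ℕ) : Fq) = 0 := by rw [hc, Nat.cast_mul, h0, zero_mul]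
  rw [Nat.cast_sub hqe, Nat.cast_pow, ← hq, FiniteField.cast_card_eq_zero,
    zero_pow he.ne'] at h1
  simp at h1

theorem sum_natDegree_factors_dvd {q n e : ℕ} (hq : Fintype.card Fq = q) (hn : 0 < n)
    (he : 0 < e) (J : Finset Fq[X])
    (hJ : ∀ g, g ∈ J ↔ g.Monic ∧ Irreducible g ∧ g ∣ X ^ n - 1) :
    ∑ g ∈ J.filter (fun g => g.natDegree ∣ e), g.natDegree = n.gcd (q ^ e - 1) := by
  have hpos : 0 < n.gcd (q ^ e - 1) := Nat.gcd_pos_of_pos_left _ hn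
  have hne : ((n.gcd (q ^ e - 1) : ℕ) : Fq) ≠ 0 :=
    natCast_ne_zero_of_dvd_card_pow_sub_one hq he (Nat.gcd_dvd_right _ _)
  have hsq : Squarefree (X ^ n.gcd (q ^ e - 1) - 1 : Fq[X]) :=
    (X_pow_sub_one_separable_iff.2 hne).squarefree
  rw [sum_natDegree_eq_of_squarefree hsq]
  · exact natDegree_X_pow_sub_C (r := (1 : Fq))
  · intro g
    rw [Finset.mem_filter, hJ]
    constructor
    · rintro ⟨⟨h1, h2, h3⟩, h4⟩
      exact ⟨h1, h2, (dvd_and_natDegree_dvd_iff hq hn h2).2 ⟨h3, h4⟩⟩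
    · rintro ⟨h1, h2, h3⟩
      have := (dvd_and_natDegree_dvd_iff hq hn h2).1 h3
      exact ⟨⟨h1, h2, this.1⟩, this.2⟩

theorem exists_monic_irreducible_factors {K : Type*} [Field K] {h : K[X]} (h0 : h ≠ 0) :
    ∃ J : Finset K[X], ∀ g, g ∈ J ↔ g.Monic ∧ Irreducible g ∧ g ∣ h := by
  classical
  refine ⟨(UniqueFactorizationMonoid.normalizedFactors h).toFinset, fun g => ?_⟩
  rw [Multiset.mem_toFinset, UniqueFactorizationMonoid.mem_normalizedFactors_iff' h0]
  constructor
  · rintro ⟨h1, h2, h3⟩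
    exact ⟨(normalize_eq_self_iff_monic h1.ne_zero).1 h2, h1, h3⟩
  · rintro ⟨h1, h2, h3⟩
    exact ⟨h2, (normalize_eq_self_iff_monic h2.ne_zero).2 h1, h3⟩

theorem natCast_eq_zero_iff_not_coprime {q n : ℕ} (hq : Fintype.card Fq = q) :
    (n : Fq) = 0 ↔ ¬ n.Coprime q := by
  obtain ⟨p, hp⟩ := CharP.exists Fq
  obtain ⟨k, hprime, hk⟩ := FiniteField.card Fq p
  rw [CharP.cast_eq_zero_iff Fq p, ← hq, hk, Nat.coprime_pow_right_iff k.pos,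
    Nat.coprime_comm, Nat.Prime.coprime_iff_not_dvd hprime, not_not]

/-- The number of monic irreducible factors of `(X ^ n - 1) / (X - 1)` of degrees `1, 2, 3`. -/
theorem card_factors {q n : ℕ} (hq : Fintype.card Fq = q) (hn : 0 < n) {f : Fq[X]}
    (hf : (X - 1) * f = X ^ n - 1) (I : Finset Fq[X])
    (hI : ∀ g : Fq[X], g ∈ I ↔ g.Monic ∧ Irreducible g ∧ g ∣ f) :
    (I.filter fun g => g.natDegree = 1).card + (if n.Coprime q then 1 else 0) =
        n.gcd (q - 1) ∧
      2 * (I.filter fun g => g.natDegree = 2).card + n.gcd (q - 1) = n.gcd (q ^ 2 - 1) ∧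
      3 * (I.filter fun g => g.natDegree = 3).card + n.gcd (q - 1) = n.gcd (q ^ 3 - 1) ∧
      ∑ g ∈ I, g.natDegree ≤ n - 1 := by
  classical
  have hX1 : (X - 1 : Fq[X]).Monic := monic_X_sub_C (1 : Fq)
  have hX1i : Irreducible (X - 1 : Fq[X]) := irreducible_X_sub_C (1 : Fq)
  have hX1d : (X - 1 : Fq[X]).natDegree = 1 := natDegree_X_sub_C (1 : Fq)
  have h0 : (X ^ n - 1 : Fq[X]) ≠ 0 := X_pow_sub_C_ne_zero hn (1 : Fq)
  have hf0 : f ≠ 0 := by rintro rfl; exact h0 (by rw [← hf, mul_zero])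
  have hdeg : f.natDegree = n - 1 := by
    have e := congrArg natDegree hf
    rw [natDegree_mul hX1.ne_zero hf0, show (X ^ n - 1 : Fq[X]).natDegree = n from
      natDegree_X_pow_sub_C (r := (1 : Fq)), hX1d] at e
    omega
  have hmem : (X - 1 ∈ I) ↔ ¬ n.Coprime q := by
    rw [hI, ← natCast_eq_zero_iff_not_coprime hq (Fq := Fq), and_iff_right hX1,
      and_iff_right hX1i, show (X - 1 : Fq[X]) = X - C 1 by simp, dvd_iff_isRoot, IsRoot]
    have e := congrArg (fun h => eval 1 (derivative h)) hf
    simp only [derivative_mul, derivative_sub, derivative_X, derivative_one, sub_zero, one_mul,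
      eval_add, eval_mul, eval_sub, eval_X, eval_one, sub_self, zero_mul, add_zero,
      derivative_X_pow, eval_pow, one_pow, mul_one, eval_C] at e
    rw [e]
  obtain ⟨J, hJ⟩ := exists_monic_irreducible_factors h0
  have hIJ : insert (X - 1) I = J := by
    ext g
    rw [Finset.mem_insert, hI, hJ, ← hf]
    constructor
    · rintro (rfl | ⟨h1, h2, h3⟩)
      · exact ⟨hX1, hX1i, dvd_mul_right _ _⟩
      · exact ⟨h1, h2, h3.mul_left _⟩
    · rintro ⟨h1, h2, h3⟩
      rcases h2.prime.dvd_or_dvd h3 with h | h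
      · exact Or.inl (eq_of_monic_of_associated h1 hX1 (h2.associated_of_dvd hX1i h))
      · exact Or.inr ⟨h1, h2, h⟩
  have hsum : ∀ e, ∑ g ∈ J.filter (fun g => g.natDegree = e), g.natDegree =
      e * (J.filter fun g => g.natDegree = e).card := fun e => by
    rw [Finset.sum_congr rfl fun g hg => (Finset.mem_filter.1 hg).2, Finset.sum_const,
      smul_eq_mul, mul_comm]
  have hone : (J.filter fun g => g.natDegree = 1).card = n.gcd (q - 1) := by
    have := sum_natDegree_factors_dvd hq hn one_pos J hJ
    simp only [Nat.dvd_one, hsum, one_mul, pow_one] at this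
    exact this
  have htwo : ∀ e, e.Prime → n.gcd (q - 1) + e * (J.filter fun g => g.natDegree = e).card =
      n.gcd (q ^ e - 1) := fun e he => by
    have := sum_natDegree_factors_dvd hq hn he.pos J hJ
    simp only [Nat.dvd_prime he] at this
    rw [Finset.filter_or, Finset.sum_union, hsum, hsum, one_mul, hone] at this
    · exact this
    · rw [Finset.disjoint_filter]
      intro g _ h1 h2
      exact he.one_lt.ne (h1.symm.trans h2)
  have hother : ∀ e, 1 < e → J.filter (fun g => g.natDegree = e) =
      I.filter fun g => g.natDegree = e := fun e he => by
    rw [← hIJ, Finset.filter_insert, if_neg]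
    rw [hX1d]
    omega
  refine ⟨?_, ?_, ?_, ?_⟩
  · rw [← hone, ← hIJ, Finset.filter_insert, if_pos hX1d]
    split_ifs with hc
    · rw [Finset.card_insert_of_notMem]
      rw [Finset.mem_filter, hmem]
      exact fun h => h.1 hc
    · rw [Finset.insert_eq_of_mem, add_zero]
      exact Finset.mem_filter.2 ⟨hmem.2 hc, hX1d⟩
  · rw [← htwo 2 Nat.prime_two, hother 2 (by norm_num), add_comm]
  · rw [← htwo 3 Nat.prime_three, hother 3 (by norm_num), add_comm]
  · have hm : ∀ g ∈ I, g.Monic := fun g hg => ((hI g).1 hg).1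
    rw [← natDegree_prod_of_monic _ _ hm, ← hdeg]
    exact natDegree_le_of_dvd (prod_dvd_of_monic_irreducible
      (fun g hg => ⟨((hI g).1 hg).1, ((hI g).1 hg).2.1⟩) fun g hg => ((hI g).1 hg).2.2) hf0

end Counts

section CountedSieve

/-- The number of linear factors of `(X ^ n - 1) / (X - 1)` over the field with `q` elements. -/
def numLinear (q n : ℕ) : ℕ := n.gcd (q - 1) - if n.gcd q = 1 then 1 else 0

/-- The number of its irreducible quadratic factors. -/
def numQuadratic (q n : ℕ) : ℕ := (n.gcd (q ^ 2 - 1) - n.gcd (q - 1)) / 2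

/-- The number of its irreducible cubic factors. -/
def numCubic (q n : ℕ) : ℕ := (n.gcd (q ^ 3 - 1) - n.gcd (q - 1)) / 3

/-- An upper bound for the number of its irreducible factors of degree at least four. -/
def numHigher (q n : ℕ) : ℕ :=
  (n - 1 - numLinear q n - 2 * numQuadratic q n - 3 * numCubic q n) / 4

theorem exists_subset_card_prod {Fq : Type*} [Field Fq] {I : Finset Fq[X]} {e c N q : ℕ}
    (hN : (I.filter fun g => g.natDegree = e).card = N) (hc : c ≤ N) :
    ∃ C ⊆ I.filter (fun g => g.natDegree = e), C.card = c ∧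
      ∏ g ∈ C, (1 - 1 / (q : ℝ) ^ g.natDegree) = (1 - 1 / (q : ℝ) ^ e) ^ c ∧
      ∀ S ⊆ I.filter (fun g => g.natDegree = e), Disjoint C S →
        S.card ≤ N - c ∧ ∑ g ∈ S, 1 / (q : ℝ) ^ g.natDegree ≤ ((N - c : ℕ) : ℝ) / (q : ℝ) ^ e := by
  classical
  obtain ⟨C, hC, hcard⟩ := Finset.exists_subset_card_eq (hN ▸ hc)
  refine ⟨C, hC, hcard, ?_, fun S hS hd => ?_⟩
  · rw [Finset.prod_congr rfl fun g hg => by rw [(Finset.mem_filter.1 (hC hg)).2],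
      Finset.prod_const, hcard]
  · have h1 : S.card ≤ N - c := by
      have := Finset.card_le_card (Finset.union_subset hC hS)
      rw [Finset.card_union_of_disjoint hd, hN, hcard] at this
      omega
    refine ⟨h1, ?_⟩
    rw [Finset.sum_congr rfl fun g hg => by rw [(Finset.mem_filter.1 (hS hg)).2],
      Finset.sum_const, nsmul_eq_mul, mul_one_div]
    gcongr

variable {Fq F : Type*} [Field Fq] [Field F] [Fintype Fq] [Fintype F] [Algebra Fq F]

/-- The sieve criterion in terms of the numbers of core factors of degrees `1, 2, 3`. -/
theorem exists_pair_of_counts {q n : ℕ} (hq : Fintype.card Fq = q) (hn : Module.finrank Fq F = n)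
    {PC PS : Finset ℕ} (hP : PC ∪ PS = (q ^ n - 1).primeFactors) (hPd : Disjoint PC PS)
    {c₁ c₂ c₃ : ℕ} (h₁ : c₁ ≤ numLinear q n) (h₂ : c₂ ≤ numQuadratic q n)
    (h₃ : c₃ ≤ numCubic q n)
    (hmain : 2 ^ (PC.card + 2 * (c₁ + c₂ + c₃)) * (1 + (PS.card + 2 *
        (((numLinear q n - c₁ + (numQuadratic q n - c₂) + (numCubic q n - c₃) +
          numHigher q n : ℕ)) : ℝ))) * (2 * Real.sqrt ((q : ℝ) ^ n)) <
      ((q : ℝ) ^ n - 1) / (q : ℝ) ^ 2 *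
        ((∏ p ∈ PC, (1 - 1 / (p : ℝ))) * ((1 - 1 / (q : ℝ) ^ 1) ^ c₁ * (1 - 1 / (q : ℝ) ^ 2) ^ c₂ *
          (1 - 1 / (q : ℝ) ^ 3) ^ c₃) ^ 2) *
        (1 - (∑ p ∈ PS, 1 / (p : ℝ) + 2 * (((numLinear q n - c₁ : ℕ) : ℝ) / (q : ℝ) ^ 1 +
          ((numQuadratic q n - c₂ : ℕ) : ℝ) / (q : ℝ) ^ 2 +
          ((numCubic q n - c₃ : ℕ) : ℝ) / (q : ℝ) ^ 3 + (numHigher q n : ℝ) / (q : ℝ) ^ 4)))) :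
    ∃ α : F, α ≠ 0 ∧ orderOf α = q ^ n - 1 ∧ orderOf α⁻¹ = q ^ n - 1 ∧
      IsKNormal Fq q n 1 α ∧ IsKNormal Fq q n 1 α⁻¹ := by
  classical
  have hn0 : 0 < n := hn ▸ Module.finrank_pos
  have hq1 : 1 < q := hq ▸ Fintype.one_lt_card
  have hq1' : (1 : ℝ) < q := by exact_mod_cast hq1
  obtain ⟨f, hf⟩ : (X - 1 : Fq[X]) ∣ X ^ n - 1 := sub_one_dvd_pow_sub_one X n
  have hf0 : f ≠ 0 := by
    rintro rfl
    exact X_pow_sub_C_ne_zero hn0 (1 : Fq) (by simpa using hf)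
  obtain ⟨I, hI⟩ := exists_monic_irreducible_factors hf0
  obtain ⟨k1, k2, k3, k4⟩ := card_factors hq hn0 hf.symm I hI
  have hN₁ : (I.filter fun g => g.natDegree = 1).card = numLinear q n := by
    unfold numLinear
    simp only [Nat.coprime_iff_gcd_eq_one] at k1
    omega
  have hN₂ : (I.filter fun g => g.natDegree = 2).card = numQuadratic q n := by
    unfold numQuadratic
    omega
  have hN₃ : (I.filter fun g => g.natDegree = 3).card = numCubic q n := by
    unfold numCubic
    omega
  have hIpos : ∀ g ∈ I, 0 < g.natDegree := fun g hg => ((hI g).1 hg).2.1.natDegree_pos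
  have hN₄ : (I.filter fun g => 4 ≤ g.natDegree).card ≤ numHigher q n := by
    have hle : ∀ g ∈ I, (if g.natDegree = 1 then 1 else 0) + 2 * (if g.natDegree = 2 then 1 else 0)
        + 3 * (if g.natDegree = 3 then 1 else 0) + 4 * (if 4 ≤ g.natDegree then 1 else 0) ≤
        g.natDegree := by
      intro g hg
      have := hIpos g hg
      split_ifs <;> omega
    have := (Finset.sum_le_sum hle).trans k4
    simp only [Finset.sum_add_distrib, ← Finset.mul_sum, Finset.sum_boole, Nat.cast_id] at this
    rw [hN₁, hN₂, hN₃] at this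
    unfold numHigher
    omega
  obtain ⟨C₁, s₁, t₁, u₁, v₁⟩ := exists_subset_card_prod (q := q) hN₁ h₁
  obtain ⟨C₂, s₂, t₂, u₂, v₂⟩ := exists_subset_card_prod (q := q) hN₂ h₂
  obtain ⟨C₃, s₃, t₃, u₃, v₃⟩ := exists_subset_card_prod (q := q) hN₃ h₃
  have hfd : ∀ a b, a ≠ b → Disjoint (I.filter fun g => g.natDegree = a)
      (I.filter fun g => g.natDegree = b) := fun a b hab => by
    rw [Finset.disjoint_filter]
    exact fun g _ h1 h2 => hab (h1.symm.trans h2)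
  have d12 : Disjoint C₁ C₂ := Finset.disjoint_of_subset_left s₁
    (Finset.disjoint_of_subset_right s₂ (hfd 1 2 (by norm_num)))
  have d123 : Disjoint (C₁ ∪ C₂) C₃ := by
    rw [Finset.disjoint_union_left]
    exact ⟨Finset.disjoint_of_subset_left s₁
      (Finset.disjoint_of_subset_right s₃ (hfd 1 3 (by norm_num))),
      Finset.disjoint_of_subset_left s₂
      (Finset.disjoint_of_subset_right s₃ (hfd 2 3 (by norm_num)))⟩
  have hsubI : C₁ ∪ C₂ ∪ C₃ ⊆ I := Finset.union_subset (Finset.union_subset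
    (s₁.trans (Finset.filter_subset _ _)) (s₂.trans (Finset.filter_subset _ _)))
    (s₃.trans (Finset.filter_subset _ _))
  set IC := C₁ ∪ C₂ ∪ C₃ with hIC
  set IS := I \ IC with hIS
  have hIS_sub : IS ⊆ I := Finset.sdiff_subset
  have hdisj : Disjoint IC IS := Finset.disjoint_sdiff
  have hdisj' : ∀ C ⊆ IC, ∀ S ⊆ IS, Disjoint C S := fun C hC S hS =>
    Finset.disjoint_of_subset_left hC (Finset.disjoint_of_subset_right hS hdisj)
  have hsplit : ∀ φ : Fq[X] → ℝ, ∑ g ∈ IS, φ g = ∑ g ∈ IS.filter (fun g => g.natDegree = 1), φ g +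
      ∑ g ∈ IS.filter (fun g => g.natDegree = 2), φ g +
      ∑ g ∈ IS.filter (fun g => g.natDegree = 3), φ g +
      ∑ g ∈ IS.filter (fun g => 4 ≤ g.natDegree), φ g := by
    intro φ
    simp only [Finset.sum_filter, ← Finset.sum_add_distrib]
    refine Finset.sum_congr rfl fun g hg => ?_
    have := hIpos g (hIS_sub hg)
    split_ifs <;> first | omega | simp
  have b₁ := v₁ (IS.filter fun g => g.natDegree = 1) (Finset.filter_subset_filter _ hIS_sub)
    (hdisj' _ (by rw [hIC, Finset.union_assoc]; exact Finset.subset_union_left) _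
      (Finset.filter_subset _ _))
  have b₂ := v₂ (IS.filter fun g => g.natDegree = 2) (Finset.filter_subset_filter _ hIS_sub)
    (hdisj' _ (Finset.subset_union_right.trans Finset.subset_union_left) _
      (Finset.filter_subset _ _))
  have b₃ := v₃ (IS.filter fun g => g.natDegree = 3) (Finset.filter_subset_filter _ hIS_sub)
    (hdisj' _ Finset.subset_union_right _ (Finset.filter_subset _ _))
  have b₄ : (IS.filter fun g => 4 ≤ g.natDegree).card ≤ numHigher q n :=
    (Finset.card_le_card (Finset.filter_subset_filter _ hIS_sub)).trans hN₄
  have b₄' : ∑ g ∈ IS.filter (fun g => 4 ≤ g.natDegree), 1 / (q : ℝ) ^ g.natDegree ≤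
      (numHigher q n : ℝ) / (q : ℝ) ^ 4 := by
    calc _ ≤ ∑ g ∈ IS.filter (fun g => 4 ≤ g.natDegree), 1 / (q : ℝ) ^ 4 :=
          Finset.sum_le_sum fun g hg => by
            have := (Finset.mem_filter.1 hg).2
            gcongr
            exact hq1'.le
      _ = ((IS.filter (fun g => 4 ≤ g.natDegree)).card : ℝ) / (q : ℝ) ^ 4 := by
          rw [Finset.sum_const, nsmul_eq_mul, mul_one_div]
      _ ≤ _ := by gcongr
  have hcardIS : IS.card ≤ numLinear q n - c₁ + (numQuadratic q n - c₂) + (numCubic q n - c₃) +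
      numHigher q n := by
    have := hsplit fun _ => 1
    simp only [Finset.sum_const, nsmul_eq_mul, mul_one] at this
    have : IS.card = (IS.filter fun g => g.natDegree = 1).card +
      (IS.filter fun g => g.natDegree = 2).card + (IS.filter fun g => g.natDegree = 3).card +
      (IS.filter fun g => 4 ≤ g.natDegree).card := by exact_mod_cast this
    have := b₁.1
    have := b₂.1
    have := b₃.1
    omega
  refine exists_pair_of_sieve hq hn hf.symm I hI hP hPd (IC := IC) (IS := IS)
    (fun g => ?_) hdisj ?_
  · constructor
    · intro hg
      by_cases h : g ∈ IC
      · exact Or.inl h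
      · exact Or.inr (Finset.mem_sdiff.2 ⟨hg, h⟩)
    · rintro (h | h)
      · exact hsubI h
      · exact hIS_sub h
  · have hcardIC : IC.card = c₁ + c₂ + c₃ := by
      rw [hIC, Finset.card_union_of_disjoint d123, Finset.card_union_of_disjoint d12, t₁, t₂, t₃]
    have hprodIC : ∏ g ∈ IC, (1 - 1 / (q : ℝ) ^ g.natDegree) = (1 - 1 / (q : ℝ) ^ 1) ^ c₁ *
        (1 - 1 / (q : ℝ) ^ 2) ^ c₂ * (1 - 1 / (q : ℝ) ^ 3) ^ c₃ := by
      rw [hIC, Finset.prod_union d123, Finset.prod_union d12, u₁, u₂, u₃]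
    rw [hcardIC, hprodIC]
    refine lt_of_le_of_lt ?_ (lt_of_lt_of_le hmain ?_)
    · have : (IS.card : ℝ) ≤ ((numLinear q n - c₁ + (numQuadratic q n - c₂) +
        (numCubic q n - c₃) + numHigher q n : ℕ) : ℝ) := by exact_mod_cast hcardIS
      gcongr
    · refine mul_le_mul_of_nonneg_left ?_ ?_
      · rw [hsplit]
        linarith [b₁.2, b₂.2, b₃.2]
      · have hge : (1 : ℝ) ≤ (q : ℝ) ^ n := one_le_pow₀ hq1'.le
        have hprod : 0 ≤ ∏ p ∈ PC, (1 - 1 / (p : ℝ)) := by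
          refine Finset.prod_nonneg fun p hp => ?_
          have hp1 : 1 ≤ p := (Nat.prime_of_mem_primeFactors
            (hP ▸ Finset.mem_union_left PS hp)).one_le
          have : (1 : ℝ) ≤ p := by exact_mod_cast hp1
          rw [sub_nonneg, div_le_one (by linarith)]
          exact this
        have : 0 ≤ (q : ℝ) ^ n - 1 := by linarith
        positivity

end CountedSieve

section PrimeProduct

/-- The primes `p` with `p ≤ (2 p / (p - 1)) ^ 6`. -/
def tinyPrimes : Finset ℕ := {2, 3, 5, 7, 11, 13, 17, 19, 23, 29, 31, 37, 41, 43, 47, 53, 59, 61, 67}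

theorem mem_tinyPrimes {p : ℕ} (hp : p.Prime) (h : p ≤ 70) : p ∈ tinyPrimes := by
  unfold tinyPrimes
  interval_cases p <;> first | decide | (exfalso; revert hp; norm_num)

theorem sixth_power_prod_le (D : Finset ℕ) (hD : ∀ p ∈ D, p.Prime) :
    (2 ^ D.card : ℝ) ^ 6 ≤ 557172959423828 * (∏ p ∈ D, (p : ℝ)) *
      (∏ p ∈ D, (1 - 1 / (p : ℝ))) ^ 6 := by
  set g : ℕ → ℝ := fun p => 2 ^ 6 / (p * (1 - 1 / (p : ℝ)) ^ 6) with hg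
  have hpos : ∀ p : ℕ, p.Prime → 0 < (p : ℝ) * (1 - 1 / (p : ℝ)) ^ 6 := fun p hp => by
    have : (1 : ℝ) < p := by exact_mod_cast hp.one_lt
    have h2 : 0 < 1 - 1 / (p : ℝ) := by
      rw [sub_pos, div_lt_one (by linarith)]
      exact this
    positivity
  have htiny : ∀ p ∈ tinyPrimes, 1 ≤ g p := by
    intro p hp
    simp only [tinyPrimes, Finset.mem_insert, Finset.mem_singleton] at hp
    rcases hp with rfl | rfl | rfl | rfl | rfl | rfl | rfl | rfl | rfl | rfl | rfl | rfl | rfl |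
      rfl | rfl | rfl | rfl | rfl | rfl <;> norm_num [hg]
  have hlarge : ∀ p ∈ D \ tinyPrimes, g p ≤ 1 := by
    intro p hp
    rw [Finset.mem_sdiff] at hp
    have hpp := hD p hp.1
    have h70 : 71 ≤ p := by
      by_contra h
      exact hp.2 (mem_tinyPrimes hpp (by omega))
    have h70' : (71 : ℝ) ≤ p := by exact_mod_cast h70
    rw [hg]
    simp only
    rw [div_le_one (hpos p hpp)]
    have h1 : 70 / 71 ≤ 1 - 1 / (p : ℝ) := by
      rw [le_sub_comm]
      norm_num
      rw [inv_le_comm₀ (by linarith) (by norm_num)]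
      linarith
    calc (2 : ℝ) ^ 6 ≤ 71 * (70 / 71) ^ 6 := by norm_num
      _ ≤ (p : ℝ) * (1 - 1 / (p : ℝ)) ^ 6 := by gcongr
  have hprod : ∏ p ∈ D, g p ≤ 557172959423828 := by
    rw [← Finset.prod_inter_mul_prod_sdiff D tinyPrimes]
    have e1 : ∏ p ∈ D \ tinyPrimes, g p ≤ 1 := Finset.prod_le_one (fun p hp =>
      (div_pos (by norm_num) (hpos p (hD p (Finset.sdiff_subset hp)))).le) hlarge
    have e2 : 1 ≤ ∏ p ∈ tinyPrimes \ D, g p :=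
      Finset.prod_induction _ (fun x : ℝ => 1 ≤ x) (fun a b ha hb => one_le_mul_of_one_le_of_one_le ha hb)
        le_rfl fun p hp => htiny p (Finset.sdiff_subset hp)
    have e3 : 0 ≤ ∏ p ∈ D ∩ tinyPrimes, g p := Finset.prod_nonneg fun p hp =>
      zero_le_one.trans (htiny p (Finset.mem_inter.1 hp).2)
    have e4 : ∏ p ∈ tinyPrimes, g p ≤ 557172959423828 := by
      norm_num [tinyPrimes, hg]
    rw [← Finset.prod_inter_mul_prod_sdiff tinyPrimes D, Finset.inter_comm] at e4
    calc _ ≤ (∏ p ∈ D ∩ tinyPrimes, g p) * 1 := by gcongr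
      _ ≤ (∏ p ∈ D ∩ tinyPrimes, g p) * ∏ p ∈ tinyPrimes \ D, g p := by gcongr
      _ ≤ _ := e4
  have hdpos : 0 < ∏ p ∈ D, ((p : ℝ) * (1 - 1 / (p : ℝ)) ^ 6) :=
    Finset.prod_pos fun p hp => hpos p (hD p hp)
  rw [hg, Finset.prod_div_distrib, div_le_iff₀ hdpos, Finset.prod_const, Finset.prod_mul_distrib,
    Finset.prod_pow] at hprod
  calc _ = ((2 : ℝ) ^ 6) ^ D.card := by rw [← pow_mul, ← pow_mul, mul_comm]
    _ ≤ _ := hprod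
    _ = _ := by ring

theorem prod_primeFactors_sub_nonneg (D : Finset ℕ) (hD : ∀ p ∈ D, p.Prime) :
    0 < ∏ p ∈ D, (1 - 1 / (p : ℝ)) := by
  refine Finset.prod_pos fun p hp => ?_
  have : (1 : ℝ) < p := by exact_mod_cast (hD p hp).one_lt
  rw [sub_pos, div_lt_one (by linarith)]
  exact this

/-- The sixth power form of the sieve inequality when all primes are in the core. -/
theorem sieve_of_sixth_power {q n : ℕ} (hq : 1 < q) (hn : 0 < n) {E V : ℝ}
    (hV : 0 ≤ V)
    (h : 64 * 557172959423828 * E ^ 6 * ((q : ℝ) ^ n) ^ 3 * (q : ℝ) ^ 12 <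
      ((q : ℝ) ^ n - 1) ^ 5 * V ^ 6) :
    2 ^ (q ^ n - 1).primeFactors.card * E * (2 * Real.sqrt ((q : ℝ) ^ n)) <
      ((q : ℝ) ^ n - 1) / (q : ℝ) ^ 2 *
        (∏ p ∈ (q ^ n - 1).primeFactors, (1 - 1 / (p : ℝ))) * V := by
  have hq0 : (0 : ℝ) < q := by exact_mod_cast (by omega : 0 < q)
  have hqn : 1 < q ^ n := Nat.one_lt_pow hn.ne' hq
  have hQ : (0 : ℝ) < (q : ℝ) ^ n - 1 := by
    have : (1 : ℝ) < (q : ℝ) ^ n := by exact_mod_cast hqn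
    linarith
  set P := (q ^ n - 1).primeFactors with hP
  have hPp : ∀ p ∈ P, p.Prime := fun p hp => Nat.prime_of_mem_primeFactors hp
  have hw := prod_primeFactors_sub_nonneg P hPp
  set w := ∏ p ∈ P, (1 - 1 / (p : ℝ)) with hwdef
  have hprod : ∏ p ∈ P, (p : ℝ) ≤ (q : ℝ) ^ n - 1 := by
    have h1 : ∏ p ∈ P, p ≤ q ^ n - 1 :=
      Nat.le_of_dvd (by omega) (Nat.prod_primeFactors_dvd _)
    have h2 : ((∏ p ∈ P, p : ℕ) : ℝ) ≤ ((q ^ n - 1 : ℕ) : ℝ) := by exact_mod_cast h1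
    rw [Nat.cast_sub hqn.le] at h2
    push_cast at h2
    exact h2
  have h6 := sixth_power_prod_le P hPp
  have hsq : Real.sqrt ((q : ℝ) ^ n) ^ 6 = ((q : ℝ) ^ n) ^ 3 := by
    rw [show 6 = 2 * 3 from rfl, pow_mul, Real.sq_sqrt (by positivity)]
  refine lt_of_pow_lt_pow_left₀ 6 (by positivity) ?_
  calc (2 ^ P.card * E * (2 * Real.sqrt ((q : ℝ) ^ n))) ^ 6
      = (2 ^ P.card : ℝ) ^ 6 * (64 * E ^ 6 * ((q : ℝ) ^ n) ^ 3) := by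
        rw [mul_pow, mul_pow, mul_pow 2, hsq]; ring
    _ ≤ (557172959423828 * ((q : ℝ) ^ n - 1) * w ^ 6) * (64 * E ^ 6 * ((q : ℝ) ^ n) ^ 3) := by
        refine mul_le_mul_of_nonneg_right (h6.trans ?_) (by positivity)
        gcongr
    _ = ((q : ℝ) ^ n - 1) * w ^ 6 / (q : ℝ) ^ 12 *
          (64 * 557172959423828 * E ^ 6 * ((q : ℝ) ^ n) ^ 3 * (q : ℝ) ^ 12) := by
        field_simp
    _ < ((q : ℝ) ^ n - 1) * w ^ 6 / (q : ℝ) ^ 12 * (((q : ℝ) ^ n - 1) ^ 5 * V ^ 6) := by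
        refine mul_lt_mul_of_pos_left h (by positivity)
    _ = _ := by
        field_simp

end PrimeProduct

section NatCriteria

/-- The numerator of the core factor attached to `c₁, c₂, c₃` factors of degrees `1, 2, 3`. -/
def coreNum (q c₁ c₂ c₃ : ℕ) : ℕ := 2 ^ (2 * (c₁ + c₂ + c₃)) * q ^ (2 * c₁ + 4 * c₂ + 6 * c₃)

/-- The denominator of the core factor. -/
def coreDen (q c₁ c₂ c₃ : ℕ) : ℕ :=
  (q - 1) ^ (2 * c₁) * (q ^ 2 - 1) ^ (2 * c₂) * (q ^ 3 - 1) ^ (2 * c₃)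

/-- `q ^ 4` times the total density of the non-core additive events. -/
def sieveSum (q n c₁ c₂ c₃ : ℕ) : ℕ :=
  2 * ((numLinear q n - c₁) * q ^ 3 + (numQuadratic q n - c₂) * q ^ 2 +
    (numCubic q n - c₃) * q + numHigher q n)

/-- The number of non-core additive events. -/
def sieveCard (q n c₁ c₂ c₃ : ℕ) : ℕ :=
  2 * (numLinear q n - c₁ + (numQuadratic q n - c₂) + (numCubic q n - c₃) + numHigher q n)

theorem core_factor_eq {q : ℕ} (hq : 1 < q) (c₁ c₂ c₃ : ℕ) :
    ((1 - 1 / (q : ℝ) ^ 1) ^ c₁ * (1 - 1 / (q : ℝ) ^ 2) ^ c₂ * (1 - 1 / (q : ℝ) ^ 3) ^ c₃) ^ 2 =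
      (coreDen q c₁ c₂ c₃ : ℝ) / (q : ℝ) ^ (2 * c₁ + 4 * c₂ + 6 * c₃) := by
  have hq0 : (q : ℝ) ≠ 0 := by exact_mod_cast (by omega : q ≠ 0)
  have key : ∀ e : ℕ, 1 - 1 / (q : ℝ) ^ e = ((q : ℝ) ^ e - 1) / (q : ℝ) ^ e := fun e => by
    field_simp
  have hsub : ∀ e : ℕ, ((q ^ e - 1 : ℕ) : ℝ) = (q : ℝ) ^ e - 1 := fun e => by
    rw [Nat.cast_sub (Nat.one_le_pow _ _ (by omega))]
    push_cast
    rfl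
  have h1 := hsub 1
  rw [pow_one] at h1
  unfold coreDen
  push_cast
  rw [key, key, key, hsub 2, hsub 3, h1, div_pow, div_pow, div_pow, div_mul_div_comm,
    div_mul_div_comm, div_pow]
  congr 1
  · ring
  · ring

theorem sieve_sum_eq {q : ℕ} (hq : 1 < q) (n c₁ c₂ c₃ : ℕ) :
    2 * (((numLinear q n - c₁ : ℕ) : ℝ) / (q : ℝ) ^ 1 +
          ((numQuadratic q n - c₂ : ℕ) : ℝ) / (q : ℝ) ^ 2 +
          ((numCubic q n - c₃ : ℕ) : ℝ) / (q : ℝ) ^ 3 + (numHigher q n : ℝ) / (q : ℝ) ^ 4) =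
      (sieveSum q n c₁ c₂ c₃ : ℝ) / (q : ℝ) ^ 4 := by
  have hq0 : (q : ℝ) ≠ 0 := by exact_mod_cast (by omega : q ≠ 0)
  unfold sieveSum
  push_cast
  field_simp

variable {Fq F : Type*} [Field Fq] [Field F] [Fintype Fq] [Fintype F] [Algebra Fq F]

/-- The criterion with all primes in the core. -/
theorem exists_pair_of_all_primes_core {q n : ℕ} (hq : Fintype.card Fq = q)
    (hn : Module.finrank Fq F = n) {c₁ c₂ c₃ : ℕ} (h₁ : c₁ ≤ numLinear q n)
    (h₂ : c₂ ≤ numQuadratic q n) (h₃ : c₃ ≤ numCubic q n)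
    (hσ : sieveSum q n c₁ c₂ c₃ < q ^ 4)
    (h : 64 * 557172959423828 * (q ^ n) ^ 3 * q ^ 12 * coreNum q c₁ c₂ c₃ ^ 6 *
        (1 + sieveCard q n c₁ c₂ c₃) ^ 6 * q ^ 24 <
      (q ^ n - 1) ^ 5 * (q ^ 4 - sieveSum q n c₁ c₂ c₃) ^ 6 * coreDen q c₁ c₂ c₃ ^ 6) :
    ∃ α : F, α ≠ 0 ∧ orderOf α = q ^ n - 1 ∧ orderOf α⁻¹ = q ^ n - 1 ∧
      IsKNormal Fq q n 1 α ∧ IsKNormal Fq q n 1 α⁻¹ := by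
  have hn0 : 0 < n := hn ▸ Module.finrank_pos
  have hq1 : 1 < q := hq ▸ Fintype.one_lt_card
  have hq0 : (0 : ℝ) < q := by exact_mod_cast (by omega : 0 < q)
  refine exists_pair_of_counts hq hn (PC := (q ^ n - 1).primeFactors) (PS := ∅)
    (Finset.union_empty _) (Finset.disjoint_empty_right _) h₁ h₂ h₃ ?_
  rw [core_factor_eq hq1, sieve_sum_eq hq1]
  set σ := sieveSum q n c₁ c₂ c₃
  set k := 2 * c₁ + 4 * c₂ + 6 * c₃ with hk
  have hσ' : (σ : ℝ) < (q : ℝ) ^ 4 := by exact_mod_cast hσ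
  have hδ : 0 < 1 - (σ : ℝ) / (q : ℝ) ^ 4 := by
    rw [sub_pos, div_lt_one (by positivity)]
    exact hσ'
  have hreal : (64 * 557172959423828 * ((q : ℝ) ^ n) ^ 3 * (q : ℝ) ^ 12 *
      (2 ^ (2 * (c₁ + c₂ + c₃)) * (q : ℝ) ^ k) ^ 6 *
        (1 + (sieveCard q n c₁ c₂ c₃ : ℝ)) ^ 6 * (q : ℝ) ^ 24 <
      ((q : ℝ) ^ n - 1) ^ 5 * ((q : ℝ) ^ 4 - (σ : ℝ)) ^ 6 * (coreDen q c₁ c₂ c₃ : ℝ) ^ 6) := by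
    have : ((64 * 557172959423828 * (q ^ n) ^ 3 * q ^ 12 * coreNum q c₁ c₂ c₃ ^ 6 *
        (1 + sieveCard q n c₁ c₂ c₃) ^ 6 * q ^ 24 : ℕ) : ℝ) <
      (((q ^ n - 1) ^ 5 * (q ^ 4 - σ) ^ 6 * coreDen q c₁ c₂ c₃ ^ 6 : ℕ) : ℝ) := by
      exact_mod_cast h
    have hqn : 1 ≤ q ^ n := Nat.one_le_pow _ _ (by omega)
    rw [coreNum] at this
    push_cast [Nat.cast_sub hσ.le, Nat.cast_sub hqn] at this
    rw [show (64 : ℝ) * 557172959423828 = 35659069403124992 by norm_num]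
    exact this
  have key := sieve_of_sixth_power hq1 hn0
    (E := 2 ^ (2 * (c₁ + c₂ + c₃)) * (1 + (sieveCard q n c₁ c₂ c₃ : ℝ)))
    (V := (coreDen q c₁ c₂ c₃ : ℝ) / (q : ℝ) ^ k * (1 - (σ : ℝ) / (q : ℝ) ^ 4))
    (by positivity) (by
      have e : (coreDen q c₁ c₂ c₃ : ℝ) / (q : ℝ) ^ k * (1 - (σ : ℝ) / (q : ℝ) ^ 4) =
          coreDen q c₁ c₂ c₃ * ((q : ℝ) ^ 4 - σ) / ((q : ℝ) ^ k * (q : ℝ) ^ 4) := by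
        field_simp
      rw [e, div_pow, mul_div_assoc', lt_div_iff₀ (by positivity)]
      refine lt_of_eq_of_lt ?_ (lt_of_lt_of_eq hreal ?_)
      · ring
      · ring)
  refine lt_of_eq_of_lt ?_ (lt_of_lt_of_eq key ?_)
  · unfold sieveCard
    push_cast
    rw [pow_add, Finset.card_empty]
    push_cast
    ring
  · simp only [Finset.sum_empty]
    ring

end NatCriteria

section SmallPrimes

/-- The primes below `101`. -/
def smallPrimes : List ℕ := [2, 3, 5, 7, 11, 13, 17, 19, 23, 29, 31, 37, 41, 43, 47, 53, 59, 61, 67,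
  71, 73, 79, 83, 89, 97]

theorem mem_smallPrimes {p : ℕ} (hp : p.Prime) (h : p < 101) : p ∈ smallPrimes := by
  unfold smallPrimes
  interval_cases p <;> first | decide | (exfalso; revert hp; norm_num)

theorem prime_of_mem_smallPrimes {p : ℕ} (hp : p ∈ smallPrimes) : p.Prime ∧ p < 101 := by
  simp only [smallPrimes, List.mem_cons, List.not_mem_nil, or_false] at hp
  rcases hp with rfl | rfl | rfl | rfl | rfl | rfl | rfl | rfl | rfl | rfl | rfl | rfl | rfl |
    rfl | rfl | rfl | rfl | rfl | rfl | rfl | rfl | rfl | rfl | rfl | rfl <;> norm_num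

/-- The primes below `101` dividing `m`. -/
def smallFactors (m : ℕ) : List ℕ := smallPrimes.filter fun p => m % p == 0

/-- The prime factors below `b`, for `b ≤ 101`. -/
def coreFactors (m b : ℕ) : List ℕ := (smallFactors m).filter fun p => Nat.blt p b

/-- The prime factors below `101` which are at least `b`. -/
def restFactors (m b : ℕ) : List ℕ := (smallFactors m).filter fun p => !Nat.blt p b

/-- The fraction `t / 101 + ∑ 1 / p` over the list, as a pair. -/
def fracSum (t : ℕ) : List ℕ → ℕ × ℕ
  | [] => (t, 101)
  | p :: l => ((fracSum t l).1 * p + (fracSum t l).2, (fracSum t l).2 * p)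

theorem mem_smallFactors {m p : ℕ} :
    p ∈ smallFactors m ↔ p ∈ smallPrimes ∧ p ∣ m := by
  simp [smallFactors, List.mem_filter, Nat.dvd_iff_mod_eq_zero]

theorem nodup_smallFactors (m : ℕ) : (smallFactors m).Nodup :=
  List.Nodup.filter _ (by decide)

theorem fracSum_spec (t : ℕ) (l : List ℕ) (hl : ∀ p ∈ l, 0 < p) :
    0 < (fracSum t l).2 ∧ ((fracSum t l).1 : ℝ) / (fracSum t l).2 =
      t / 101 + (l.map fun p : ℕ => 1 / (p : ℝ)).sum := by
  induction l with
  | nil => simp [fracSum]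
  | cons p l ih =>
    obtain ⟨h1, h2⟩ := ih fun p hp => hl p (List.mem_cons_of_mem _ hp)
    have hp := hl p List.mem_cons_self
    refine ⟨Nat.mul_pos h1 hp, ?_⟩
    have h1' : ((fracSum t l).2 : ℝ) ≠ 0 := by exact_mod_cast h1.ne'
    have hp' : (p : ℝ) ≠ 0 := by exact_mod_cast hp.ne'
    rw [List.map_cons, List.sum_cons, add_left_comm, ← h2, fracSum]
    push_cast
    field_simp
    ring

theorem primeFactors_split {m b t : ℕ} (hm : 0 < m)
    (ht : m < 101 ^ (t + 1) * (smallFactors m).prod) :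
    ∃ PS : Finset ℕ, (coreFactors m b).toFinset ∪ PS = m.primeFactors ∧
      Disjoint (coreFactors m b).toFinset PS ∧ PS.card ≤ (restFactors m b).length + t ∧
      ∑ p ∈ PS, 1 / (p : ℝ) ≤
        (fracSum t (restFactors m b)).1 / (fracSum t (restFactors m b)).2 := by
  classical
  have hmem : ∀ p, p ∈ m.primeFactors ↔ p.Prime ∧ p ∣ m := fun p => by
    rw [Nat.mem_primeFactors]
    exact ⟨fun h => ⟨h.1, h.2.1⟩, fun h => ⟨h.1, h.2, hm.ne'⟩⟩
  have hsm : ∀ p ∈ smallFactors m, p ∈ m.primeFactors := fun p hp => by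
    rw [mem_smallFactors] at hp
    exact (hmem p).2 ⟨(prime_of_mem_smallPrimes hp.1).1, hp.2⟩
  set L := m.primeFactors.filter fun p => 101 ≤ p with hL
  have hdisj : Disjoint (smallFactors m).toFinset L := by
    rw [Finset.disjoint_left]
    intro p hp hpL
    rw [List.mem_toFinset, mem_smallFactors] at hp
    have := (prime_of_mem_smallPrimes hp.1).2
    have := (Finset.mem_filter.1 hpL).2
    omega
  have hLt : L.card ≤ t := by
    have h1 : ∏ p ∈ (smallFactors m).toFinset ∪ L, p ≤ m := by
      refine Nat.le_of_dvd hm ((Finset.prod_dvd_prod_of_subset _ _ (fun p => p) ?_).trans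
        (Nat.prod_primeFactors_dvd m))
      refine Finset.union_subset (fun p hp => hsm p (List.mem_toFinset.1 hp))
        (Finset.filter_subset _ _)
    rw [Finset.prod_union hdisj, List.prod_toFinset _ (nodup_smallFactors m), List.map_id'] at h1
    have h2 : 101 ^ L.card ≤ ∏ p ∈ L, p :=
      Finset.pow_card_le_prod _ _ _ fun p hp => (Finset.mem_filter.1 hp).2
    have h3 : 101 ^ L.card * (smallFactors m).prod < 101 ^ (t + 1) * (smallFactors m).prod := by
      refine lt_of_le_of_lt ?_ ht
      rw [mul_comm]
      exact (Nat.mul_le_mul_left _ h2).trans h1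
    have h4 := lt_of_mul_lt_mul_right h3 (Nat.zero_le _)
    have := (Nat.pow_lt_pow_iff_right (by norm_num : 1 < 101)).1 h4
    omega
  set PS := m.primeFactors \ (coreFactors m b).toFinset with hPS
  have hcore : (coreFactors m b).toFinset ⊆ m.primeFactors := fun p hp =>
    hsm p (List.mem_of_mem_filter (List.mem_toFinset.1 hp))
  have hsub : PS ⊆ (restFactors m b).toFinset ∪ L := by
    intro p hp
    rw [hPS, Finset.mem_sdiff] at hp
    rw [Finset.mem_union]
    by_cases h : 101 ≤ p
    · exact Or.inr (Finset.mem_filter.2 ⟨hp.1, h⟩)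
    · left
      have h1 := (hmem p).1 hp.1
      have h2 : p ∈ smallFactors m :=
        mem_smallFactors.2 ⟨mem_smallPrimes h1.1 (by omega), h1.2⟩
      have h3 := hp.2
      rw [List.mem_toFinset, coreFactors, List.mem_filter] at h3
      rw [List.mem_toFinset, restFactors, List.mem_filter]
      refine ⟨h2, ?_⟩
      cases hb : Nat.blt p b <;> simp_all
  have hnodup : (restFactors m b).Nodup := List.Nodup.filter _ (nodup_smallFactors m)
  refine ⟨PS, Finset.union_sdiff_of_subset hcore, Finset.disjoint_sdiff, ?_, ?_⟩
  · refine (Finset.card_le_card hsub).trans ((Finset.card_union_le _ _).trans ?_)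
    rw [List.toFinset_card_of_nodup hnodup]
    omega
  · rw [(fracSum_spec t (restFactors m b) fun p hp => ((hmem p).1
      (hsm p (List.mem_of_mem_filter hp))).1.pos).2]
    have hnn : ∀ p : ℕ, 0 ≤ 1 / (p : ℝ) := fun p => by positivity
    calc ∑ p ∈ PS, 1 / (p : ℝ) ≤ ∑ p ∈ (restFactors m b).toFinset ∪ L, 1 / (p : ℝ) :=
          Finset.sum_le_sum_of_subset_of_nonneg hsub fun p _ _ => hnn p
      _ ≤ ∑ p ∈ (restFactors m b).toFinset, 1 / (p : ℝ) + ∑ p ∈ L, 1 / (p : ℝ) := by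
          rw [← Finset.sum_union_inter]
          exact le_add_of_nonneg_right (Finset.sum_nonneg fun p _ => hnn p)
      _ ≤ (List.map (fun p : ℕ => 1 / (p : ℝ)) (restFactors m b)).sum + t / 101 := by
          rw [List.sum_toFinset _ hnodup]
          gcongr
          calc ∑ p ∈ L, 1 / (p : ℝ) ≤ ∑ p ∈ L, 1 / (101 : ℝ) :=
                Finset.sum_le_sum fun p hp => by
                  have : (101 : ℝ) ≤ p := by exact_mod_cast (Finset.mem_filter.1 hp).2
                  gcongr
            _ = (L.card : ℝ) / 101 := by rw [Finset.sum_const, nsmul_eq_mul, mul_one_div]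
            _ ≤ t / 101 := by gcongr
      _ = _ := add_comm _ _

end SmallPrimes

section Criterion

variable {Fq F : Type*} [Field Fq] [Field F] [Fintype Fq] [Fintype F] [Algebra Fq F]

/-- The criterion with the primes below `b` in the core and at most `t` primes above `100`. -/
theorem exists_pair_of_small_primes_core {q n : ℕ} (hq : Fintype.card Fq = q)
    (hn : Module.finrank Fq F = n) {b c t : ℕ} (h₁ : c ≤ numLinear q n)
    (ht : q ^ n - 1 < 101 ^ (t + 1) * (smallFactors (q ^ n - 1)).prod)
    (hσ : sieveSum q n c 0 0 * (fracSum t (restFactors (q ^ n - 1) b)).2 +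
        (fracSum t (restFactors (q ^ n - 1) b)).1 * q ^ 4 <
      q ^ 4 * (fracSum t (restFactors (q ^ n - 1) b)).2)
    (h : 4 * q ^ n * q ^ 4 * ((coreFactors (q ^ n - 1) b).map fun p => 2 * p).prod ^ 2 *
        coreNum q c 0 0 ^ 2 *
        (1 + (sieveCard q n c 0 0 + (restFactors (q ^ n - 1) b).length + t)) ^ 2 *
        (q ^ 4 * (fracSum t (restFactors (q ^ n - 1) b)).2) ^ 2 <
      (q ^ n - 1) ^ 2 * ((coreFactors (q ^ n - 1) b).map fun p => p - 1).prod ^ 2 *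
        coreDen q c 0 0 ^ 2 * (q ^ 4 * (fracSum t (restFactors (q ^ n - 1) b)).2 -
          (sieveSum q n c 0 0 * (fracSum t (restFactors (q ^ n - 1) b)).2 +
            (fracSum t (restFactors (q ^ n - 1) b)).1 * q ^ 4)) ^ 2) :
    ∃ α : F, α ≠ 0 ∧ orderOf α = q ^ n - 1 ∧ orderOf α⁻¹ = q ^ n - 1 ∧
      IsKNormal Fq q n 1 α ∧ IsKNormal Fq q n 1 α⁻¹ := by
  have hn0 : 0 < n := hn ▸ Module.finrank_pos
  have hq1 : 1 < q := hq ▸ Fintype.one_lt_card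
  have hq0 : (0 : ℝ) < q := by exact_mod_cast (by omega : 0 < q)
  have hQ1 : 1 < q ^ n := Nat.one_lt_pow hn0.ne' hq1
  obtain ⟨PS, hP, hPd, hcard, hsum⟩ := primeFactors_split (b := b) (by omega) ht
  have hDpos : 0 < (fracSum t (restFactors (q ^ n - 1) b)).2 := by
    refine (fracSum_spec _ _ fun p hp => ?_).1
    exact (prime_of_mem_smallPrimes (mem_smallFactors.1 (List.mem_of_mem_filter hp)).1).1.pos
  refine exists_pair_of_counts hq hn hP hPd h₁ (Nat.zero_le _) (Nat.zero_le _) ?_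
  rw [core_factor_eq hq1, sieve_sum_eq hq1]
  have hnd : (coreFactors (q ^ n - 1) b).Nodup := List.Nodup.filter _ (nodup_smallFactors _)
  have hcp : ∀ p ∈ coreFactors (q ^ n - 1) b, p.Prime := fun p hp =>
    (prime_of_mem_smallPrimes (mem_smallFactors.1 (List.mem_of_mem_filter hp)).1).1
  rw [List.prod_toFinset _ hnd, List.toFinset_card_of_nodup hnd]
  generalize coreFactors (q ^ n - 1) b = C at *
  generalize restFactors (q ^ n - 1) b = R at *
  have hC : (C.map fun p : ℕ => 1 - 1 / (p : ℝ)).prod * ((C.map fun p => 2 * p).prod : ℕ) =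
      2 ^ C.length * ((C.map fun p => p - 1).prod : ℕ) ∧ 0 < (C.map fun p => 2 * p).prod := by
    clear h hP hPd hnd
    induction C with
    | nil => simp
    | cons p C ih =>
      have hp := hcp p List.mem_cons_self
      obtain ⟨ih, ih'⟩ := ih fun p hp => hcp p (List.mem_cons_of_mem _ hp)
      have hp0 : (p : ℝ) ≠ 0 := by exact_mod_cast hp.ne_zero
      simp only [List.map_cons, List.prod_cons, List.length_cons]
      refine ⟨?_, Nat.mul_pos (Nat.mul_pos two_pos hp.pos) ih'⟩
      rw [Nat.cast_mul, Nat.cast_mul, Nat.cast_mul, Nat.cast_sub hp.one_le, Nat.cast_one,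
        Nat.cast_two, pow_succ]
      calc _ = (1 - 1 / (p : ℝ)) * p * 2 * ((C.map fun p : ℕ => 1 - 1 / (p : ℝ)).prod *
            ((C.map fun p => 2 * p).prod : ℕ)) := by ring
        _ = _ := by
          rw [ih, sub_mul, one_div_mul_cancel hp0]
          ring
  generalize (C.map fun p : ℕ => 1 - 1 / (p : ℝ)).prod = Θ at *
  generalize (C.map fun p => 2 * p).prod = L₂ at *
  generalize (C.map fun p => p - 1).prod = L₁ at *
  generalize (fracSum t R).1 = a at *
  generalize (fracSum t R).2 = D at *
  generalize hcd : coreDen q c 0 0 = cd at *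
  have hs : ((sieveCard q n c 0 0 : ℕ) : ℝ) = 2 * ((numLinear q n - c + (numQuadratic q n - 0) +
      (numCubic q n - 0) + numHigher q n : ℕ) : ℝ) := by
    unfold sieveCard
    push_cast
    ring
  rw [← hs]
  generalize sieveCard q n c 0 0 = s at *
  generalize sieveSum q n c 0 0 = σ at *
  obtain ⟨hC, hL₂⟩ := hC
  have hL₂' : (0 : ℝ) < L₂ := by exact_mod_cast hL₂
  have hD : (0 : ℝ) < D := by exact_mod_cast hDpos
  have hΘ : Θ = 2 ^ C.length * L₁ / L₂ := by
    rw [eq_div_iff hL₂'.ne', hC]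
  have hQ : (1 : ℝ) < (q : ℝ) ^ n := by exact_mod_cast hQ1
  have hσ' : (σ : ℝ) * D + a * (q : ℝ) ^ 4 < (q : ℝ) ^ 4 * D := by exact_mod_cast hσ
  set N : ℝ := (q : ℝ) ^ 4 * D - (σ * D + a * (q : ℝ) ^ 4) with hN
  have hN0 : 0 < N := sub_pos.2 hσ'
  have hreal : 4 * (q : ℝ) ^ n * (q : ℝ) ^ 4 * (L₂ : ℝ) ^ 2 * (2 ^ (2 * c) * (q : ℝ) ^ (2 * c)) ^ 2 *
      (1 + ((s : ℝ) + R.length + t)) ^ 2 * ((q : ℝ) ^ 4 * D) ^ 2 <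
      ((q : ℝ) ^ n - 1) ^ 2 * (L₁ : ℝ) ^ 2 * (cd : ℝ) ^ 2 * N ^ 2 := by
    have h' := (Nat.cast_lt (α := ℝ)).2 h
    rw [coreNum] at h'
    push_cast [Nat.cast_sub hσ.le, Nat.cast_sub hQ1.le] at h'
    simpa using h'
  have hδ : N / ((q : ℝ) ^ 4 * D) ≤ 1 - (∑ p ∈ PS, 1 / (p : ℝ) + σ / (q : ℝ) ^ 4) := by
    have e : N / ((q : ℝ) ^ 4 * D) = 1 - ((a : ℝ) / D + σ / (q : ℝ) ^ 4) := by
      rw [hN]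
      field_simp
      ring
    rw [e]
    gcongr
  have hcardR : (PS.card : ℝ) ≤ R.length + t := by exact_mod_cast hcard
  simp only [add_zero, mul_zero]
  calc (2 : ℝ) ^ (C.length + 2 * c) * (1 + ((PS.card : ℝ) + s)) * (2 * √((q : ℝ) ^ n))
      ≤ 2 ^ (C.length + 2 * c) * (1 + ((s : ℝ) + R.length + t)) * (2 * √((q : ℝ) ^ n)) := by
        refine mul_le_mul_of_nonneg_right (mul_le_mul_of_nonneg_left ?_ (by positivity))
          (by positivity)
        linarith
    _ < ((q : ℝ) ^ n - 1) / (q : ℝ) ^ 2 * (Θ * (cd / (q : ℝ) ^ (2 * c))) *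
        (N / ((q : ℝ) ^ 4 * D)) := by
        refine lt_of_pow_lt_pow_left₀ 2 ?_ ?_
        · rw [hΘ]
          have := sub_pos.2 hQ
          positivity
        · rw [hΘ, mul_pow _ (2 * √((q : ℝ) ^ n)), mul_pow 2 (√((q : ℝ) ^ n)),
            Real.sq_sqrt (by positivity)]
          have e : (((q : ℝ) ^ n - 1) / (q : ℝ) ^ 2 * (2 ^ C.length * L₁ / L₂ *
              (cd / (q : ℝ) ^ (2 * c))) * (N / ((q : ℝ) ^ 4 * D))) ^ 2 =
              (2 ^ C.length) ^ 2 * (((q : ℝ) ^ n - 1) ^ 2 * (L₁ : ℝ) ^ 2 * (cd : ℝ) ^ 2 * N ^ 2) /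
                ((q : ℝ) ^ 2 * L₂ * (q : ℝ) ^ (2 * c) * ((q : ℝ) ^ 4 * D)) ^ 2 := by
            field_simp
          rw [e, lt_div_iff₀ (by positivity)]
          refine lt_of_eq_of_lt ?_ (mul_lt_mul_of_pos_left hreal (by positivity))
          rw [pow_add]
          ring
    _ ≤ _ := by
        refine mul_le_mul_of_nonneg_left hδ ?_
        rw [hΘ]
        have := sub_pos.2 hQ
        positivity

end Criterion

section FiniteRange

/-- The criterion `exists_pair_of_all_primes_core` as a Boolean. -/
def allPrimesCheck (q n c₁ c₂ c₃ : ℕ) : Bool :=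
  Nat.blt (sieveSum q n c₁ c₂ c₃) (q ^ 4) &&
    Nat.blt (64 * 557172959423828 * (q ^ n) ^ 3 * q ^ 12 * coreNum q c₁ c₂ c₃ ^ 6 *
        (1 + sieveCard q n c₁ c₂ c₃) ^ 6 * q ^ 24)
      ((q ^ n - 1) ^ 5 * (q ^ 4 - sieveSum q n c₁ c₂ c₃) ^ 6 * coreDen q c₁ c₂ c₃ ^ 6)

/-- `allPrimesCheck` for the four cores consisting of all factors up to some degree. -/
def degreeCoreCheck (q n : ℕ) : Bool :=
  allPrimesCheck q n 0 0 0 || allPrimesCheck q n (numLinear q n) 0 0 ||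
    allPrimesCheck q n (numLinear q n) (numQuadratic q n) 0 ||
      allPrimesCheck q n (numLinear q n) (numQuadratic q n) (numCubic q n)

/-- The criterion `exists_pair_of_small_primes_core` as a Boolean. -/
def smallPrimesCheck (q n b c t : ℕ) : Bool :=
  Nat.ble c (numLinear q n) &&
  Nat.blt (q ^ n - 1) (101 ^ (t + 1) * (smallFactors (q ^ n - 1)).prod) &&
  Nat.blt (sieveSum q n c 0 0 * (fracSum t (restFactors (q ^ n - 1) b)).2 +
        (fracSum t (restFactors (q ^ n - 1) b)).1 * q ^ 4)
      (q ^ 4 * (fracSum t (restFactors (q ^ n - 1) b)).2) &&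
  Nat.blt (4 * q ^ n * q ^ 4 * ((coreFactors (q ^ n - 1) b).map fun p => 2 * p).prod ^ 2 *
        coreNum q c 0 0 ^ 2 *
        (1 + (sieveCard q n c 0 0 + (restFactors (q ^ n - 1) b).length + t)) ^ 2 *
        (q ^ 4 * (fracSum t (restFactors (q ^ n - 1) b)).2) ^ 2)
      ((q ^ n - 1) ^ 2 * ((coreFactors (q ^ n - 1) b).map fun p => p - 1).prod ^ 2 *
        coreDen q c 0 0 ^ 2 * (q ^ 4 * (fracSum t (restFactors (q ^ n - 1) b)).2 -
          (sieveSum q n c 0 0 * (fracSum t (restFactors (q ^ n - 1) b)).2 +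
            (fracSum t (restFactors (q ^ n - 1) b)).1 * q ^ 4)) ^ 2)

/-- The prime powers `q` with `3 < q < 256`. -/
def smallPrimePowers : List ℕ :=
  [4, 5, 7, 8, 9, 11, 13, 16, 17, 19, 23, 25, 27, 29, 31, 32, 37, 41, 43, 47, 49, 53, 59, 61,
  64, 67, 71, 73, 79, 81, 83, 89, 97, 101, 103, 107, 109, 113, 121, 125, 127, 128, 131, 137,
  139, 149, 151, 157, 163, 167, 169, 173, 179, 181, 191, 193, 197, 199, 211, 223, 227, 229, 233,
  239, 241, 243, 251]

theorem mem_smallPrimePowers {q : ℕ} (hq : IsPrimePow q) (h3 : 3 < q) (h : q < 256) :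
    q ∈ smallPrimePowers := by
  have key : ∀ q ∈ List.range 256, 3 < q → q ∉ smallPrimePowers →
      ∃ r ∈ [2, 3, 5, 7, 11, 13], q % r = 0 ∧ r ^ 8 % q ≠ 0 := by
    decide +kernel
  by_contra hmem
  obtain ⟨r, hr, hrq, hne⟩ := key q (List.mem_range.2 h) h3 hmem
  have hrp : r.Prime := by
    simp only [List.mem_cons, List.not_mem_nil, or_false] at hr
    rcases hr with rfl | rfl | rfl | rfl | rfl | rfl <;> norm_num
  obtain ⟨p, k, hp, hk, rfl⟩ := (isPrimePow_nat_iff _).1 hq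
  have hrp' : r = p := (Nat.prime_dvd_prime_iff_eq hrp hp).1
    (hrp.dvd_of_dvd_pow (Nat.dvd_of_mod_eq_zero hrq))
  subst hrp'
  refine hne (Nat.mod_eq_zero_of_dvd (pow_dvd_pow _ ?_))
  by_contra hk8
  have : 2 ^ 8 ≤ r ^ k := (Nat.pow_le_pow_left hp.two_le 8).trans
    (Nat.pow_le_pow_right hp.pos (by omega))
  omega

/-- Parameters `(q, n, b, c, t)` for which `smallPrimesCheck` succeeds. -/
def smallPrimesCases : List (ℕ × ℕ × ℕ × ℕ × ℕ) :=
  [(4, 14, 3, 1, 2), (4, 16, 3, 1, 3), (4, 17, 3, 0, 4), (4, 19, 3, 0, 5), (4, 20, 5, 1, 2), (4,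
  21, 3, 2, 4), (4, 22, 3, 1, 4), (4, 23, 3, 0, 5), (4, 24, 3, 3, 4), (4, 25, 3, 0, 6), (4, 26,
  3, 1, 6), (4, 27, 3, 2, 5), (4, 30, 13, 3, 4), (4, 33, 3, 2, 6), (4, 36, 5, 3, 6), (5, 14, 2,
  1, 3), (5, 15, 2, 1, 2), (5, 17, 2, 0, 5), (5, 18, 3, 1, 4), (5, 19, 2, 0, 6), (5, 20, 11, 3,
  3), (5, 21, 2, 0, 6), (5, 22, 2, 1, 5), (5, 24, 31, 3, 6), (5, 28, 3, 2, 8), (5, 30, 3, 2, 6),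
  (5, 32, 3, 3, 9), (7, 14, 2, 2, 4), (7, 15, 2, 2, 4), (7, 16, 3, 1, 5), (7, 17, 2, 0, 6), (7,
  18, 3, 4, 4), (7, 19, 2, 0, 7), (7, 20, 3, 1, 7), (7, 21, 2, 3, 7), (7, 24, 5, 5, 6), (7, 30,
  3, 4, 9), (8, 15, 7, 0, 4), (8, 16, 3, 1, 4), (8, 17, 7, 0, 7), (8, 18, 3, 0, 5), (8, 21, 7,
  4, 8), (8, 28, 3, 7, 9), (9, 14, 2, 1, 5), (9, 15, 2, 1, 3), (9, 17, 2, 0, 7), (9, 18, 5, 0,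
  4), (9, 20, 5, 2, 6), (9, 24, 5, 7, 6), (9, 32, 5, 5, 13), (11, 14, 3, 0, 5), (11, 15, 5, 2,
  6), (11, 16, 3, 0, 6), (11, 20, 5, 6, 8), (11, 30, 5, 8, 12), (13, 14, 3, 0, 6), (13, 15, 2,
  2, 7), (13, 16, 3, 2, 7), (13, 18, 3, 3, 7), (13, 24, 3, 11, 10), (13, 36, 3, 11, 15), (16,
  14, 3, 0, 5), (16, 30, 5, 14, 12), (17, 14, 2, 1, 8), (17, 15, 2, 0, 9), (17, 32, 3, 14, 18),
  (19, 14, 3, 0, 8), (19, 15, 2, 2, 8), (19, 36, 5, 15, 19), (23, 14, 3, 0, 6), (23, 22, 101,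
  12, 14), (23, 44, 3, 21, 27), (25, 14, 3, 0, 8), (25, 24, 17, 14, 14), (27, 14, 2, 0, 8), (27,
  26, 7, 17, 16), (29, 14, 7, 2, 9), (29, 28, 5, 21, 19), (31, 15, 5, 5, 9), (31, 30, 7, 22,
  19), (32, 31, 31, 19, 22), (37, 36, 5, 31, 22), (41, 40, 5, 35, 28), (43, 14, 3, 6, 10), (43,
  42, 3, 41, 32), (47, 46, 3, 39, 37), (49, 48, 5, 42, 35), (53, 52, 5, 44, 43), (59, 58, 5, 49,
  49), (61, 60, 7, 55, 48), (64, 63, 7, 55, 53), (67, 66, 7, 63, 55), (71, 70, 7, 65, 62), (73,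
  72, 7, 70, 62), (79, 78, 7, 75, 71), (81, 80, 11, 76, 72), (83, 82, 7, 78, 76), (89, 88, 17,
  84, 82), (97, 96, 37, 93, 90), (101, 100, 31, 99, 97), (103, 102, 79, 101, 98)]

/-- The pairs `(q, n)` settled by an explicit element. -/
def explicitCases : List (ℕ × ℕ) :=
  [(4, 15), (4, 18), (5, 16), (8, 14), (9, 16), (16, 15), (17, 16), (19, 18)]

/-- The bound on `n` up to which the pairs `(q, n)` are checked one by one. -/
def rangeBound (q : ℕ) : ℕ := bif Nat.blt q 16 then 500 else 200

/-- Every pair in the finite range is settled by one of the criteria. -/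
def pairCheck (q n : ℕ) : Bool :=
  degreeCoreCheck q n || smallPrimesCases.any (fun x => Nat.beq x.1 q && Nat.beq x.2.1 n) ||
    explicitCases.any (fun x => Nat.beq x.1 q && Nat.beq x.2 n)

/-- `pairCheck q` holds on `[a, a + k)`. -/
def rangeCheck (q a : ℕ) : ℕ → Bool
  | 0 => true
  | k + 1 => pairCheck q (a + k) && rangeCheck q a k

theorem pairCheck_of_rangeCheck {q a k : ℕ} (h : rangeCheck q a k = true) {n : ℕ} (h1 : a ≤ n)
    (h2 : n < a + k) : pairCheck q n = true := by
  induction k with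
  | zero => omega
  | succ k ih =>
    rw [rangeCheck, Bool.and_eq_true] at h
    rcases Nat.lt_succ_iff_lt_or_eq.1 h2 with h3 | rfl
    · exact ih h.2 h3
    · exact h.1

theorem smallPrimesCases_check :
    smallPrimesCases.all (fun x => smallPrimesCheck x.1 x.2.1 x.2.2.1 x.2.2.2.1 x.2.2.2.2) =
      true := by
  decide +kernel

theorem smallPrimePowers_check :
    smallPrimePowers.all (fun q => rangeCheck q 14 (rangeBound q - 14)) = true := by
  decide +kernel

variable {Fq F : Type*} [Field Fq] [Field F] [Fintype Fq] [Fintype F] [Algebra Fq F]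

theorem exists_pair_of_allPrimesCheck {q n : ℕ} (hq : Fintype.card Fq = q)
    (hn : Module.finrank Fq F = n) {c₁ c₂ c₃ : ℕ} (h₁ : c₁ ≤ numLinear q n)
    (h₂ : c₂ ≤ numQuadratic q n) (h₃ : c₃ ≤ numCubic q n)
    (h : allPrimesCheck q n c₁ c₂ c₃ = true) :
    ∃ α : F, α ≠ 0 ∧ orderOf α = q ^ n - 1 ∧ orderOf α⁻¹ = q ^ n - 1 ∧
      IsKNormal Fq q n 1 α ∧ IsKNormal Fq q n 1 α⁻¹ := by
  rw [allPrimesCheck, Bool.and_eq_true, Nat.blt_eq, Nat.blt_eq] at h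
  exact exists_pair_of_all_primes_core hq hn h₁ h₂ h₃ h.1 h.2

theorem exists_pair_of_smallPrimesCheck {q n : ℕ} (hq : Fintype.card Fq = q)
    (hn : Module.finrank Fq F = n) {b c t : ℕ} (h : smallPrimesCheck q n b c t = true) :
    ∃ α : F, α ≠ 0 ∧ orderOf α = q ^ n - 1 ∧ orderOf α⁻¹ = q ^ n - 1 ∧
      IsKNormal Fq q n 1 α ∧ IsKNormal Fq q n 1 α⁻¹ := by
  rw [smallPrimesCheck, Bool.and_eq_true, Bool.and_eq_true, Bool.and_eq_true, Nat.blt_eq,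
    Nat.blt_eq, Nat.blt_eq, Nat.ble_eq] at h
  exact exists_pair_of_small_primes_core hq hn h.1.1.1 h.1.1.2 h.1.2 h.2

/-- The finite range, apart from the explicit cases. -/
theorem exists_pair_of_lt_rangeBound {q n : ℕ} (hpp : IsPrimePow q) (h3 : 3 < q) (h256 : q < 256)
    (h14 : 14 ≤ n) (hb : n < rangeBound q) (hex : (q, n) ∉ explicitCases)
    (hq : Fintype.card Fq = q) (hn : Module.finrank Fq F = n) :
    ∃ α : F, α ≠ 0 ∧ orderOf α = q ^ n - 1 ∧ orderOf α⁻¹ = q ^ n - 1 ∧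
      IsKNormal Fq q n 1 α ∧ IsKNormal Fq q n 1 α⁻¹ := by
  have h := pairCheck_of_rangeCheck (List.all_eq_true.1 smallPrimePowers_check q
    (mem_smallPrimePowers hpp h3 h256)) h14 (by omega)
  rw [pairCheck, Bool.or_eq_true, Bool.or_eq_true, List.any_eq_true, List.any_eq_true] at h
  rcases h with (h | ⟨⟨q', n', b, c, t⟩, hx, h⟩) | ⟨⟨q', n'⟩, hx, h⟩
  · rw [degreeCoreCheck, Bool.or_eq_true, Bool.or_eq_true, Bool.or_eq_true] at h
    rcases h with ((h | h) | h) | h <;>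
      exact exists_pair_of_allPrimesCheck hq hn (by simp) (by simp) (by simp) h
  · rw [Bool.and_eq_true] at h
    obtain rfl : q' = q := Nat.eq_of_beq_eq_true h.1
    obtain rfl : n' = n := Nat.eq_of_beq_eq_true h.2
    exact exists_pair_of_smallPrimesCheck hq hn
      (List.all_eq_true.1 smallPrimesCases_check _ hx)
  · rw [Bool.and_eq_true] at h
    obtain rfl : q' = q := Nat.eq_of_beq_eq_true h.1
    obtain rfl : n' = n := Nat.eq_of_beq_eq_true h.2
    exact absurd hx hex

end FiniteRange

section FullCore

/-- The factor by which an irreducible factor of degree `e` enters the full core criterion. -/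
noncomputable def coreWeight (q e : ℕ) : ℝ := 2 / (1 - 1 / (q : ℝ) ^ e)

theorem one_div_pow_le_half {q e : ℕ} (hq : 2 ≤ q) (he : 0 < e) : 1 / (q : ℝ) ^ e ≤ 1 / 2 := by
  have h1 : (2 : ℝ) ≤ q := by exact_mod_cast hq
  have h2 : (q : ℝ) ≤ (q : ℝ) ^ e := le_self_pow₀ (by linarith) he.ne'
  gcongr
  linarith

theorem one_le_coreWeight {q e : ℕ} (hq : 2 ≤ q) (he : 0 < e) : 1 ≤ coreWeight q e := by
  have h := one_div_pow_le_half hq he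
  have h0 : 0 ≤ 1 / (q : ℝ) ^ e := by positivity
  rw [coreWeight, one_le_div (by linarith)]
  linarith

theorem coreWeight_anti {q d e : ℕ} (hq : 2 ≤ q) (hd : 0 < d) (h : d ≤ e) :
    coreWeight q e ≤ coreWeight q d := by
  have h1 := one_div_pow_le_half hq hd
  have hq1 : (1 : ℝ) ≤ q := by exact_mod_cast (by omega : 1 ≤ q)
  unfold coreWeight
  have : 0 < 1 - 1 / (q : ℝ) ^ d := by linarith
  gcongr

theorem prod_coreWeight_le {Fq : Type*} [Field Fq] {q n D k : ℕ} (hq : 2 ≤ q) (I : Finset Fq[X])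
    (hpos : ∀ g ∈ I, 0 < g.natDegree) (hk : k * (D + 1) = 12) (U : ℕ → ℕ)
    (hU : ∀ e < D, (I.filter fun g => g.natDegree = e + 1).card ≤ U e)
    (hsum : ∑ g ∈ I, g.natDegree ≤ n) :
    ∏ g ∈ I, coreWeight q g.natDegree ^ 12 ≤
      (∏ e ∈ Finset.range D, coreWeight q (e + 1) ^ (12 * U e)) *
        (coreWeight q (D + 1) ^ k) ^ n := by
  classical
  have hw : ∀ e, 1 ≤ coreWeight q (e + 1) := fun e => one_le_coreWeight hq e.succ_pos
  have hw' : ∀ g ∈ I, 1 ≤ coreWeight q g.natDegree := fun g hg => one_le_coreWeight hq (hpos g hg)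
  calc ∏ g ∈ I, coreWeight q g.natDegree ^ 12
      ≤ ∏ g ∈ I, ((∏ e ∈ Finset.range D,
          if g.natDegree = e + 1 then coreWeight q (e + 1) ^ 12 else 1) *
          (coreWeight q (D + 1) ^ k) ^ g.natDegree) := by
        refine Finset.prod_le_prod (fun g hg => pow_nonneg (zero_le_one.trans (hw' g hg)) _)
          fun g hg => ?_
        obtain ⟨d, hd⟩ := Nat.exists_eq_succ_of_ne_zero (hpos g hg).ne'
        rw [Nat.succ_eq_add_one] at hd
        rw [hd]
        by_cases h : d < D
        · have e : (∏ e ∈ Finset.range D,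
              if d + 1 = e + 1 then coreWeight q (e + 1) ^ 12 else 1) =
                coreWeight q (d + 1) ^ 12 := by
            simp only [add_left_inj]
            rw [Finset.prod_ite_eq, if_pos (Finset.mem_range.2 h)]
          rw [e]
          exact le_mul_of_one_le_right (pow_nonneg (zero_le_one.trans (hw d)) _)
            (one_le_pow₀ (one_le_pow₀ (hw D)))
        · have e : (∏ e ∈ Finset.range D,
              if d + 1 = e + 1 then coreWeight q (e + 1) ^ 12 else 1) = 1 := by
            refine Finset.prod_eq_one fun e he => if_neg ?_
            have := Finset.mem_range.1 he
            omega
          rw [e, one_mul, ← pow_mul]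
          calc coreWeight q (d + 1) ^ 12 ≤ coreWeight q (D + 1) ^ 12 := by
                have := hw d
                gcongr
                exact coreWeight_anti hq D.succ_pos (by omega)
            _ ≤ coreWeight q (D + 1) ^ (k * (d + 1)) := by
                refine pow_le_pow_right₀ (hw D) ?_
                rw [← hk]
                gcongr
                omega
    _ = (∏ e ∈ Finset.range D,
          coreWeight q (e + 1) ^ (12 * (I.filter fun g => g.natDegree = e + 1).card)) *
          (coreWeight q (D + 1) ^ k) ^ ∑ g ∈ I, g.natDegree := by
        rw [Finset.prod_mul_distrib, Finset.prod_comm, Finset.prod_pow_eq_pow_sum]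
        congr 1
        refine Finset.prod_congr rfl fun e _ => ?_
        rw [Finset.prod_ite, Finset.prod_const, Finset.prod_const_one, mul_one, pow_mul]
    _ ≤ _ := by
        have := hw D
        refine mul_le_mul (Finset.prod_le_prod (fun e _ => pow_nonneg
          (zero_le_one.trans (hw e)) _) fun e he => pow_le_pow_right₀ (hw e)
            (Nat.mul_le_mul_left _ (hU e (Finset.mem_range.1 he))))
          (pow_le_pow_right₀ (one_le_pow₀ (hw D)) hsum) (by positivity)
          (Finset.prod_nonneg fun e _ => pow_nonneg (zero_le_one.trans (hw e)) _)

variable {Fq F : Type*} [Field Fq] [Field F] [Fintype Fq] [Fintype F] [Algebra Fq F]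

/-- The criterion with everything in the core. -/
theorem exists_pair_of_full_core {q n D k : ℕ} (hq : Fintype.card Fq = q)
    (hn : Module.finrank Fq F = n) (hq3 : 3 < q) (hn14 : 14 ≤ n) (hD : D ≤ 3)
    (hk : k * (D + 1) = 12)
    (h : 128 * 557172959423828 * (q : ℝ) ^ 12 *
        ((∏ e ∈ Finset.range D, coreWeight q (e + 1) ^ (12 * ((q ^ (e + 1) - 1) / (e + 1)))) *
          (coreWeight q (D + 1) ^ k) ^ n) ≤ ((q : ℝ) ^ 2) ^ n) :
    ∃ α : F, α ≠ 0 ∧ orderOf α = q ^ n - 1 ∧ orderOf α⁻¹ = q ^ n - 1 ∧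
      IsKNormal Fq q n 1 α ∧ IsKNormal Fq q n 1 α⁻¹ := by
  classical
  have hn0 : 0 < n := by omega
  have hq1 : 1 < q := by omega
  obtain ⟨f, hf⟩ : (X - 1 : Fq[X]) ∣ X ^ n - 1 := sub_one_dvd_pow_sub_one _ _
  have hf0 : f ≠ 0 := by
    rintro rfl
    exact X_pow_sub_C_ne_zero hn0 (1 : Fq) (by rw [C_1, hf, mul_zero])
  obtain ⟨I, hI⟩ := exists_monic_irreducible_factors hf0
  obtain ⟨hc1, hc2, hc3, hsum⟩ := card_factors hq hn0 hf.symm I hI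
  have hpos : ∀ g ∈ I, 0 < g.natDegree := fun g hg => ((hI g).1 hg).2.1.natDegree_pos
  have hprod := prod_coreWeight_le (q := q) (n := n) (by omega) I hpos hk
    (fun e => (q ^ (e + 1) - 1) / (e + 1)) (fun e he => by
      have hg : ∀ e, 0 < e → n.gcd (q ^ e - 1) ≤ q ^ e - 1 := fun e he =>
        Nat.gcd_le_right _ (Nat.sub_pos_of_lt (Nat.one_lt_pow he.ne' hq1))
      rw [Nat.le_div_iff_mul_le e.succ_pos]
      have g1 := hg 1 one_pos
      have g2 := hg 2 two_pos
      have g3 := hg 3 three_pos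
      rw [pow_one] at g1
      have he3 : e < 3 := by omega
      clear he
      interval_cases e
      · rw [zero_add, pow_one]
        omega
      · norm_num at *
        omega
      · norm_num at *
        omega) (by omega)
  refine exists_pair_of_sieve hq hn hf.symm I hI (PC := (q ^ n - 1).primeFactors) (PS := ∅)
    (IC := I) (IS := ∅) (Finset.union_empty _) (Finset.disjoint_empty_right _) (by simp)
    (Finset.disjoint_empty_right _) ?_
  have hd : ∀ g ∈ I, 0 < 1 - 1 / (q : ℝ) ^ g.natDegree := fun g hg => by
    have := one_div_pow_le_half (q := q) (by omega) (hpos g hg)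
    linarith
  set V := (∏ g ∈ I, (1 - 1 / (q : ℝ) ^ g.natDegree)) ^ 2 with hV
  have hV0 : 0 < V := pow_pos (Finset.prod_pos hd) 2
  have hEV : ∏ g ∈ I, coreWeight q g.natDegree ^ 12 = (2 ^ (2 * I.card)) ^ 6 / V ^ 6 := by
    rw [Finset.prod_pow, hV]
    simp only [coreWeight]
    rw [Finset.prod_div_distrib, Finset.prod_const, div_pow]
    ring
  rw [hEV] at hprod
  have hQ : (4 : ℝ) ^ 14 ≤ (q : ℝ) ^ n := by
    calc (4 : ℝ) ^ 14 ≤ (q : ℝ) ^ 14 := by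
          gcongr
          exact_mod_cast hq3
      _ ≤ (q : ℝ) ^ n := pow_le_pow_right₀ (by exact_mod_cast hq1.le) hn14
  have key := sieve_of_sixth_power hq1 hn0 (E := 2 ^ (2 * I.card)) hV0.le (by
    set Q := (q : ℝ) ^ n with hQdef
    have h' : 128 * 557172959423828 * (q : ℝ) ^ 12 * ((2 ^ (2 * I.card)) ^ 6 / V ^ 6) ≤ Q ^ 2 := by
      refine (mul_le_mul_of_nonneg_left hprod (by positivity)).trans (h.trans_eq ?_)
      rw [hQdef, ← pow_mul, ← pow_mul, mul_comm]
    rw [mul_div_assoc', div_le_iff₀ (by positivity)] at h'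
    have h5 : Q ^ 5 < 2 * (Q - 1) ^ 5 := by
      have hb := one_add_mul_le_pow (a := -(1 / Q)) (by
        have : 1 / Q ≤ 1 := by rw [div_le_one (by linarith)]; linarith
        linarith) 5
      have hQ0 : 0 < Q := by linarith
      have e : Q - 1 = Q * (1 + -(1 / Q)) := by field_simp; ring
      rw [e, mul_pow]
      have : 1 / Q ≤ 1 / 4 ^ 14 := by gcongr
      have : (1 : ℝ) / 2 < (1 + -(1 / Q)) ^ 5 := by
        norm_num at *
        linarith
      have : 0 < Q ^ 5 := by positivity
      nlinarith
    have hQ3 : 0 < Q ^ 3 := by positivity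
    have h6 : 0 < V ^ 6 := by positivity
    nlinarith [mul_le_mul_of_nonneg_left h' hQ3.le, mul_lt_mul_of_pos_right h5 h6])
  rw [pow_add]
  simpa [mul_assoc, mul_comm, mul_left_comm] using key

end FullCore

section Tail

/-- The numerator of the contribution of the factors of degree at most `D`. -/
def tailNum (q : ℕ) : ℕ → ℕ
  | 0 => 1
  | e + 1 => tailNum q e * (2 * q ^ (e + 1)) ^ (12 * ((q ^ (e + 1) - 1) / (e + 1)))

/-- The denominator of the contribution of the factors of degree at most `D`. -/
def tailDen (q : ℕ) : ℕ → ℕ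
  | 0 => 1
  | e + 1 => tailDen q e * (q ^ (e + 1) - 1) ^ (12 * ((q ^ (e + 1) - 1) / (e + 1)))

/-- The full core criterion for all `n ≥ m`. -/
def tailCheck (q m D k : ℕ) : Bool :=
  Nat.ble ((2 * q ^ (D + 1)) ^ k) (q ^ 2 * (q ^ (D + 1) - 1) ^ k) &&
    Nat.ble (128 * 557172959423828 * q ^ 12 * tailNum q D * ((2 * q ^ (D + 1)) ^ k) ^ m)
      (tailDen q D * (q ^ 2 * (q ^ (D + 1) - 1) ^ k) ^ m)

theorem coreWeight_eq {q e : ℕ} (hq : 2 ≤ q) (he : 0 < e) :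
    0 < q ^ e - 1 ∧ coreWeight q e = ((2 * q ^ e : ℕ) : ℝ) / ((q ^ e - 1 : ℕ) : ℝ) := by
  have h1 : 1 < q ^ e := Nat.one_lt_pow he.ne' hq
  refine ⟨Nat.sub_pos_of_lt h1, ?_⟩
  have h2 : (1 : ℝ) < (q : ℝ) ^ e := by exact_mod_cast h1
  have h3 : (q : ℝ) ^ e - 1 ≠ 0 := (sub_pos.2 h2).ne'
  rw [coreWeight, Nat.cast_sub h1.le]
  push_cast
  have h4 : (q : ℝ) ^ e ≠ 0 := by positivity
  field_simp

theorem prod_coreWeight_eq {q : ℕ} (hq : 2 ≤ q) (D : ℕ) :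
    0 < tailDen q D ∧
    ∏ e ∈ Finset.range D, coreWeight q (e + 1) ^ (12 * ((q ^ (e + 1) - 1) / (e + 1))) =
      (tailNum q D : ℝ) / tailDen q D := by
  induction D with
  | zero => simp [tailNum, tailDen]
  | succ D ih =>
    have h := coreWeight_eq hq D.succ_pos
    refine ⟨Nat.mul_pos ih.1 (pow_pos h.1 _), ?_⟩
    rw [Finset.prod_range_succ, ih.2, h.2, tailNum, tailDen, Nat.cast_mul (tailNum q D),
      Nat.cast_mul (tailDen q D), Nat.cast_pow (2 * q ^ (D + 1)), Nat.cast_pow (q ^ (D + 1) - 1),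
      div_pow, div_mul_div_comm]

variable {Fq F : Type*} [Field Fq] [Field F] [Fintype Fq] [Fintype F] [Algebra Fq F]

theorem exists_pair_of_tailCheck {q n m D k : ℕ} (hq : Fintype.card Fq = q)
    (hn : Module.finrank Fq F = n) (hq3 : 3 < q) (hn14 : 14 ≤ n) (hm : m ≤ n) (hD : D ≤ 3)
    (hk : k * (D + 1) = 12) (h : tailCheck q m D k = true) :
    ∃ α : F, α ≠ 0 ∧ orderOf α = q ^ n - 1 ∧ orderOf α⁻¹ = q ^ n - 1 ∧
      IsKNormal Fq q n 1 α ∧ IsKNormal Fq q n 1 α⁻¹ := by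
  rw [tailCheck, Bool.and_eq_true, Nat.ble_eq, Nat.ble_eq] at h
  obtain ⟨h1, h2⟩ := h
  refine exists_pair_of_full_core hq hn hq3 hn14 hD hk ?_
  obtain ⟨hT0, hT⟩ := prod_coreWeight_eq (q := q) (by omega) D
  obtain ⟨hw0, hw⟩ := coreWeight_eq (q := q) (by omega) D.succ_pos
  rw [Nat.succ_eq_add_one] at hw hw0
  rw [hT, hw]
  have h3 : 128 * 557172959423828 * q ^ 12 * tailNum q D * ((2 * q ^ (D + 1)) ^ k) ^ n ≤
      tailDen q D * (q ^ 2 * (q ^ (D + 1) - 1) ^ k) ^ n := by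
    obtain ⟨j, rfl⟩ := Nat.exists_eq_add_of_le hm
    rw [pow_add _ m j, pow_add _ m j, ← mul_assoc, ← mul_assoc]
    exact Nat.mul_le_mul h2 (Nat.pow_le_pow_left h1 j)
  have hw0' : (0 : ℝ) < ((q ^ (D + 1) - 1 : ℕ) : ℝ) := by exact_mod_cast hw0
  have hT0' : (0 : ℝ) < tailDen q D := by exact_mod_cast hT0
  generalize q ^ (D + 1) - 1 = W at *
  have h4 := (Nat.cast_le (α := ℝ)).2 h3
  push_cast at h4
  rw [div_pow, div_pow, div_mul_div_comm, mul_div_assoc', div_le_iff₀ (by positivity)]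
  push_cast
  refine le_trans (le_of_eq ?_) (h4.trans_eq ?_)
  · ring
  · rw [mul_pow]
    ring

/-- The number `D` of degrees treated separately in the tail. -/
def tailDegree (q : ℕ) : ℕ :=
  bif Nat.blt q 6 then 3 else bif Nat.blt q 10 then 2 else bif Nat.blt q 100 then 1 else 0

theorem smallPrimePowers_tailCheck :
    smallPrimePowers.all (fun q => tailCheck q (rangeBound q) (tailDegree q)
      (12 / (tailDegree q + 1))) = true := by
  decide +kernel

theorem exists_pair_of_rangeBound_le {q n : ℕ} (hpp : IsPrimePow q) (h3 : 3 < q) (h256 : q < 256)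
    (h14 : 14 ≤ n) (hb : rangeBound q ≤ n)
    (hq : Fintype.card Fq = q) (hn : Module.finrank Fq F = n) :
    ∃ α : F, α ≠ 0 ∧ orderOf α = q ^ n - 1 ∧ orderOf α⁻¹ = q ^ n - 1 ∧
      IsKNormal Fq q n 1 α ∧ IsKNormal Fq q n 1 α⁻¹ := by
  have hD : tailDegree q = 0 ∨ tailDegree q = 1 ∨ tailDegree q = 2 ∨ tailDegree q = 3 := by
    unfold tailDegree
    cases Nat.blt q 6 <;> cases Nat.blt q 10 <;> cases Nat.blt q 100 <;> simp
  have h := List.all_eq_true.1 smallPrimePowers_tailCheck q (mem_smallPrimePowers hpp h3 h256)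
  refine exists_pair_of_tailCheck hq hn h3 h14 hb (by omega) ?_ h
  rcases hD with h | h | h | h <;> rw [h]

end Tail

section LargeField

theorem num_factors_le {q n : ℕ} (hn : 0 < n) :
    numLinear q n ≤ n ∧ numQuadratic q n ≤ n / 2 ∧ numCubic q n ≤ n / 3 ∧ numHigher q n ≤ n / 4 := by
  have h1 : n.gcd (q - 1) ≤ n := Nat.gcd_le_left _ hn
  have h2 : n.gcd (q ^ 2 - 1) ≤ n := Nat.gcd_le_left _ hn
  have h3 : n.gcd (q ^ 3 - 1) ≤ n := Nat.gcd_le_left _ hn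
  unfold numHigher numLinear numQuadratic numCubic
  omega

variable {Fq F : Type*} [Field Fq] [Field F] [Fintype Fq] [Fintype F] [Algebra Fq F]

theorem exists_pair_of_large {q n : ℕ} (h256 : 256 ≤ q) (h14 : 14 ≤ n)
    (hq : Fintype.card Fq = q) (hn : Module.finrank Fq F = n) :
    ∃ α : F, α ≠ 0 ∧ orderOf α = q ^ n - 1 ∧ orderOf α⁻¹ = q ^ n - 1 ∧
      IsKNormal Fq q n 1 α ∧ IsKNormal Fq q n 1 α⁻¹ := by
  have hqR : (256 : ℝ) ≤ q := by exact_mod_cast h256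
  rcases lt_or_ge n 39 with h39 | h39
  · obtain ⟨n1, n2, n3, n4⟩ := num_factors_le (q := q) (n := n) (by omega)
    have hs : 1 + sieveCard q n 0 0 0 ≤ 157 := by
      unfold sieveCard
      omega
    have hσ : 2 * sieveSum q n 0 0 0 ≤ q ^ 4 := by
      have h1 : numLinear q n ≤ 38 := by omega
      have h2 : numQuadratic q n ≤ 19 := by omega
      have h3 : numCubic q n ≤ 12 := by omega
      have h4 : numHigher q n ≤ 9 := by omega
      have hq3 : 256 * q ^ 3 ≤ q ^ 4 := by
        rw [pow_succ' q 3]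
        gcongr
      have hq2 : 256 * q ^ 2 ≤ q ^ 3 := by
        rw [pow_succ' q 2]
        gcongr
      have hq1 : 256 * q ≤ q ^ 2 := by
        rw [pow_succ' q 1, pow_one]
        gcongr
      have e1 := Nat.mul_le_mul_right (q ^ 3) h1
      have e2 := Nat.mul_le_mul_right (q ^ 2) h2
      have e3 := Nat.mul_le_mul_right q h3
      unfold sieveSum
      rw [Nat.sub_zero, Nat.sub_zero, Nat.sub_zero]
      omega
    have hq4 : 0 < q ^ 4 := by positivity
    refine exists_pair_of_all_primes_core hq hn (Nat.zero_le _) (Nat.zero_le _) (Nat.zero_le _)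
      (by omega) ?_
    have hN : coreNum q 0 0 0 = 1 := by simp [coreNum]
    have hd : coreDen q 0 0 0 = 1 := by simp [coreDen]
    rw [hN, hd]
    have hx : q ^ 4 ≤ 2 * (q ^ 4 - sieveSum q n 0 0 0) := by omega
    generalize q ^ 4 - sieveSum q n 0 0 0 = x at hx ⊢
    have hQ : q ^ 14 ≤ q ^ n := Nat.pow_le_pow_right (by omega) h14
    have hQ2 : 1 < q ^ n := lt_of_lt_of_le (Nat.one_lt_pow (by norm_num) (by omega)) hQ
    have hy : q ^ n ≤ 2 * (q ^ n - 1) := by omega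
    generalize q ^ n - 1 = y at hy ⊢
    generalize q ^ n = Q at hQ hQ2 hy ⊢
    refine lt_of_mul_lt_mul_left (a := 2 ^ 11) ?_ (Nat.zero_le _)
    calc 2 ^ 11 * (64 * 557172959423828 * Q ^ 3 * q ^ 12 * 1 ^ 6 *
          (1 + sieveCard q n 0 0 0) ^ 6 * q ^ 24)
        ≤ 2 ^ 11 * (64 * 557172959423828 * Q ^ 3 * q ^ 12 * 1 ^ 6 * 157 ^ 6 * q ^ 24) := by gcongr
      _ = (2 ^ 17 * 557172959423828 * 157 ^ 6) * (Q ^ 3 * q ^ 36) := by ring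
      _ < 256 ^ 16 * (Q ^ 3 * q ^ 36) := by
          refine Nat.mul_lt_mul_of_pos_right (by norm_num) (by positivity)
      _ ≤ q ^ 16 * (Q ^ 3 * q ^ 36) := by gcongr
      _ = Q ^ 3 * (q ^ 14) ^ 2 * (q ^ 4) ^ 6 := by ring
      _ ≤ Q ^ 3 * Q ^ 2 * (q ^ 4) ^ 6 := by gcongr
      _ = Q ^ 5 * (q ^ 4) ^ 6 := by ring
      _ ≤ (2 * y) ^ 5 * (2 * x) ^ 6 := by gcongr
      _ = 2 ^ 11 * (y ^ 5 * x ^ 6 * 1 ^ 6) := by ring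
  · refine exists_pair_of_full_core (D := 0) (k := 12) hq hn (by omega) h14 (by norm_num)
      (by norm_num) ?_
    have hw : coreWeight q 1 ≤ 512 / 255 := by
      rw [coreWeight, pow_one]
      have : 1 / (q : ℝ) ≤ 1 / 256 := by gcongr
      rw [div_le_div_iff₀ (by linarith) (by norm_num)]
      linarith
    have hw0 : 0 ≤ coreWeight q 1 := zero_le_one.trans (one_le_coreWeight (by omega) one_pos)
    obtain ⟨j, rfl⟩ := Nat.exists_eq_add_of_le h39
    rw [Finset.range_zero, Finset.prod_empty, one_mul, zero_add, pow_add, pow_add]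
    have h1 : coreWeight q 1 ^ 12 ≤ (q : ℝ) ^ 2 := by
      calc coreWeight q 1 ^ 12 ≤ (512 / 255) ^ 12 := by gcongr
        _ ≤ 256 ^ 2 := by norm_num
        _ ≤ (q : ℝ) ^ 2 := by gcongr
    have h2 : 128 * 557172959423828 * (q : ℝ) ^ 12 * (coreWeight q 1 ^ 12) ^ 39 ≤
        ((q : ℝ) ^ 2) ^ 39 := by
      calc 128 * 557172959423828 * (q : ℝ) ^ 12 * (coreWeight q 1 ^ 12) ^ 39
          ≤ 128 * 557172959423828 * (q : ℝ) ^ 12 * ((512 / 255) ^ 12) ^ 39 := by gcongr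
        _ ≤ 256 ^ 66 * (q : ℝ) ^ 12 := by
          rw [mul_right_comm]
          gcongr
          norm_num
        _ ≤ (q : ℝ) ^ 66 * (q : ℝ) ^ 12 := by gcongr
        _ = _ := by ring
    calc _ = 128 * 557172959423828 * (q : ℝ) ^ 12 * (coreWeight q 1 ^ 12) ^ 39 *
          (coreWeight q 1 ^ 12) ^ j := by ring
      _ ≤ _ := mul_le_mul h2 (pow_le_pow_left₀ (by positivity) h1 j) (by positivity)
          (by positivity)

end LargeField

section PackedArithmetic

/-- The word size used to pack the coefficients of a polynomial into a natural number. -/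
def wordBase : ℕ := 340282366920938463463374607431768211456

/-- Evaluate the second argument once before passing it on. -/
def forceNat {α : Type*} (f : ℕ → α) : ℕ → α
  | 0 => f 0
  | n + 1 => f (n + 1)

/-- Convert from base `p` to base `wordBase`. -/
def packBase (p : ℕ) : ℕ → ℕ → ℕ
  | 0, _ => 0
  | L + 1, a => a % p + wordBase * packBase p L (a / p)

/-- Reduce the words of a packed polynomial modulo `p`. -/
def packNorm (p : ℕ) : ℕ → ℕ → ℕ
  | 0, _ => 0
  | L + 1, a => a % wordBase % p + wordBase * forceNat (packNorm p L) (a / wordBase)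

/-- Substitute `t` for `X ^ N`, where `M = wordBase ^ N`. -/
def packFold (M t a : ℕ) : ℕ := a % M + a / M * t

/-- Reduce the words modulo `p` up to a multiple of `p`, where `c` is `2 ^ 64 / p` and
the words of `m` are `2 ^ 64 - 1`. -/
def packBarrett (p c m a : ℕ) : ℕ := a - p * Nat.land (a * c / 18446744073709551616) m

/-- Reduction modulo `p` and `X ^ N - t`. -/
def packReduce (p c m M t a : ℕ) : ℕ :=
  forceNat (fun a => forceNat (fun a => forceNat (packBarrett p c m) (packFold M t a))
    (packFold M t a)) a

/-- Binary powering; the first numerical argument bounds the number of binary digits. -/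
def packPowAux (R : ℕ → ℕ) (a : ℕ) : ℕ → ℕ → ℕ
  | 0, _ => 1
  | k + 1, e => forceNat (fun s => bif Nat.beq (e % 2) 1 then R (R (s * s) * a)
      else R (s * s)) (packPowAux R a k (e / 2))

/-- Powering. -/
def packPow (R : ℕ → ℕ) (a e : ℕ) : ℕ := packPowAux R a (e.log2 + 1) e

/-- Prepend `k` successive `q`-th powers of `a` to the list `l`. -/
def packConj {β : Type*} (R : ℕ → ℕ) (q : ℕ) (f : List ℕ → β) : ℕ → ℕ → List ℕ → β
  | 0, _, l => f l
  | k + 1, a, l => forceNat (fun a => packConj R q f k (packPow R a q) (a :: l)) a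

/-- The sum of the products of corresponding entries. -/
def packDot : List ℕ → List ℕ → ℕ
  | u :: U, a :: A => u * a + packDot U A
  | _, _ => 0

/-- The first `k` tails of `A` are orthogonal to `U`. -/
def packOrtho (C : ℕ → ℕ → Bool) (U : List ℕ) : ℕ → List ℕ → Bool
  | k + 1, a :: A => C (packDot U (a :: A)) 0 && packOrtho C U k A
  | _, _ => true

/-- The trace conditions making `a` a `1`-normal element with dual element `u`. -/
def packNormalCheck (R : ℕ → ℕ) (C : ℕ → ℕ → Bool) (q n u a : ℕ) : Bool :=
  packConj R q (fun U => packConj R q (fun A =>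
    C (packDot U A) 1 && packOrtho C U (n - 2) A.tail &&
      C (packDot (List.replicate n 1) (A.drop (n - 1))) 0) (2 * n - 1) a []) n u []

/-- The product of the elements `a ^ (m / r) - 1` over the list, where `c = p - 1`. -/
def packOrderProd (R : ℕ → ℕ) (c m a : ℕ) : List ℕ → ℕ
  | [] => 1
  | r :: P => forceNat (fun s => R (R (packPow R a (m / r) + c) * s)) (packOrderProd R c m a P)

/-- All conditions on the packed elements, with reduction `R` and comparison `C`. -/
def packCheck (R : ℕ → ℕ) (C : ℕ → ℕ → Bool) (p N q n : ℕ) (P : List ℕ) (a b w u v : ℕ) : Bool :=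
  C (packPow R wordBase (p ^ N)) wordBase &&
  C (a * b) 1 &&
  C (packPow R a (p ^ N - 1)) 1 &&
  C (packOrderProd R (p - 1) (p ^ N - 1) a P * w) 1 &&
  packNormalCheck R C q n u a && packNormalCheck R C q n v b

/-- Compare the reduction of `a` with `b`. -/
def packEq (R : ℕ → ℕ) (p N a b : ℕ) : Bool := Nat.beq (forceNat (packNorm p N) (R a)) b

/-- All conditions on elements given by their coefficients in base `p`. -/
def explicitCheck (p N q n : ℕ) (P : List ℕ) (t a b w u v : ℕ) : Bool :=
  forceNat (fun m => forceNat (fun M => forceNat (fun t => forceNat (fun a => forceNat (fun b =>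
    forceNat (fun w => forceNat (fun u => forceNat (fun v =>
      packCheck (packReduce p (18446744073709551616 / p) m M t)
        (packEq (packReduce p (18446744073709551616 / p) m M t) p N) p N q n P a b w u v)
      (packBase p N v)) (packBase p N u)) (packBase p N w)) (packBase p N b)) (packBase p N a))
      (packBase p 8 t)) (wordBase ^ N)) ((wordBase ^ N - 1) / (wordBase - 1) * 18446744073709551615)

end PackedArithmetic

section PackedSemantics

variable {A : Type*} [CommRing A]

/-- The number `a` is a packed polynomial with value `y` at `θ`, with at most `L` words of
total size at most `S`. -/
def PackRep (θ : A) (S L a : ℕ) (y : A) : Prop :=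
  ∃ f : ℕ[X], (∀ i, L ≤ i → f.coeff i = 0) ∧ f.eval 1 ≤ S ∧ f.eval wordBase = a ∧ aeval θ f = y

theorem forceNat_eq {β : Type*} (f : ℕ → β) (a : ℕ) : forceNat f a = f a := by
  cases a <;> rfl

variable {θ : A} {S S' L L' a b : ℕ} {y z : A}

theorem PackRep.mono (h : PackRep θ S L a y) (hS : S ≤ S') (hL : L ≤ L') :
    PackRep θ S' L' a y := by
  obtain ⟨f, h1, h2, h3, h4⟩ := h
  exact ⟨f, fun i hi => h1 i (hL.trans hi), h2.trans hS, h3, h4⟩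

theorem PackRep.add (h : PackRep θ S L a y) (h' : PackRep θ S' L b z) :
    PackRep θ (S + S') L (a + b) (y + z) := by
  obtain ⟨f, h1, h2, h3, h4⟩ := h
  obtain ⟨g, g1, g2, g3, g4⟩ := h'
  refine ⟨f + g, fun i hi => by rw [coeff_add, h1 i hi, g1 i hi], ?_, ?_, ?_⟩
  · rw [eval_add]; omega
  · rw [eval_add, h3, g3]
  · rw [map_add, h4, g4]

theorem PackRep.mul (h : PackRep θ S L a y) (h' : PackRep θ S' L' b z) :
    PackRep θ (S * S') (L + L') (a * b) (y * z) := by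
  obtain ⟨f, h1, h2, h3, h4⟩ := h
  obtain ⟨g, g1, g2, g3, g4⟩ := h'
  refine ⟨f * g, fun i hi => ?_, ?_, ?_, ?_⟩
  · rw [coeff_mul]
    refine Finset.sum_eq_zero fun x hx => ?_
    replace hx := Finset.HasAntidiagonal.mem_antidiagonal.1 hx
    rcases le_or_gt L x.1 with h | h
    · rw [h1 _ h, zero_mul]
    · rw [g1 x.2 (by omega), mul_zero]
  · rw [eval_mul]; exact Nat.mul_le_mul h2 g2
  · rw [eval_mul, h3, g3]
  · rw [map_mul, h4, g4]

theorem packRep_const (θ : A) (c : ℕ) : PackRep θ c 1 c (c : A) := by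
  refine ⟨C c, fun i hi => coeff_C_of_ne_zero (by omega), by simp, by simp, ?_⟩
  rw [aeval_C]; simp

theorem packRep_wordBase (θ : A) : PackRep θ 1 2 wordBase θ :=
  ⟨X, fun i hi => coeff_X_of_ne_one (by omega), by simp, by simp, by simp⟩

theorem packRep_zero (θ : A) : PackRep θ 0 0 0 0 :=
  ⟨0, by simp, by simp, by simp, by simp⟩

theorem PackRep.cons {d D : ℕ} (hd : d ≤ D) (h : PackRep θ S L a y) :
    PackRep θ (S + D) (L + 1) (d + wordBase * a) (d + θ * y) := by
  obtain ⟨f, h1, h2, h3, h4⟩ := h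
  refine ⟨C d + X * f, fun i hi => ?_, ?_, ?_, ?_⟩
  · obtain ⟨i, rfl⟩ : ∃ k, i = k + 1 := ⟨i - 1, by omega⟩
    rw [coeff_add, coeff_X_mul, h1 i (by omega), coeff_C_of_ne_zero (by omega)]
  · simp only [eval_add, eval_C, eval_mul, eval_X]; omega
  · simp only [eval_add, eval_C, eval_mul, eval_X, h3]
  · simp [h4]

theorem PackRep.of_length_zero (h : PackRep θ S 0 a y) : a = 0 ∧ y = 0 := by
  obtain ⟨f, h1, h2, h3, h4⟩ := h
  have : f = 0 := by ext i; simpa using h1 i (Nat.zero_le _)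
  subst this
  simp at h3 h4
  exact ⟨h3.symm, h4.symm⟩

theorem PackRep.uncons (h : PackRep θ S (L + 1) a y) (hS : S < wordBase) :
    a % wordBase ≤ S ∧ ∃ z, PackRep θ (S - a % wordBase) L (a / wordBase) z ∧
      y = (a % wordBase : ℕ) + θ * z := by
  obtain ⟨f, h1, h2, h3, h4⟩ := h
  have hf := X_mul_divX_add f
  have e1 : f.eval 1 = f.divX.eval 1 + f.coeff 0 := by
    conv_lhs => rw [← hf]
    simp
  have hB : f.eval wordBase = wordBase * f.divX.eval wordBase + f.coeff 0 := by
    conv_lhs => rw [← hf]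
    simp
  have hmod : a % wordBase = f.coeff 0 := by
    rw [← h3, hB, Nat.mul_add_mod, Nat.mod_eq_of_lt (by omega)]
  have hdiv : a / wordBase = f.divX.eval wordBase := by
    rw [← h3, hB, Nat.mul_add_div (by omega), Nat.div_eq_of_lt (by omega), add_zero]
  refine ⟨by omega, aeval θ f.divX, ⟨f.divX, fun i hi => ?_, by omega, hdiv.symm, rfl⟩, ?_⟩
  · rw [coeff_divX]; exact h1 _ (by omega)
  · rw [hmod, ← h4]
    conv_lhs => rw [← hf]
    simp [add_comm]

theorem PackRep.unique (h : PackRep θ S L a y) (h' : PackRep θ S' L a z) (hS : S < wordBase)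
    (hS' : S' < wordBase) : y = z := by
  induction L generalizing S S' a y z with
  | zero => rw [h.of_length_zero.2, h'.of_length_zero.2]
  | succ L ih =>
    obtain ⟨-, y', h1, rfl⟩ := h.uncons hS
    obtain ⟨-, z', h1', rfl⟩ := h'.uncons hS'
    rw [ih h1 h1' (by omega) (by omega)]

theorem cast_mod_of_cast_eq_zero {p : ℕ} (hp : (p : A) = 0) (d : ℕ) :
    ((d % p : ℕ) : A) = d := by
  conv_rhs => rw [← Nat.mod_add_div d p]
  simp [hp]

theorem PackRep.packNorm {p : ℕ} (hp : (p : A) = 0) (hp0 : 0 < p) (h : PackRep θ S L a y)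
    (hS : S < wordBase) : PackRep θ (L * p) L (packNorm p L a) y := by
  induction L generalizing S a y with
  | zero =>
    obtain ⟨rfl, rfl⟩ := h.of_length_zero
    simpa [_root_.packNorm] using packRep_zero θ
  | succ L ih =>
    obtain ⟨-, z, h1, rfl⟩ := h.uncons hS
    rw [_root_.packNorm, forceNat_eq, add_one_mul, ← cast_mod_of_cast_eq_zero hp (a % wordBase)]
    exact (ih h1 (by omega)).cons (Nat.mod_lt _ hp0).le

theorem PackRep.split {K : ℕ} (h : PackRep θ S (K + L) a y) (hS : S < wordBase) :
    ∃ y₀ y₁, PackRep θ S K (a % wordBase ^ K) y₀ ∧ PackRep θ S L (a / wordBase ^ K) y₁ ∧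
      y = y₀ + y₁ * θ ^ K := by
  induction K generalizing S a y with
  | zero =>
    refine ⟨0, y, ?_, ?_, by simp⟩
    · simpa [Nat.mod_one] using (packRep_zero θ).mono (Nat.zero_le S) le_rfl
    · simpa using h
  | succ K ih =>
    rw [Nat.add_right_comm] at h
    obtain ⟨hle, z, h1, rfl⟩ := h.uncons hS
    obtain ⟨y₀, y₁, h2, h3, rfl⟩ := ih h1 (by omega)
    refine ⟨(a % wordBase : ℕ) + θ * y₀, y₁, ?_, ?_, by ring⟩
    · rw [pow_succ', Nat.mod_mul]
      exact (h2.cons le_rfl).mono (by omega) le_rfl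
    · rw [pow_succ', ← Nat.div_div_eq_div_mul]
      exact h3.mono (by omega) le_rfl

theorem PackRep.packFold {N D St t : ℕ} (h : PackRep θ S (N + L) a y) (hS : S < wordBase)
    (ht : PackRep θ St D t (θ ^ N)) :
    PackRep θ (S * (1 + St)) (max N (L + D)) (packFold (wordBase ^ N) t a) y := by
  obtain ⟨y₀, y₁, h0, h1, rfl⟩ := h.split hS
  rw [mul_add, mul_one]
  exact (h0.mono le_rfl (le_max_left _ _)).add ((h1.mul ht).mono le_rfl (le_max_right _ _))

theorem land_add_mul_two_pow (k a b c d : ℕ) (ha : a < 2 ^ k) (hc : c < 2 ^ k) :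
    Nat.land (a + 2 ^ k * b) (c + 2 ^ k * d) = Nat.land a c + 2 ^ k * Nat.land b d := by
  change (a + 2 ^ k * b) &&& (c + 2 ^ k * d) = (a &&& c) + 2 ^ k * (b &&& d)
  have hac : a &&& c < 2 ^ k := Nat.and_lt_two_pow _ hc
  refine Nat.eq_of_testBit_eq fun i => ?_
  rw [Nat.testBit_and, add_comm a, add_comm c, add_comm (a &&& c),
    Nat.testBit_two_pow_mul_add _ ha, Nat.testBit_two_pow_mul_add _ hc,
    Nat.testBit_two_pow_mul_add _ hac]
  split_ifs <;> simp

/-- The number with `L` words equal to `2 ^ 64 - 1`. -/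
def packMask : ℕ → ℕ
  | 0 => 0
  | L + 1 => 18446744073709551615 + wordBase * packMask L

theorem packMask_eq (L : ℕ) :
    packMask L = (wordBase ^ L - 1) / (wordBase - 1) * 18446744073709551615 := by
  induction L with
  | zero => simp [packMask]
  | succ L ih =>
    have hd : wordBase - 1 ∣ wordBase ^ L - 1 := by simpa using Nat.sub_dvd_pow_sub_pow wordBase 1 L
    obtain ⟨k, hk⟩ := hd
    have h1 : 1 ≤ wordBase ^ L := Nat.one_le_pow _ _ (by norm_num [wordBase])
    have hw : 0 < wordBase - 1 := by norm_num [wordBase]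
    have hs : wordBase ^ (L + 1) - 1 = (wordBase - 1) * (1 + wordBase * k) := by
      have : wordBase ^ L = (wordBase - 1) * k + 1 := by omega
      rw [pow_succ, this]
      obtain ⟨w, hw⟩ : ∃ w, wordBase = w + 1 := ⟨wordBase - 1, by omega⟩
      rw [hw, Nat.add_sub_cancel, Nat.sub_eq_iff_eq_add (Nat.mul_pos (by omega) (by omega))]
      ring
    rw [packMask, ih, hk, hs, Nat.mul_div_cancel_left _ hw, Nat.mul_div_cancel_left _ hw]
    ring

theorem packBarrett_succ {p c m d e : ℕ} (hc : p * c ≤ 2 ^ 64) (hc0 : c ≤ 2 ^ 64)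
    (hd : d < 2 ^ 64) :
    p * Nat.land (e * c / 18446744073709551616) m ≤ e → 
    packBarrett p c (18446744073709551615 + wordBase * m) (d + wordBase * e) =
      (d - p * (d * c / 2 ^ 64)) + wordBase * packBarrett p c m e ∧
    p * Nat.land ((d + wordBase * e) * c / 18446744073709551616)
      (18446744073709551615 + wordBase * m) ≤ d + wordBase * e := by
  intro he
  have hle : p * (d * c / 2 ^ 64) ≤ d := by
    have : p * (d * c / 2 ^ 64) ≤ p * (d * c) / 2 ^ 64 := Nat.mul_div_le_mul_div_assoc ..
    refine this.trans (Nat.div_le_of_le_mul ?_)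
    calc p * (d * c) = (p * c) * d := by ring
      _ ≤ _ := Nat.mul_le_mul_right _ hc
  have hlt : d * c / 2 ^ 64 < 2 ^ 64 := by
    rw [Nat.div_lt_iff_lt_mul (by norm_num)]
    nlinarith
  have hkey : Nat.land ((d + wordBase * e) * c / 18446744073709551616)
      (18446744073709551615 + wordBase * m) =
      d * c / 2 ^ 64 + wordBase * Nat.land (e * c / 18446744073709551616) m := by
    have e1 : (d + wordBase * e) * c / 18446744073709551616 =
        d * c / 2 ^ 64 + 2 ^ 64 * (e * c) := by
      have : (d + wordBase * e) * c = d * c + 2 ^ 64 * (2 ^ 64 * (e * c)) := by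
        rw [wordBase]; ring
      rw [this]; exact Nat.add_mul_div_left _ _ (by norm_num)
    have e2 : 2 ^ 64 * (e * c) = 2 ^ 64 * (e * c % 2 ^ 64) + wordBase * (e * c / 2 ^ 64) := by
      conv_lhs => rw [← Nat.mod_add_div (e * c) (2 ^ 64)]
      rw [wordBase]; ring
    have hb : wordBase = 2 ^ 128 := by norm_num [wordBase]
    have hm : e * c % 2 ^ 64 < 2 ^ 64 := Nat.mod_lt _ (by norm_num)
    have e3 : Nat.land (d * c / 2 ^ 64 + 2 ^ 64 * (e * c % 2 ^ 64)) 18446744073709551615 =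
        d * c / 2 ^ 64 := by
      change _ &&& (2 ^ 64 - 1) = _
      rw [Nat.and_two_pow_sub_one_eq_mod, Nat.add_mul_mod_self_left, Nat.mod_eq_of_lt hlt]
    rw [e1, e2, ← add_assoc, hb, land_add_mul_two_pow _ _ _ _ _ (by omega) (by norm_num), e3]
    norm_num
  refine ⟨?_, ?_⟩
  · unfold packBarrett
    rw [hkey, Nat.mul_sub, mul_add]
    have : p * (wordBase * Nat.land (e * c / 18446744073709551616) m) ≤ wordBase * e := by
      rw [mul_left_comm]; exact Nat.mul_le_mul_left _ he
    rw [mul_left_comm wordBase p]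
    omega
  · rw [hkey, mul_add, mul_left_comm]
    exact Nat.add_le_add hle (Nat.mul_le_mul_left _ he)

theorem PackRep.packBarrett {p : ℕ} (hp : (p : A) = 0) (hp0 : 0 < p) (h : PackRep θ S L a y)
    (hS : S < 2 ^ 64) :
    PackRep θ (L * (2 * p)) L (packBarrett p (18446744073709551616 / p) (packMask L) a) y ∧
      p * Nat.land (a * (18446744073709551616 / p) / 18446744073709551616) (packMask L) ≤ a := by
  have hc : p * (18446744073709551616 / p) ≤ 2 ^ 64 := Nat.mul_div_le _ _
  have hc0 : 18446744073709551616 / p ≤ 2 ^ 64 := Nat.div_le_self _ _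
  have hc1 : 2 ^ 64 < p * (18446744073709551616 / p) + p := by
    have := Nat.div_add_mod 18446744073709551616 p
    have := Nat.mod_lt 18446744073709551616 hp0
    omega
  induction L generalizing S a y with
  | zero =>
    obtain ⟨rfl, rfl⟩ := h.of_length_zero
    exact ⟨by simpa [_root_.packBarrett] using packRep_zero θ, by simp [packMask]⟩
  | succ L ih =>
    obtain ⟨hd, z, h1, rfl⟩ := h.uncons (hS.trans (by norm_num [wordBase]))
    obtain ⟨h2, h3⟩ := ih h1 (by omega)
    obtain ⟨h4, h5⟩ := packBarrett_succ (d := a % wordBase) hc hc0 (by omega) h3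
    rw [Nat.mod_add_div] at h4 h5
    refine ⟨?_, h5⟩
    rw [packMask, h4, add_one_mul]
    set c := 18446744073709551616 / p
    set d := a % wordBase
    have hle : p * (d * c / 2 ^ 64) ≤ d := by
      have : p * (d * c / 2 ^ 64) ≤ p * (d * c) / 2 ^ 64 := Nat.mul_div_le_mul_div_assoc ..
      refine this.trans (Nat.div_le_of_le_mul ?_)
      calc p * (d * c) = (p * c) * d := by ring
        _ ≤ _ := Nat.mul_le_mul_right _ hc
    have hv : ((d : ℕ) : A) = ((d - p * (d * c / 2 ^ 64) : ℕ) : A) := by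
      rw [Nat.cast_sub hle]; simp [hp]
    rw [hv]
    refine h2.cons ?_
    have hq := Nat.div_add_mod (d * c) (2 ^ 64)
    have hr := Nat.mod_lt (d * c) (y := 2 ^ 64) (by norm_num)
    have hd64 : d < 2 ^ 64 := by omega
    have hlow : 2 ^ 64 * d ≤ 2 ^ 64 * (p * (d * c / 2 ^ 64)) + 2 ^ 64 * (2 * p) := by
      have k1 : p * (2 ^ 64 * (d * c / 2 ^ 64) + 2 ^ 64) ≥ p * (d * c) :=
        Nat.mul_le_mul_left _ (by omega)
      have k2 : 2 ^ 64 * d ≤ (p * c + p) * d := Nat.mul_le_mul_right _ hc1.le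
      have k3 : p * d ≤ p * 2 ^ 64 := Nat.mul_le_mul_left _ hd64.le
      have k4 : (p * c + p) * d = p * (d * c) + p * d := by ring
      have k5 : p * (2 ^ 64 * (d * c / 2 ^ 64) + 2 ^ 64) =
        2 ^ 64 * (p * (d * c / 2 ^ 64)) + 2 ^ 64 * p := by ring
      omega
    omega

theorem PackRep.packReduce {p N D St t : ℕ} (hp : (p : A) = 0) (hp0 : 0 < p)
    (ht : PackRep θ St D t (θ ^ N)) (hD : D + D ≤ N) (h : PackRep θ S (N + N) a y)
    (hS : S * (1 + St) * (1 + St) < 2 ^ 64) :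
    PackRep θ (N * (2 * p)) N
      (packReduce p (18446744073709551616 / p) (packMask N) (wordBase ^ N) t a) y := by
  have hw : (2 : ℕ) ^ 64 < wordBase := by norm_num [wordBase]
  have hS1 : S * (1 + St) < 2 ^ 64 := lt_of_le_of_lt (Nat.le_mul_of_pos_right _ (by omega)) hS
  have hS0 : S < 2 ^ 64 := lt_of_le_of_lt (Nat.le_mul_of_pos_right _ (by omega)) hS1
  have h1 := (h.packFold (hS0.trans hw) ht).mono le_rfl (L' := N + D) (by simp)
  have h2 := (h1.packFold (hS1.trans hw) ht).mono le_rfl (L' := N) (by simp [hD])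
  simp only [_root_.packReduce, forceNat_eq]
  exact (h2.packBarrett hp hp0 hS).1

/-- The polynomial over `ℕ` with `L` coefficients given by the digits of `a` in base `p`. -/
noncomputable def digitPoly (p : ℕ) : ℕ → ℕ → ℕ[X]
  | 0, _ => 0
  | L + 1, a => C (a % p) + X * digitPoly p L (a / p)

theorem packRep_packBase (θ : A) {p : ℕ} (hp0 : 0 < p) (L a : ℕ) :
    PackRep θ (L * p) L (packBase p L a) (aeval θ (digitPoly p L a)) := by
  induction L generalizing a with
  | zero => simpa [packBase, digitPoly] using packRep_zero θ
  | succ L ih =>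
    have := (ih (a / p)).cons (Nat.mod_lt a hp0).le
    simpa [packBase, digitPoly, add_one_mul] using this

theorem degree_digitPoly_lt (p L a : ℕ) : (digitPoly p L a).degree < L := by
  rw [degree_lt_iff_coeff_zero]
  induction L generalizing a with
  | zero => simp [digitPoly]
  | succ L ih =>
    intro i hi
    obtain ⟨i, rfl⟩ : ∃ k, i = k + 1 := ⟨i - 1, by omega⟩
    rw [digitPoly, coeff_add, coeff_X_mul, ih _ i (by omega), coeff_C_of_ne_zero (by omega), add_zero]

end PackedSemantics

section PackedChecks

variable {A : Type*} [CommRing A] {θ : A} {K E N : ℕ} {R : ℕ → ℕ} {C : ℕ → ℕ → Bool}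
  {a b q k n : ℕ} {y z : A}

theorem PackRep.packPow (hR : ∀ a y, PackRep θ K (N + N) a y → PackRep θ E N (R a) y)
    (hK : E * E ≤ K) (hE : 1 ≤ E) (hN : 1 ≤ N) (h : PackRep θ E N a y) (e : ℕ) :
    PackRep θ E N (packPow R a e) (y ^ e) := by
  have aux : ∀ (k e : ℕ), e < 2 ^ k → PackRep θ E N (packPowAux R a k e) (y ^ e) := by
    intro k
    induction k with
    | zero =>
      intro e he
      obtain rfl : e = 0 := by simpa using he
      simpa [packPowAux] using (packRep_const θ 1).mono hE hN
    | succ k ih =>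
      intro e he
      have h1 := ih (e / 2) (by rw [pow_succ] at he; omega)
      have h2 := hR _ _ ((h1.mul h1).mono hK le_rfl)
      rw [packPowAux, forceNat_eq]
      rcases Nat.mod_two_eq_zero_or_one e with h0 | h0
      · have he' : y ^ e = y ^ (e / 2) * y ^ (e / 2) := by rw [← pow_add]; congr 1; omega
        rw [h0, he']
        exact h2
      · have he' : y ^ e = y ^ (e / 2) * y ^ (e / 2) * y := by
          rw [← pow_add, ← pow_succ]; congr 1; omega
        rw [h0, he']
        exact hR _ _ ((h2.mul h).mono hK le_rfl)
  exact aux _ _ Nat.lt_log2_self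

theorem packConj_eq_true (hR : ∀ a y, PackRep θ K (N + N) a y → PackRep θ E N (R a) y)
    (hK : E * E ≤ K) (hE : 1 ≤ E) (hN : 1 ≤ N) {f : List ℕ → Bool} {l : List ℕ} {ys : List A}
    (h : PackRep θ E N a y) (hl : List.Forall₂ (PackRep θ E N) l ys)
    (hf : packConj R q f k a l = true) :
    ∃ l', f l' = true ∧ List.Forall₂ (PackRep θ E N) l'
      ((List.range k).reverse.map (fun i => y ^ q ^ i) ++ ys) := by
  induction k generalizing a y l ys with
  | zero => exact ⟨l, by simpa [packConj] using hf, by simpa using hl⟩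
  | succ k ih =>
    rw [packConj, forceNat_eq] at hf
    obtain ⟨l', h1, h2⟩ := ih (h.packPow hR hK hE hN q) (List.Forall₂.cons h hl) hf
    refine ⟨l', h1, ?_⟩
    convert h2 using 1
    rw [List.range_succ_eq_map]
    simp [← pow_mul, pow_succ', Function.comp_def]

theorem packRep_packDot (hK : E * E * n ≤ K) {U V : List ℕ} {us vs : List A}
    (hU : List.Forall₂ (PackRep θ E N) U us) (hV : List.Forall₂ (PackRep θ E N) V vs)
    (hn : U.length ≤ n) :
    PackRep θ K (N + N) (packDot U V) (List.zipWith (· * ·) us vs).sum := by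
  have hlen : E * E * U.length ≤ K := (Nat.mul_le_mul_left _ hn).trans hK
  clear hn hK
  suffices h : PackRep θ (E * E * U.length) (N + N) (packDot U V)
      (List.zipWith (· * ·) us vs).sum from h.mono hlen le_rfl
  clear hlen
  induction hU generalizing V vs with
  | nil => simpa [packDot] using (packRep_zero θ).mono le_rfl (Nat.zero_le _)
  | cons h1 _ ih =>
    cases hV with
    | nil => simpa [packDot] using (packRep_zero θ).mono (Nat.zero_le _) (Nat.zero_le _)
    | cons h2 h3 =>
      have := (h1.mul h2).add (ih h3)
      simpa [packDot, mul_add, add_comm (E * E)] using this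

theorem packOrtho_eq_true
    (hC : ∀ a b y z, PackRep θ K (N + N) a y → PackRep θ K N b z → C a b = true → y = z)
    (hK : E * E * n ≤ K) {U V : List ℕ} {us vs : List A}
    (hU : List.Forall₂ (PackRep θ E N) U us) (hV : List.Forall₂ (PackRep θ E N) V vs)
    (hn : U.length ≤ n) (hf : packOrtho C U k V = true) :
    ∀ i < k, (List.zipWith (· * ·) us (vs.drop i)).sum = 0 := by
  induction k generalizing V vs with
  | zero => simp
  | succ k ih =>
    intro i hi
    cases hV with
    | nil => simp
    | cons h1 h2 =>
      rw [packOrtho, Bool.and_eq_true] at hf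
      cases i with
      | zero =>
        exact hC _ _ _ _ (packRep_packDot hK hU (.cons h1 h2) hn)
          ((packRep_zero θ).mono (Nat.zero_le _) (Nat.zero_le _)) hf.1
      | succ i => exact ih h2 hf.2 i (by omega)

theorem sum_zipWith_map_reverse_range (f g : ℕ → A) (n j : ℕ) :
    (List.zipWith (· * ·) ((List.range n).reverse.map f)
      ((List.range (n + j)).reverse.map g)).sum = ∑ i ∈ Finset.range n, f i * g (i + j) := by
  induction n with
  | zero => simp
  | succ n ih =>
    rw [Finset.sum_range_succ, ← ih, Nat.add_right_comm, List.range_succ, List.range_succ]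
    simp [add_comm]

theorem drop_reverse_range (n s : ℕ) :
    (List.range n).reverse.drop s = (List.range (n - s)).reverse := by
  rw [List.drop_reverse, List.length_range, List.take_range, min_eq_left (Nat.sub_le _ _)]

/-- The element `w` is orthogonal to all `y ^ q ^ j` with `1 ≤ j ≤ n - 2`, but not to
`y ^ q ^ (n - 1)`, under the trace form, and `y` has trace zero. -/
def TraceCertificate (q n : ℕ) (y w : A) : Prop :=
  ∑ i ∈ Finset.range n, y ^ q ^ i = 0 ∧
  ∑ i ∈ Finset.range n, w ^ q ^ i * y ^ q ^ (i + (n - 1)) = 1 ∧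
  ∀ j, 1 ≤ j → j ≤ n - 2 → ∑ i ∈ Finset.range n, w ^ q ^ i * y ^ q ^ (i + j) = 0

theorem packNormalCheck_eq_true
    (hR : ∀ a y, PackRep θ K (N + N) a y → PackRep θ E N (R a) y)
    (hC : ∀ a b y z, PackRep θ K (N + N) a y → PackRep θ K N b z → C a b = true → y = z)
    (hK : E * E * n ≤ K) (hE : 1 ≤ E) (hN : 1 ≤ N) (hn : 2 ≤ n) {u : ℕ} {w : A}
    (ha : PackRep θ E N a y) (hu : PackRep θ E N u w)
    (h : packNormalCheck R C q n u a = true) :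
    TraceCertificate q n y w := by
  have hK' : E * E ≤ K := (Nat.le_mul_of_pos_right _ (by omega)).trans hK
  have hK1 : 1 ≤ K := (Nat.mul_pos hE hE).trans_le hK'
  have hzero : PackRep θ K N 0 (0 : A) := (packRep_zero θ).mono (Nat.zero_le _) (Nat.zero_le _)
  have hone : PackRep θ K N 1 (1 : A) := by simpa using (packRep_const θ 1).mono hK1 hN
  obtain ⟨U, h, hU⟩ := packConj_eq_true hR hK' hE hN hu .nil h
  obtain ⟨V, h, hV⟩ := packConj_eq_true hR hK' hE hN ha .nil h
  rw [List.append_nil] at hU hV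
  have hlen : U.length ≤ n := by rw [hU.length_eq]; simp
  simp only [Bool.and_eq_true] at h
  obtain ⟨⟨h1, h2⟩, h3⟩ := h
  have hdrop : ∀ j ≤ n - 1, (List.zipWith (· * ·) ((List.range n).reverse.map fun i => w ^ q ^ i)
      (((List.range (2 * n - 1)).reverse.map fun i => y ^ q ^ i).drop (n - 1 - j))).sum =
      ∑ i ∈ Finset.range n, w ^ q ^ i * y ^ q ^ (i + j) := by
    intro j hj
    rw [← List.map_drop, drop_reverse_range,
      show 2 * n - 1 - (n - 1 - j) = n + j by omega, sum_zipWith_map_reverse_range]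
  refine ⟨?_, ?_, ?_⟩
  · have hrep : List.Forall₂ (PackRep θ E N) (List.replicate n 1)
        ((List.range n).reverse.map fun _ => (1 : A)) := by
      rw [List.map_const', List.length_reverse, List.length_range, List.forall₂_iff_get]
      refine ⟨by simp, fun i _ _ => ?_⟩
      simpa using (packRep_const θ 1).mono hE hN
    have h4 := hC _ _ _ _ (packRep_packDot hK hrep (List.forall₂_drop (n - 1) hV) (by simp))
      hzero h3
    rw [← List.map_drop, drop_reverse_range, show 2 * n - 1 - (n - 1) = n + 0 by omega,
      sum_zipWith_map_reverse_range] at h4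
    simpa using h4
  · rw [← hdrop (n - 1) le_rfl, Nat.sub_self, List.drop_zero]
    exact hC _ _ _ _ (packRep_packDot hK hU hV hlen) hone h1
  · intro j hj hj'
    have hV' : List.Forall₂ (PackRep θ E N) V.tail
        (((List.range (2 * n - 1)).reverse.map fun i => y ^ q ^ i).drop 1) := by
      rw [← List.drop_one]; exact List.forall₂_drop 1 hV
    have := packOrtho_eq_true hC hK hU hV' hlen h2 (n - 2 - j) (by omega)
    rw [List.drop_drop, show 1 + (n - 2 - j) = n - 1 - j by omega, hdrop j (by omega)] at this
    exact this

end PackedChecks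

section PackedChecks

variable {A : Type*} [CommRing A] {θ : A}

theorem PackRep.packOrderProd {K E N a : ℕ} {R : ℕ → ℕ} {y : A} {p : ℕ}
    (hR : ∀ a y, PackRep θ K (N + N) a y → PackRep θ E N (R a) y)
    (hK : E * E * 2 ≤ K) (hE : 1 ≤ E) (hN : 1 ≤ N) (hp : (p : A) = 0) (hp0 : 0 < p) (hpE : p ≤ E)
    (h : PackRep θ E N a y) (m : ℕ) (P : List ℕ) :
    PackRep θ E N (packOrderProd R (p - 1) m a P) (P.map fun r => y ^ (m / r) - 1).prod := by
  have hK' : E * E ≤ K := by omega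
  induction P with
  | nil => simpa [_root_.packOrderProd] using (packRep_const θ 1).mono hE hN
  | cons r P ih =>
    have hc : PackRep θ p N (p - 1) (-1 : A) := by
      have := (packRep_const θ (p - 1)).mono (Nat.sub_le p 1) hN
      rwa [Nat.cast_sub hp0, hp, Nat.cast_one, zero_sub] at this
    have h1 := hR _ _ (((h.packPow hR hK' hE hN (m / r)).add hc).mono
      (S' := K) (L' := N + N) (by nlinarith) (by omega))
    rw [← sub_eq_add_neg] at h1
    rw [_root_.packOrderProd, forceNat_eq, List.map_cons, List.prod_cons]
    exact hR _ _ ((h1.mul ih).mono hK' le_rfl)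

theorem explicitCheck_eq_true {p N q n : ℕ} {P : List ℕ} {t a b w u v : ℕ}
    (h : explicitCheck p N q n P t a b w u v = true) (hp : (p : A) = 0) (hp0 : 0 < p)
    (hN : 16 ≤ N) (hn : 2 ≤ n)
    (hb : N * (2 * p) * (N * (2 * p)) * n * (1 + 8 * p) * (1 + 8 * p) < 2 ^ 64)
    (hθ : θ ^ N = aeval θ (digitPoly p 8 t)) :
    θ ^ p ^ N = θ ∧ ∃ α β γ μ ν : A, α * β = 1 ∧ α ^ (p ^ N - 1) = 1 ∧
      (P.map fun r => α ^ ((p ^ N - 1) / r) - 1).prod * γ = 1 ∧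
      TraceCertificate q n α μ ∧ TraceCertificate q n β ν := by
  simp only [explicitCheck, forceNat_eq] at h
  rw [← packMask_eq] at h
  have ht := packRep_packBase θ hp0 8 t
  rw [← hθ] at ht
  set E := N * (2 * p) with hE
  set K := E * E * n with hK
  set T := packBase p 8 t
  set R := packReduce p (18446744073709551616 / p) (packMask N) (wordBase ^ N) T with hRdef
  have hpE : p ≤ E := by rw [hE]; nlinarith
  have hNp : N * p ≤ E := by rw [hE]; nlinarith
  have hR : ∀ a y, PackRep θ K (N + N) a y → PackRep θ E N (R a) y := fun a y hy =>
    PackRep.packReduce hp hp0 ht (by omega) hy hb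
  have hE1 : 1 ≤ E := by omega
  have hN1 : 1 ≤ N := by omega
  have hK2 : E * E * 2 ≤ K := Nat.mul_le_mul_left _ hn
  have hK1 : E * E ≤ K := by omega
  have hEK : E ≤ K := le_trans (Nat.le_mul_of_pos_right _ hE1) hK1
  have hw : (2 : ℕ) ^ 64 < wordBase := by norm_num [wordBase]
  have hKw : K < wordBase := by
    refine lt_of_le_of_lt ?_ (hb.trans hw)
    rw [mul_assoc]; exact Nat.le_mul_of_pos_right _ (by positivity)
  have hC : ∀ a b y z, PackRep θ K (N + N) a y → PackRep θ K N b z →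
      packEq R p N a b = true → y = z := by
    intro a b y z hy hz hab
    have h1 := (hR a y hy).packNorm hp hp0 (by omega)
    rw [packEq, forceNat_eq] at hab
    rw [Nat.eq_of_beq_eq_true hab] at h1
    exact h1.unique hz (by omega) hKw
  have hone : PackRep θ K N 1 (1 : A) := by
    simpa using (packRep_const θ 1).mono (hE1.trans hEK) hN1
  have hX : PackRep θ E N wordBase θ := (packRep_wordBase θ).mono hE1 (by omega)
  have hin : ∀ c, PackRep θ E N (packBase p N c) (aeval θ (digitPoly p N c)) := fun c =>
    (packRep_packBase θ hp0 N c).mono hNp le_rfl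
  simp only [packCheck, Bool.and_eq_true] at h
  obtain ⟨⟨⟨⟨⟨h1, h2⟩, h3⟩, h4⟩, h5⟩, h6⟩ := h
  refine ⟨?_, aeval θ (digitPoly p N a), aeval θ (digitPoly p N b), aeval θ (digitPoly p N w),
    aeval θ (digitPoly p N u), aeval θ (digitPoly p N v), ?_, ?_, ?_, ?_, ?_⟩
  · exact hC _ _ _ _ ((hX.packPow hR hK1 hE1 hN1 _).mono hEK (by omega)) (hX.mono hEK le_rfl) h1
  · exact hC _ _ _ _ (((hin a).mul (hin b)).mono hK1 le_rfl) hone h2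
  · exact hC _ _ _ _ (((hin a).packPow hR hK1 hE1 hN1 _).mono hEK (by omega)) hone h3
  · exact hC _ _ _ _ ((((hin a).packOrderProd hR hK2 hE1 hN1 hp hp0 hpE _ P).mul (hin w)).mono
      hK1 le_rfl) hone h4
  · exact packNormalCheck_eq_true hR hC le_rfl hE1 hN1 hn (hin a) (hin u) h5
  · exact packNormalCheck_eq_true hR hC le_rfl hE1 hN1 hn (hin b) (hin v) h6

end PackedChecks

section ExplicitPairs

variable {Fq F : Type*} [Field Fq] [Field F] [Fintype Fq] [Fintype F] [Algebra Fq F]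

theorem isKNormal_one_of_traceCertificate {q n : ℕ} (hq : Fintype.card Fq = q) (hn : 2 ≤ n)
    {α u : F} (h : TraceCertificate q n α u) : IsKNormal Fq q n 1 α := by
  obtain ⟨h0, h1, h2⟩ := h
  have hact : ∀ g : Fq[X], polyAct q g α = aeval (frobEnd Fq F) g α := fun g => by
    rw [aeval_frobEnd_apply, hq, polyAct]
  set T : Fq[X] := ∑ i ∈ Finset.range n, X ^ i with hT
  have hTapply : ∀ x : F, aeval (frobEnd Fq F) T x = ∑ i ∈ Finset.range n, x ^ q ^ i := by
    intro x
    simp [hT, frobEnd_pow_apply, hq]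
  have hTdeg : T.natDegree = n - 1 := by
    have h := congrArg natDegree (geom_sum_mul (X : Fq[X]) n)
    rw [← C_1, (monic_geom_sum_X (by omega)).natDegree_mul (monic_X_sub_C (1 : Fq)),
      natDegree_X_sub_C, natDegree_X_pow_sub_C, ← hT] at h
    omega
  refine ⟨T, ⟨monic_geom_sum_X (by omega), ?_, ?_, ?_⟩, hTdeg⟩
  · exact ⟨X - 1, (geom_sum_mul X n).symm⟩
  · rw [hact, hTapply, h0]
  · intro g hg _ hgα
    rw [hact] at hgα
    rw [hTdeg]
    by_contra! hlt
    set d := g.natDegree with hd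
    set G : Fq[X] := X ^ (n - 1 - d) * g with hG
    have hGm : G.Monic := (monic_X_pow _).mul hg
    have hGd : G.natDegree = n - 1 := by
      rw [hG, (monic_X_pow _).natDegree_mul hg, natDegree_X_pow]; omega
    have hG0 : G.coeff 0 = 0 := by
      rw [hG, coeff_X_pow_mul', if_neg (by omega)]
    have hGα : aeval (frobEnd Fq F) G α = 0 := by
      rw [hG, map_mul, Module.End.mul_apply, hgα, map_zero]
    have hsum : ∑ j ∈ Finset.range n, G.coeff j • α ^ q ^ j = 0 := by
      rw [← hGα, aeval_eq_sum_range' (n := n) (by omega)]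
      simp [frobEnd_pow_apply, hq]
    have hz : aeval (frobEnd Fq F) T (u * ∑ j ∈ Finset.range n, G.coeff j • α ^ q ^ j) = 0 := by
      rw [hsum, mul_zero, map_zero]
    rw [Finset.mul_sum, map_sum] at hz
    have hterm : ∀ j, aeval (frobEnd Fq F) T (u * G.coeff j • α ^ q ^ j) =
        G.coeff j • ∑ i ∈ Finset.range n, u ^ q ^ i * α ^ q ^ (i + j) := by
      intro j
      rw [mul_smul_comm, map_smul, hTapply]
      congr 1
      refine Finset.sum_congr rfl fun i _ => ?_
      rw [mul_pow, ← pow_mul, ← pow_add, add_comm j]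
    rw [Finset.sum_eq_single (n - 1), hterm, h1] at hz
    · have : G.coeff (n - 1) = 1 := by rw [← hGd]; exact hGm
      rw [this, one_smul] at hz
      exact one_ne_zero hz
    · intro j hj hj'
      rw [Finset.mem_range] at hj
      rw [hterm]
      rcases Nat.eq_zero_or_pos j with rfl | hj0
      · rw [hG0, zero_smul]
      · rw [h2 j hj0 (by omega), smul_zero]
    · intro hn'
      exact absurd (Finset.mem_range.2 (by omega)) hn'

theorem aeval_X_pow_sub_map_natCast {B : Type*} [CommRing B] {p : ℕ} [Algebra (ZMod p) B] (θ : B)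
    (N : ℕ) (g : ℕ[X]) :
    aeval θ (X ^ N - g.map (Nat.castRingHom (ZMod p))) = θ ^ N - aeval θ g := by
  rw [map_sub, map_pow, aeval_X, aeval_def, eval₂_map, aeval_def]
  congr 2
  exact ext_nat _ _

theorem exists_root_of_forall_pow_eq {p N : ℕ} [Fact p.Prime] [CharP F p]
    (hF : Fintype.card F = p ^ N) (hN : 0 < N) {g : ℕ[X]} (hg : g.degree < N)
    (h : ∀ (B : Type) [CommRing B] (θ : B), (p : B) = 0 → θ ^ N = aeval θ g → θ ^ p ^ N = θ) :
    ∃ θ : F, θ ^ N = aeval θ g := by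
  let := ZMod.algebra F p
  set g' : (ZMod p)[X] := g.map (Nat.castRingHom _) with hg'
  have hg'd : g'.degree < N := degree_map_le.trans_lt hg
  set m : (ZMod p)[X] := X ^ N - g' with hm
  have hroot := h (AdjoinRoot m) (AdjoinRoot.root m) (by
    rw [← map_natCast (algebraMap (ZMod p) (AdjoinRoot m)), CharP.cast_eq_zero, map_zero]) (by
    rw [← sub_eq_zero, ← aeval_X_pow_sub_map_natCast (p := p), ← hg', ← hm, AdjoinRoot.aeval_eq, AdjoinRoot.mk_self])
  have hdvd : m ∣ X ^ p ^ N - X := by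
    rw [← AdjoinRoot.mk_eq_zero, map_sub, map_pow, AdjoinRoot.mk_X, hroot, sub_self]
  have hs := (FiniteField.isSplittingField_sub F (ZMod p)).splits
  rw [hF] at hs
  have hne : ((X ^ p ^ N - X : (ZMod p)[X]).map (algebraMap (ZMod p) F)) ≠ 0 := by
    rw [Polynomial.map_sub, Polynomial.map_pow, map_X]
    exact FiniteField.X_pow_card_pow_sub_X_ne_zero F hN.ne' (Fact.out : p.Prime).one_lt
  have hs' := hs.of_dvd hne (Polynomial.map_dvd _ hdvd)
  have hmd : m.degree = N := by
    rw [hm, degree_sub_eq_left_of_degree_lt (by rwa [degree_X_pow]), degree_X_pow]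
  obtain ⟨θ, hθ⟩ := hs'.exists_eval_eq_zero (by
    rw [degree_map, hmd]; exact_mod_cast hN.ne')
  refine ⟨θ, ?_⟩
  rwa [eval_map_algebraMap, hm, hg', aeval_X_pow_sub_map_natCast, sub_eq_zero] at hθ

theorem exists_pair_of_explicitCheck {p N q n : ℕ} {P : List ℕ} {t a b w u v : ℕ}
    (h : explicitCheck p N q n P t a b w u v = true) (hp : p.Prime) (hN : 16 ≤ N) (hn2 : 2 ≤ n)
    (hb : N * (2 * p) * (N * (2 * p)) * n * (1 + 8 * p) * (1 + 8 * p) < 2 ^ 64)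
    (hpN : p ^ N = q ^ n) (hP : ∀ r ∈ P, r.Prime) (hdvd : p ^ N - 1 ∣ P.prod ^ 10)
    (hq : Fintype.card Fq = q) (hn : Module.finrank Fq F = n) :
    ∃ α : F, α ≠ 0 ∧ orderOf α = q ^ n - 1 ∧ orderOf α⁻¹ = q ^ n - 1 ∧
      IsKNormal Fq q n 1 α ∧ IsKNormal Fq q n 1 α⁻¹ := by
  have hF : Fintype.card F = p ^ N := by
    rw [Module.card_eq_pow_finrank (K := Fq), hq, hn, hpN]
  have : Fact p.Prime := ⟨hp⟩
  have : CharP F p := charP_of_card_eq_prime_pow hF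
  have hdeg : (digitPoly p 8 t).degree < N :=
    (degree_digitPoly_lt p 8 t).trans_le (by exact_mod_cast (by omega : 8 ≤ N))
  obtain ⟨θ, hθ⟩ := exists_root_of_forall_pow_eq hF (by omega) hdeg fun B _ θ hp' hθ =>
    (explicitCheck_eq_true h hp' hp.pos hN hn2 hb hθ).1
  obtain ⟨-, α, β, γ, μ, ν, h1, h2, h3, h4, h5⟩ :=
    explicitCheck_eq_true h (CharP.cast_eq_zero F p) hp.pos hN hn2 hb hθ
  have hα : α ≠ 0 := left_ne_zero_of_mul_eq_one h1
  have hβ : α⁻¹ = β := inv_eq_of_mul_eq_one_right h1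
  have hord : orderOf α = q ^ n - 1 := by
    rw [← hpN]
    have hpos : 0 < p ^ N - 1 := by
      have : 1 < p ^ N := Nat.one_lt_pow (by omega) hp.one_lt
      omega
    refine orderOf_eq_of_pow_and_pow_div_prime hpos h2 fun r hr hrd hr1 => ?_
    have hrP : r ∈ P := by
      obtain ⟨s, hs, hrs⟩ := (Prime.dvd_prod_iff hr.prime).1 (hr.dvd_of_dvd_pow (hrd.trans hdvd))
      rwa [(Nat.prime_dvd_prime_iff_eq hr (hP s hs)).1 hrs]
    refine left_ne_zero_of_mul_eq_one h3 (List.prod_eq_zero ?_)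
    exact List.mem_map.2 ⟨r, hrP, by rw [hr1, sub_self]⟩
  refine ⟨α, hα, hord, ?_, isKNormal_one_of_traceCertificate hq hn2 h4, ?_⟩
  · lift α to Fˣ using hα.isUnit
    rw [← Units.val_inv_eq_inv_val, orderOf_units, orderOf_inv, ← orderOf_units, hord]
  · rw [hβ]; exact isKNormal_one_of_traceCertificate hq hn2 h5

end ExplicitPairs

section ExplicitPairs

variable {Fq F : Type*} [Field Fq] [Field F] [Fintype Fq] [Fintype F] [Algebra Fq F]

theorem explicitCheck_4_15 : explicitCheck 2 30 4 15 [3, 7, 11, 31, 151, 331]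
    3
    510685971
    170038733
    868736371
    188949922
    422597834 = true := by
  decide +kernel

theorem explicitCheck_4_18 : explicitCheck 2 36 4 18 [3, 5, 7, 13, 19, 37, 73, 109]
    53
    5185456061
    31592852656
    36276080411
    50801933148
    46734196242 = true := by
  decide +kernel

theorem explicitCheck_5_16 : explicitCheck 5 16 5 16 [2, 3, 13, 17, 313, 11489]
    109
    149905473066
    30787767010
    94044752446
    78459274395
    83512300085 = true := by
  decide +kernel

theorem explicitCheck_8_14 : explicitCheck 2 42 8 14 [3, 7, 43, 127, 337, 5419]
    119
    3550523470731
    590460126618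
    3902640447175
    2253258052134
    2648737267052 = true := by
  decide +kernel

theorem explicitCheck_9_16 : explicitCheck 3 32 9 16 [2, 5, 17, 41, 193, 21523361]
    196
    677518393942626
    1356780513755701
    727867275647996
    211455371956860
    211105255113066 = true := by
  decide +kernel

theorem explicitCheck_16_15 : explicitCheck 2 60 16 15 [3, 5, 7, 11, 13, 31, 41, 61, 151, 331, 1321]
    3
    226876671619941715
    301917660494656322
    1054700317594700112
    10971164318989338
    11031047199628248 = true := by
  decide +kernel

theorem explicitCheck_17_16 : explicitCheck 17 16 17 16 [2, 3, 5, 29, 18913, 41761, 184417]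
    6
    47581010158091105035
    37192348287258346408
    19572604026836285893
    6891738999659811957
    20795220606760035786 = true := by
  decide +kernel

theorem explicitCheck_19_18 : explicitCheck 19 18 19 18 [2, 3, 5, 7, 127, 199, 523, 29989, 236377]
    14
    90517538478794171054418
    76659665474262441409054
    9023803850005193755608
    76529088125058955411962
    83750339688080760827699 = true := by
  decide +kernel

theorem exists_pair_of_mem_explicitCases {q n : ℕ} (h : (q, n) ∈ explicitCases)
    (hq : Fintype.card Fq = q) (hn : Module.finrank Fq F = n) :
    ∃ α : F, α ≠ 0 ∧ orderOf α = q ^ n - 1 ∧ orderOf α⁻¹ = q ^ n - 1 ∧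
      IsKNormal Fq q n 1 α ∧ IsKNormal Fq q n 1 α⁻¹ := by
  simp only [explicitCases, List.mem_cons, Prod.mk.injEq, List.not_mem_nil, or_false] at h
  rcases h with ⟨rfl, rfl⟩ | ⟨rfl, rfl⟩ | ⟨rfl, rfl⟩ | ⟨rfl, rfl⟩ | ⟨rfl, rfl⟩ | ⟨rfl, rfl⟩ |
    ⟨rfl, rfl⟩ | ⟨rfl, rfl⟩
  · exact exists_pair_of_explicitCheck explicitCheck_4_15 (by norm_num) (by norm_num)
      (by norm_num) (by norm_num) (by norm_num) (by norm_num) (by norm_num) hq hn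
  · exact exists_pair_of_explicitCheck explicitCheck_4_18 (by norm_num) (by norm_num)
      (by norm_num) (by norm_num) (by norm_num) (by norm_num) (by norm_num) hq hn
  · exact exists_pair_of_explicitCheck explicitCheck_5_16 (by norm_num) (by norm_num)
      (by norm_num) (by norm_num) (by norm_num) (by norm_num) (by norm_num) hq hn
  · exact exists_pair_of_explicitCheck explicitCheck_8_14 (by norm_num) (by norm_num)
      (by norm_num) (by norm_num) (by norm_num) (by norm_num) (by norm_num) hq hn
  · exact exists_pair_of_explicitCheck explicitCheck_9_16 (by norm_num) (by norm_num)
      (by norm_num) (by norm_num) (by norm_num) (by norm_num) (by norm_num) hq hn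
  · exact exists_pair_of_explicitCheck explicitCheck_16_15 (by norm_num) (by norm_num)
      (by norm_num) (by norm_num) (by norm_num) (by norm_num) (by norm_num) hq hn
  · exact exists_pair_of_explicitCheck explicitCheck_17_16 (by norm_num) (by norm_num)
      (by norm_num) (by norm_num) (by norm_num) (by norm_num) (by norm_num) hq hn
  · exact exists_pair_of_explicitCheck explicitCheck_19_18 (by norm_num) (by norm_num)
      (by norm_num) (by norm_num) (by norm_num) (by norm_num) (by norm_num) hq hn

end ExplicitPairs

/-- For every prime power `q > 3` and every `n ≥ 14` there is `α ∈ F_{q^n}^*` such that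
both `α` and `α⁻¹` are simultaneously primitive and `1`-normal over `F_q`. -/
theorem exists_primitive_one_normal_pair_of_three_lt_of_fourteen_le
    (q n : ℕ) (hq : IsPrimePow q) (hq3 : 3 < q) (hn : 14 ≤ n)
    (Fq F : Type*) [Field Fq] [Field F] [Fintype Fq] [Fintype F] [Algebra Fq F]
    (hcard : Fintype.card Fq = q) (hdim : Module.finrank Fq F = n) :
    ∃ α : F, α ≠ 0 ∧ orderOf α = q ^ n - 1 ∧ orderOf α⁻¹ = q ^ n - 1 ∧
      IsKNormal Fq q n 1 α ∧ IsKNormal Fq q n 1 α⁻¹ := by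
  rcases le_or_gt 256 q with h256 | h256
  · exact exists_pair_of_large h256 hn hcard hdim
  rcases le_or_gt (rangeBound q) n with hb | hb
  · exact exists_pair_of_rangeBound_le hq hq3 h256 hn hb hcard hdim
  by_cases hex : (q, n) ∈ explicitCases
  · exact exists_pair_of_mem_explicitCases hex hcard hdim
  · exact exists_pair_of_lt_rangeBound hq hq3 h256 hn hb hex hcard hdim

end
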